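/- Let τ₀ ∈ ℍ and k ∈ {1,2,3}. Equation (★_k) on E_{τ₀} has a non-even family of solutions if and only if there exists (r,s) ∈ ℝ² ∖ (1/2)ℤ² such that Z(r,s,τ₀) = 0; equivalently, if and only if the equation Δu + e^u = 8πδ₀ on the same torus E_{τ₀} has a solution. -/

import Mathlib

open Metric Set Filter Topology

noncomputable section

def lat (τ : ℂ) : Set ℂ := {z | ∃ m n : ℤ, z = (m : ℂ) + (n : ℂ) * τ}

def latPt (τ : ℂ) (p : ℤ × ℤ) : ℂ := (p.1 : ℂ) + (p.2 : ℂ) * τ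

def wp (τ z : ℂ) : ℂ :=
  1 / z ^ 2 + ∑' p : {p : ℤ × ℤ // p ≠ 0},
    (1 / (z - latPt τ p.1) ^ 2 - 1 / latPt τ p.1 ^ 2)

def wpd (τ z : ℂ) : ℂ := deriv (wp τ) z

def wpdd (τ z : ℂ) : ℂ := deriv (deriv (wp τ)) z

def wzeta (τ z : ℂ) : ℂ :=
  1 / z + ∑' p : {p : ℤ × ℤ // p ≠ 0},
    (1 / (z - latPt τ p.1) + 1 / latPt τ p.1 + z / latPt τ p.1 ^ 2)

def wsigma (τ z : ℂ) : ℂ :=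
  z * ∏' p : {p : ℤ × ℤ // p ≠ 0},
    ((1 - z / latPt τ p.1) * Complex.exp (z / latPt τ p.1 + z ^ 2 / (2 * latPt τ p.1 ^ 2)))

def per (τ : ℂ) : ℕ → ℂ
  | 0 => 0
  | 1 => 1
  | 2 => τ
  | 3 => 1 + τ
  | _ => 0

def eper (τ : ℂ) (k : ℕ) : ℂ := wp τ (per τ k / 2)

def eta1 (τ : ℂ) : ℂ := 2 * wzeta τ (1 / 2)

def eta2 (τ : ℂ) : ℂ := 2 * wzeta τ (τ / 2)

def etaq (τ : ℂ) : ℕ → ℂ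
  | 1 => eta1 τ
  | 2 => eta2 τ
  | 3 => eta1 τ + eta2 τ
  | _ => 0

def heckeZ (r s τ : ℂ) : ℂ := wzeta τ (r + s * τ) - r * eta1 τ - s * eta2 τ

def heckeZm (k : ℕ) (r s τ : ℂ) : ℂ := heckeZ r s τ ^ 2 - wp τ (r + s * τ) + eper τ k

def rkr (k : ℕ) (r : ℂ) : ℂ := if k = 2 then r else r + 1 / 2

def rks (k : ℕ) (s : ℂ) : ℂ := if k = 1 then s else s + 1 / 2

def IsHalfIntPair (r s : ℂ) : Prop := ∃ m n : ℤ, r = (m : ℂ) / 2 ∧ s = (n : ℂ) / 2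

def singSet (τ : ℂ) (m : Fin 4 → ℕ) : Set ℂ :=
  {z | ∃ k : Fin 4, 1 ≤ m k ∧ ∃ l ∈ lat τ, z = per τ (k : ℕ) / 2 + l}

def lapl (u : ℂ → ℝ) (z : ℂ) : ℝ :=
  fderiv ℝ (fun w => fderiv ℝ u w (1 : ℂ)) z (1 : ℂ) +
  fderiv ℝ (fun w => fderiv ℝ u w Complex.I) z Complex.I

def IsCurvatureSolution (τ : ℂ) (m : Fin 4 → ℕ) (u : ℂ → ℝ) : Prop :=
  (∀ z, u (z + 1) = u z) ∧ (∀ z, u (z + τ) = u z) ∧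
  (∀ z ∉ singSet τ m, (∀ n : ℕ, ContDiffAt ℝ n u z) ∧ lapl u z + Real.exp (u z) = 0) ∧
  (∀ k : Fin 4, 1 ≤ m k → ∀ l ∈ lat τ,
    ∃ C ε : ℝ, 0 < ε ∧ ∀ z : ℂ, z ≠ per τ (k : ℕ) / 2 + l →
      dist z (per τ (k : ℕ) / 2 + l) < ε →
      |u z - 4 * (m k : ℝ) * Real.log (dist z (per τ (k : ℕ) / 2 + l))| ≤ C)

def starM (k : ℕ) : Fin 4 → ℕ := fun j => if (j : ℕ) = 0 ∨ (j : ℕ) = k then 1 else 0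

def IsDevelopingMapOf (u : ℂ → ℝ) (f : ℂ → ℂ) : Prop :=
  (∀ z : ℂ, MeromorphicAt f z) ∧
  ∀ z : ℂ, AnalyticAt ℂ f z → deriv f z ≠ 0 →
    u z = Real.log (8 * ‖deriv f z‖ ^ 2 / (1 + ‖f z‖ ^ 2) ^ 2)

def IsTypeII (τ : ℂ) (f : ℂ → ℂ) : Prop :=
  ∃ θ₁ θ₂ : ℝ,
    (∀ z, f (z + 1) = Complex.exp (2 * Complex.I * (θ₁ : ℂ)) * f z) ∧
    (∀ z, f (z + τ) = Complex.exp (2 * Complex.I * (θ₂ : ℂ)) * f z)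

def FamilyHasEven (τ : ℂ) (m : Fin 4 → ℕ) (f : ℂ → ℂ) : Prop :=
  ∃ (β : ℝ) (v : ℂ → ℝ), IsCurvatureSolution τ m v ∧
    IsDevelopingMapOf v (fun z => (Real.exp β : ℂ) * f z) ∧ ∀ z, v (-z) = v z

def GeneratesNonEvenFamily (τ : ℂ) (m : Fin 4 → ℕ) (u : ℂ → ℝ) (f : ℂ → ℂ) : Prop :=
  IsCurvatureSolution τ m u ∧ IsDevelopingMapOf u f ∧ IsTypeII τ f ∧ ¬ FamilyHasEven τ m f

def HasNonEvenFamily (τ : ℂ) (m : Fin 4 → ℕ) : Prop :=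
  ∃ u f, GeneratesNonEvenFamily τ m u f

def HasEvenFamily (τ : ℂ) (m : Fin 4 → ℕ) : Prop :=
  ∃ (u : ℂ → ℝ) (f : ℂ → ℂ), IsCurvatureSolution τ m u ∧ IsDevelopingMapOf u f ∧
    IsTypeII τ f ∧ FamilyHasEven τ m f

def SolvesODEOn (q : ℂ → ℂ) (S : Set ℂ) (y : ℂ → ℂ) : Prop :=
  (∀ z : ℂ, MeromorphicAt y z) ∧
  ∀ z ∉ S, AnalyticAt ℂ y z ∧ deriv (deriv y) z = q z * y z

def LinIndepOn (S : Set ℂ) (y₁ y₂ : ℂ → ℂ) : Prop :=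
  ∀ a b : ℂ, (∀ z ∉ S, a * y₁ z + b * y₂ z = 0) → a = 0 ∧ b = 0

def HasUnitaryMonodromy (q : ℂ → ℂ) (S : Set ℂ) (τ : ℂ) : Prop :=
  ∃ y₁ y₂ : ℂ → ℂ, SolvesODEOn q S y₁ ∧ SolvesODEOn q S y₂ ∧ LinIndepOn S y₁ y₂ ∧
    ∃ M₁ M₂ : Matrix (Fin 2) (Fin 2) ℂ,
      M₁ ∈ Matrix.unitaryGroup (Fin 2) ℂ ∧ M₁.det = 1 ∧
      M₂ ∈ Matrix.unitaryGroup (Fin 2) ℂ ∧ M₂.det = 1 ∧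
      (∀ z, y₁ (z + 1) = M₁ 0 0 * y₁ z + M₁ 0 1 * y₂ z) ∧
      (∀ z, y₂ (z + 1) = M₁ 1 0 * y₁ z + M₁ 1 1 * y₂ z) ∧
      (∀ z, y₁ (z + τ) = M₂ 0 0 * y₁ z + M₂ 0 1 * y₂ z) ∧
      (∀ z, y₂ (z + τ) = M₂ 1 0 * y₁ z + M₂ 1 1 * y₂ z)

def LPot (k : ℕ) (T E τ : ℂ) (z : ℂ) : ℂ :=
  2 * wp τ z + 2 * wp τ (z - per τ k / 2) +
    T * (wzeta τ (z - per τ k / 2) - wzeta τ z) - E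

def LSing (τ : ℂ) (k : ℕ) : Set ℂ := {z | ∃ l ∈ lat τ, z = l ∨ z = per τ k / 2 + l}

def ApparentAt (q : ℂ → ℂ) (p : ℂ) : Prop :=
  ∃ (y₁ y₂ : ℂ → ℂ) (ε : ℝ), 0 < ε ∧
    (∀ z ∈ Metric.ball p ε, z ≠ p →
      AnalyticAt ℂ y₁ z ∧ AnalyticAt ℂ y₂ z ∧
      deriv (deriv y₁) z = q z * y₁ z ∧ deriv (deriv y₂) z = q z * y₂ z) ∧
    MeromorphicAt y₁ p ∧ MeromorphicAt y₂ p ∧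
    ∀ a b : ℂ, (∀ z ∈ Metric.ball p ε, z ≠ p → a * y₁ z + b * y₂ z = 0) → a = 0 ∧ b = 0

def qPot (k : ℕ) (T E τ : ℂ) (z : ℂ) : ℂ :=
  2 * (wp τ (z + per τ k / 4) + wp τ (z - per τ k / 4)) +
    T * (wzeta τ (z + per τ k / 4) - wzeta τ (z - per τ k / 4)) - E

def qSing (τ : ℂ) (k : ℕ) : Set ℂ :=
  {z | ∃ l ∈ lat τ, z = per τ k / 4 + l ∨ z = -(per τ k / 4) + l}

def PhiE (τ : ℂ) (k : ℕ) (T E : ℂ) (z : ℂ) : ℂ :=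
  (wpd τ (per τ k / 4)) ^ 4 / (wp τ z - wp τ (per τ k / 4)) ^ 2 +
  (wpd τ (per τ k / 4)) ^ 2 * (wpd τ (per τ k / 4) * T + wpdd τ (per τ k / 4)) /
      (wp τ z - wp τ (per τ k / 4)) +
  (1 / 4) * (4 * (wpd τ (per τ k / 4)) ^ 2 * E + 3 * (wpd τ (per τ k / 4)) ^ 2 * T ^ 2
    - 8 * wzeta τ (per τ k / 4) * (wpd τ (per τ k / 4)) ^ 2 * T
    + 32 * wp τ (per τ k / 4) * (wpd τ (per τ k / 4)) ^ 2
    - 3 * (wpdd τ (per τ k / 4)) ^ 2)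

def otherTwo : ℕ → ℕ × ℕ
  | 1 => (2, 3)
  | 2 => (1, 3)
  | 3 => (1, 2)
  | _ => (0, 0)

def wirt (g : ℂ → ℂ) (z : ℂ) : ℂ :=
  (1 / 2) * (fderiv ℝ g z (1 : ℂ) - Complex.I * fderiv ℝ g z Complex.I)

def uPot (u : ℂ → ℝ) (z : ℂ) : ℂ :=
  -(1 / 2) * (wirt (wirt (fun w => ((u w : ℝ) : ℂ))) z -
    (1 / 2) * (wirt (fun w => ((u w : ℝ) : ℂ)) z) ^ 2)

def fullSing (τ : ℂ) : Set ℂ := {z | ∃ k : Fin 4, ∃ l ∈ lat τ, z = per τ (k : ℕ) / 2 + l}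

def q8 (τ : ℂ) (m : Fin 4 → ℕ) (T₁ T₂ T₃ E : ℂ) (z : ℂ) : ℂ :=
  (∑ k : Fin 4, (m k : ℂ) * ((m k : ℂ) + 1) * wp τ (z - per τ (k : ℕ) / 2)) +
  T₁ * (wzeta τ (z - per τ 1 / 2) - wzeta τ z) +
  T₂ * (wzeta τ (z - per τ 2 / 2) - wzeta τ z) +
  T₃ * (wzeta τ (z - per τ 3 / 2) - wzeta τ z) - E

def sigY (τ : ℂ) (k : ℕ) (a₁ a₂ c : ℂ) (z : ℂ) : ℂ :=
  Complex.exp (c * z) * wsigma τ (z - a₁) * wsigma τ (z - a₂) /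
    (wsigma τ (z - per τ k / 4) * wsigma τ (z + per τ k / 4))

end

open Metric Set Filter Topology
noncomputable section
open ComplexConjugate ContDiff
local notation "CC" => ℂ
local notation "RR" => ℝ

def WL (a b : CC) : CC →L[RR] CC := a • (1 : CC →L[RR] CC) + b • (Complex.conjCLE : CC →L[RR] CC)

@[simp] lemma WL_apply (a b v : CC) : WL a b v = a * v + b * conj v := by simp [WL]

def HasW (g : CC → CC) (a b z : CC) : Prop := HasFDerivAt g (WL a b) z

def dz (g : CC → CC) (z : CC) : CC := (fderiv RR g z 1 - Complex.I * fderiv RR g z Complex.I) / 2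
def db (g : CC → CC) (z : CC) : CC := (fderiv RR g z 1 + Complex.I * fderiv RR g z Complex.I) / 2

lemma clm_eq_WL (L : CC →L[RR] CC) :
    L = WL ((L 1 - Complex.I * L Complex.I) / 2) ((L 1 + Complex.I * L Complex.I) / 2) := by
  have h : ∀ v : CC, L v = v.re * L 1 + v.im * L Complex.I := by
    intro v
    conv_lhs => rw [← Complex.re_add_im v, mul_comm]
    have e : ((v.re : CC) + Complex.I * v.im) = v.re • (1:CC) + v.im • Complex.I := by
      simp [mul_comm]
    rw [e, map_add, map_smul, map_smul]; simp
  ext v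
  rw [h v, WL_apply]
  have h2 : v = v.re + v.im * Complex.I := (Complex.re_add_im v).symm
  have h3 : conj v = v.re - v.im * Complex.I := by
    apply Complex.ext <;> simp
  rw [h3]; conv_rhs => rw [h2]
  simp only [Complex.add_re, Complex.ofReal_re, Complex.mul_re, Complex.I_re, Complex.add_im, Complex.mul_im, Complex.ofReal_im, Complex.I_im]
  ring_nf; simp only [Complex.I_sq]; simp

lemma HasW.dz_eq {g a b z} (h : HasW g a b z) : dz g z = a := by
  rw [dz, HasFDerivAt.fderiv h]; simp; ring_nf; simp; ring
lemma HasW.db_eq {g a b z} (h : HasW g a b z) : db g z = b := by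
  rw [db, HasFDerivAt.fderiv h]; simp; ring_nf; simp; ring
lemma hasW_of_diff {g z} (h : DifferentiableAt RR g z) : HasW g (dz g z) (db g z) z := by
  have := h.hasFDerivAt
  rw [clm_eq_WL (fderiv RR g z)] at this; exact this
lemma HasW.congr {g g' a b a' b' z} (h : HasW g a b z) (e : g' =ᶠ[𝓝 z] g) (ha : a' = a)
    (hb : b' = b) : HasW g' a' b' z := by subst ha hb; exact HasFDerivAt.congr_of_eventuallyEq h e
lemma HasW.cd {g a b a' b' z} (h : HasW g a b z) (ha : a' = a)
    (hb : b' = b) : HasW g a' b' z := by subst ha hb; exact h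
lemma HasW.add {f g a b c d z} (hf : HasW f a b z) (hg : HasW g c d z) :
    HasW (fun w => f w + g w) (a + c) (b + d) z := by
  refine (HasFDerivAt.add hf hg).congr_fderiv ?_
  ext v; simp; ring
lemma HasW.sub {f g a b c d z} (hf : HasW f a b z) (hg : HasW g c d z) :
    HasW (fun w => f w - g w) (a - c) (b - d) z := by
  refine (HasFDerivAt.sub hf hg).congr_fderiv ?_
  ext v; simp; ring
lemma HasW.mul {f g a b c d z} (hf : HasW f a b z) (hg : HasW g c d z) :
    HasW (fun w => f w * g w) (a * g z + f z * c) (b * g z + f z * d) z := by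
  refine (HasFDerivAt.mul hf hg).congr_fderiv ?_
  ext v; simp; ring
lemma hasW_const (c z : CC) : HasW (fun _ => c) 0 0 z := by
  refine (hasFDerivAt_const c z).congr_fderiv ?_
  ext v; simp
lemma HasDerivAt.hasW {g a z} (h : HasDerivAt g a z) : HasW g a 0 z := by
  refine (h.hasFDerivAt.restrictScalars RR).congr_fderiv ?_
  ext v; simp [mul_comm]
lemma HasW.hasDerivAt {g a z} (h : HasW g a 0 z) : HasDerivAt g a z := by
  have h' : HasFDerivAt g (((ContinuousLinearMap.toSpanSingleton CC a)).restrictScalars RR) z := by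
    refine HasFDerivAt.congr_fderiv h ?_
    ext v; simp [mul_comm]
  simpa using (hasFDerivAt_of_restrictScalars RR h' rfl).hasDerivAt
lemma HasW.conj {g a b z} (h : HasW g a b z) : HasW (fun w => conj (g w)) (conj b) (conj a) z := by
  refine ((Complex.conjCLE : CC →L[RR] CC).hasFDerivAt.comp z h).congr_fderiv ?_
  ext v; simp; ring
lemma HasW.comp {F : CC → CC} {g a b c z} (hF : HasDerivAt F c (g z)) (h : HasW g a b z) :
    HasW (fun w => F (g w)) (c * a) (c * b) z := by
  refine ((hF.hasFDerivAt.restrictScalars RR).comp z h).congr_fderiv ?_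
  ext v; simp; ring
lemma HasW.inv {g a b z} (h : HasW g a b z) (h0 : g z ≠ 0) :
    HasW (fun w => (g w)⁻¹) (-a / g z ^ 2) (-b / g z ^ 2) z :=
  (HasW.comp (hasDerivAt_inv h0) h).cd (by ring) (by ring)
lemma HasW.curve {g a b} {γ : RR → CC} {γ' : CC} {t : RR} (h : HasW g a b (γ t))
    (hγ : HasDerivAt γ γ' t) :
    HasDerivAt (fun s => g (γ s)) (a * γ' + b * conj γ') t := by
  have := HasFDerivAt.comp_hasDerivAt (x := t) (f := γ) h hγ
  rw [WL_apply] at this; exact this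
lemma HasW.continuousAt {g a b z} (h : HasW g a b z) : ContinuousAt g z :=
  HasFDerivAt.continuousAt h
lemma HasW.unique {g a b c d z} (h : HasW g a b z) (h' : HasW g c d z) : a = c ∧ b = d :=
  ⟨h.dz_eq.symm.trans h'.dz_eq, h.db_eq.symm.trans h'.db_eq⟩

abbrev Sm (g : CC → CC) (z : CC) : Prop := ContDiffAt RR ∞ g z

lemma Sm.hasW {g z} (h : Sm g z) : HasW g (dz g z) (db g z) z :=
  hasW_of_diff (h.differentiableAt (by simp))
lemma Sm.fd {g z} (h : Sm g z) (v : CC) : Sm (fun w => fderiv RR g w v) z :=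
  (h.fderiv_right (m := ∞) (by simp)).clm_apply contDiffAt_const
lemma Sm.sdz {g z} (h : Sm g z) : Sm (dz g) z :=
  ((h.fd 1).sub (contDiffAt_const.mul (h.fd Complex.I))).div_const 2
lemma Sm.sdb {g z} (h : Sm g z) : Sm (db g) z :=
  ((h.fd 1).add (contDiffAt_const.mul (h.fd Complex.I))).div_const 2
lemma fderiv_fd {g z} (h : Sm g z) (v w : CC) :
    fderiv RR (fun x => fderiv RR g x v) z w = fderiv RR (fderiv RR g) z w v := by
  have := (h.fderiv_right (m := ∞) (by simp)).differentiableAt (by simp)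
  rw [fderiv_clm_apply this (by fun_prop)]; simp
lemma Sm.symm2 {g z} (h : Sm g z) : fderiv RR (fderiv RR g) z 1 Complex.I = fderiv RR (fderiv RR g) z Complex.I 1 :=
  (h.isSymmSndFDerivAt (by simp; exact WithTop.coe_le_coe.mpr (le_top (a := (2 : ℕ∞))))).eq 1 Complex.I
lemma Sm.fdz {g z} (h : Sm g z) (v : CC) : fderiv RR (dz g) z v = (fderiv RR (fderiv RR g) z v 1 - Complex.I * fderiv RR (fderiv RR g) z v Complex.I) / 2 := by
  have d1 := (h.fd 1).differentiableAt (by simp)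
  have d2 := (h.fd Complex.I).differentiableAt (by simp)
  have : HasFDerivAt (dz g) _ z := ((d1.hasFDerivAt.sub (d2.hasFDerivAt.const_mul Complex.I)).mul_const (1/2 : CC)).congr_of_eventuallyEq (by filter_upwards with w; simp [dz]; ring)
  rw [this.fderiv]; simp [fderiv_fd h]; ring
lemma Sm.lap {g z} (h : Sm g z) : db (dz g) z = (fderiv RR (fderiv RR g) z 1 1 + fderiv RR (fderiv RR g) z Complex.I Complex.I) / 4 := by
  rw [db, h.fdz, h.fdz, h.symm2]; linear_combination (-fderiv RR (fderiv RR g) z Complex.I Complex.I/4) * Complex.I_sq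
lemma Sm.comm {g z} (h : Sm g z) : dz (db g) z = db (dz g) z := by
  have d1 := (h.fd 1).differentiableAt (by simp)
  have d2 := (h.fd Complex.I).differentiableAt (by simp)
  have e2 : ∀ v, fderiv RR (db g) z v = (fderiv RR (fderiv RR g) z v 1 + Complex.I * fderiv RR (fderiv RR g) z v Complex.I) / 2 := by
    intro v
    have : HasFDerivAt (db g) _ z := ((d1.hasFDerivAt.add (d2.hasFDerivAt.const_mul Complex.I)).mul_const (1/2 : CC)).congr_of_eventuallyEq (by filter_upwards with w; simp [db]; ring)
    rw [this.fderiv]; simp [fderiv_fd h]; ring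
  rw [dz, db, h.fdz, h.fdz, e2, e2, h.symm2]; ring

def pt (R s θ : RR) : CC := R * Complex.exp (-s + θ * Complex.I)
def ann (p : CC) (R : RR) : Set CC := {z | z ≠ p ∧ dist z p < R}

lemma norm_pt {R : RR} (hR : 0 < R) (s θ : RR) : ‖pt R s θ‖ = R * Real.exp (-s) := by
  simp [pt, Complex.norm_exp, abs_of_pos hR]
lemma pt_mem {p : CC} {R R' s : RR} (hR : 0 < R) (h : R * Real.exp (-s) < R') (θ : RR) :
    p + pt R s θ ∈ ann p R' := by
  have h1 := norm_pt hR s θ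
  refine ⟨fun h => ?_, by simpa [h1] using h⟩
  have : pt R s θ = 0 := by simpa using h
  rw [this] at h1; have := Real.exp_pos (-s); simp at h1; have := mul_pos hR this; linarith
lemma ann_open (p : CC) (R : RR) : IsOpen (ann p R) :=
  isOpen_ne.inter isOpen_ball
lemma continuous_pt (p : CC) (R : RR) : Continuous (fun q : RR × RR => p + pt R q.1 q.2) := by
  unfold pt; fun_prop
lemma pt_ds (p : CC) (R s θ : RR) : HasDerivAt (fun s => p + pt R s θ) (-pt R s θ) s := by
  have h : HasDerivAt (fun s : RR => (-(s:CC) + θ * Complex.I)) (-1) s :=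
    (Complex.ofRealCLM.hasDerivAt (x := s)).neg.add_const _
  exact ((h.cexp.const_mul (R:CC)).const_add p).congr_deriv (by simp [pt])
lemma pt_dθ (p : CC) (R s θ : RR) : HasDerivAt (fun θ => p + pt R s θ) (Complex.I * pt R s θ) θ := by
  have h : HasDerivAt (fun θ : RR => (-(s:CC) + θ * Complex.I)) (1 * Complex.I) θ :=
    ((Complex.ofRealCLM.hasDerivAt (x := θ)).mul_const _).const_add _
  exact ((h.cexp.const_mul (R:CC)).const_add p).congr_deriv (by simp [pt]; ring)

def md (p : CC) (R : RR) (φ : CC → CC) (n : ℤ) (s : RR) : CC :=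
  ∫ θ in (0:RR)..(2 * Real.pi), φ (p + pt R s θ) * Complex.exp (-(n * θ * Complex.I))

section
variable {p : CC} {R R' s : RR} {φ φ1 φ2 ψ : CC → CC} (hR : 0 < R) (h : R * Real.exp (-s) < R')
include hR h

lemma md_cont (hφ : ContinuousOn φ (ann p R')) (n : ℤ) :
    Continuous (fun θ : RR => φ (p + pt R s θ) * Complex.exp (-(n * θ * Complex.I))) := by
  refine Continuous.mul ?_ (by fun_prop)
  rw [continuous_iff_continuousAt]; intro θ
  refine ContinuousAt.comp (g := φ) (hφ.continuousAt ((ann_open p R').mem_nhds (pt_mem hR h θ))) ?_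
  exact ((continuous_pt p R).comp (by fun_prop : Continuous fun θ : RR => (s, θ))).continuousAt

lemma md_congr (n : ℤ) (he : ∀ z ∈ ann p R', φ z = ψ z) : md p R φ n s = md p R ψ n s := by
  unfold md; congr 1; ext θ; rw [he _ (pt_mem hR h θ)]
lemma md_add (n : ℤ) (hφ : ContinuousOn φ (ann p R')) (hψ : ContinuousOn ψ (ann p R')) :
    md p R (fun z => φ z + ψ z) n s = md p R φ n s + md p R ψ n s := by
  unfold md
  rw [← intervalIntegral.integral_add ((md_cont hR h hφ n).intervalIntegrable _ _)
    ((md_cont hR h hψ n).intervalIntegrable _ _)]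
  congr 1; ext θ; ring
omit hR h in
lemma md_cmul (n : ℤ) (c : CC) :
    md p R (fun z => c * φ z) n s = c * md p R φ n s := by
  unfold md
  rw [← intervalIntegral.integral_const_mul]
  congr 1; ext θ; ring
lemma md_norm (n : ℤ) {C : RR} (hb : ∀ z ∈ ann p R', dist z p = R * Real.exp (-s) → ‖φ z‖ ≤ C) :
    ‖md p R φ n s‖ ≤ C * (2 * Real.pi) := by
  have := intervalIntegral.norm_integral_le_of_norm_le_const (a := 0) (b := 2 * Real.pi) (C := C)
    (f := fun θ : RR => φ (p + pt R s θ) * Complex.exp (-(n * θ * Complex.I))) (by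
    intro θ _
    have : ‖Complex.exp (-(n * θ * Complex.I))‖ = 1 := by
      simp [Complex.norm_exp]
    rw [norm_mul, this, mul_one]
    exact hb _ (pt_mem hR h θ) (by simp [norm_pt hR]))
  rwa [sub_zero, abs_of_pos Real.two_pi_pos] at this
lemma md_ibp (n : ℤ) (hφ : ∀ z ∈ ann p R', HasW φ (φ1 z) (φ2 z) z)
    (h1 : ContinuousOn φ1 (ann p R')) (h2 : ContinuousOn φ2 (ann p R')) :
    md p R (fun z => (z - p) * φ1 z) n s - md p R (fun z => conj (z - p) * φ2 z) n s
      = n * md p R φ n s := by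
  have hc1 : ContinuousOn (fun z => (z - p) * φ1 z) (ann p R') := by fun_prop
  have hc2 : ContinuousOn (fun z => conj (z - p) * φ2 z) (ann p R') := by
    refine ContinuousOn.mul ?_ h2
    exact (Complex.continuous_conj.comp (by fun_prop)).continuousOn
  have hc0 : ContinuousOn φ (ann p R') := fun z hz => (hφ z hz).continuousAt.continuousWithinAt
  have hd : ∀ θ : RR, HasDerivAt (fun θ : RR => φ (p + pt R s θ) * Complex.exp (-(n * θ * Complex.I)))
      (Complex.I * ((pt R s θ * φ1 (p + pt R s θ)) * Complex.exp (-(n * θ * Complex.I))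
       - (conj (pt R s θ) * φ2 (p + pt R s θ)) * Complex.exp (-(n * θ * Complex.I))
       - n * (φ (p + pt R s θ) * Complex.exp (-(n * θ * Complex.I))))) θ := by
    intro θ
    have e : HasDerivAt (fun θ : RR => (-(n * (θ : CC) * Complex.I))) (-(n * 1 * Complex.I)) θ :=
      (((Complex.ofRealCLM.hasDerivAt (x := θ)).const_mul (n:CC)).mul_const _).neg
    refine ((HasW.curve (γ := fun θ => p + pt R s θ) (hφ _ (pt_mem hR h θ)) (pt_dθ p R s θ)).mul e.cexp).congr_deriv ?_
    simp; ring
  have := intervalIntegral.integral_eq_sub_of_hasDerivAt (a := 0) (b := 2 * Real.pi)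
    (fun θ _ => hd θ) (by
      apply Continuous.intervalIntegrable
      have a1 := md_cont hR h hc1 n
      have a2 := md_cont hR h hc2 n
      have a0 := md_cont hR h hc0 n
      simp only [add_sub_cancel_left] at a1 a2
      fun_prop)
  have e0 : pt R s (2 * Real.pi) = pt R s 0 := by
    simp [pt, Complex.exp_add, Complex.exp_two_pi_mul_I]
  have e1 : Complex.exp (-(n * (2 * Real.pi : RR) * Complex.I)) = 1 := by
    rw [Complex.exp_eq_one_iff]; exact ⟨-n, by push_cast; ring⟩
  rw [e0, e1] at this
  simp only [Complex.ofReal_zero, mul_zero, zero_mul, neg_zero, Complex.exp_zero, mul_one, sub_self, intervalIntegral.integral_const_mul] at this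
  have a1 := (md_cont hR h hc1 n).intervalIntegrable (μ := MeasureTheory.volume) 0 (2 * Real.pi)
  have a2 := (md_cont hR h hc2 n).intervalIntegrable (μ := MeasureTheory.volume) 0 (2 * Real.pi)
  have a0 := (md_cont hR h hc0 n).intervalIntegrable (μ := MeasureTheory.volume) 0 (2 * Real.pi)
  simp only [add_sub_cancel_left] at a1 a2
  rw [intervalIntegral.integral_sub (a1.sub a2) (a0.const_mul _), intervalIntegral.integral_sub a1 a2, intervalIntegral.integral_const_mul] at this
  have := (mul_eq_zero.mp this).resolve_left Complex.I_ne_zero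
  simp only [md, add_sub_cancel_left]
  exact sub_eq_zero.mp this
lemma md_deriv (n : ℤ) (hφ : ∀ z ∈ ann p R', HasW φ (φ1 z) (φ2 z) z)
    (h1 : ContinuousOn φ1 (ann p R')) (h2 : ContinuousOn φ2 (ann p R')) :
    HasDerivAt (md p R φ n) (-(n * md p R φ n s + 2 * md p R (fun z => conj (z - p) * φ2 z) n s)) s := by
  have hc1 : ContinuousOn (fun z => (z - p) * φ1 z) (ann p R') := by fun_prop
  have hc2 : ContinuousOn (fun z => conj (z - p) * φ2 z) (ann p R') := by
    refine ContinuousOn.mul ?_ h2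
    exact (Complex.continuous_conj.comp (by fun_prop)).continuousOn
  have hc0 : ContinuousOn φ (ann p R') := fun z hz => (hφ z hz).continuousAt.continuousWithinAt
  set G : CC → CC := fun z => -((z - p) * φ1 z + conj (z - p) * φ2 z) with hG
  have hcG : ContinuousOn G (ann p R') := (hc1.add hc2).neg
  obtain ⟨s', hs', hlt⟩ : ∃ s' < s, R * Real.exp (-s') < R' := by
    have : ∀ᶠ x in 𝓝[<] s, R * Real.exp (-x) < R' :=
      ((by fun_prop : ContinuousAt (fun x => R * Real.exp (-x)) s).eventually (gt_mem_nhds h)).filter_mono nhdsWithin_le_nhds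
    obtain ⟨x, hx, hx'⟩ := (this.and self_mem_nhdsWithin).exists
    exact ⟨x, hx', hx⟩
  have hmem : ∀ x ∈ Icc s' (s+1), ∀ θ, p + pt R x θ ∈ ann p R' := by
    intro x hx θ
    refine pt_mem hR (lt_of_le_of_lt ?_ hlt) θ
    have := hx.1; gcongr
  obtain ⟨C, hC⟩ := (isCompact_Icc.prod isCompact_Icc : IsCompact (Icc s' (s+1) ×ˢ Icc (0:RR) (2 * Real.pi))).exists_bound_of_continuousOn
    (f := fun q : RR × RR => G (p + pt R q.1 q.2)) (hcG.comp (continuous_pt p R).continuousOn (fun q hq => hmem _ hq.1 _))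
  have key := intervalIntegral.hasDerivAt_integral_of_dominated_loc_of_deriv_le (μ := MeasureTheory.volume)
    (F := fun s (θ:RR) => φ (p + pt R s θ) * Complex.exp (-(n * θ * Complex.I)))
    (F' := fun s (θ:RR) => G (p + pt R s θ) * Complex.exp (-(n * θ * Complex.I))) (x₀ := s)
    (a := 0) (b := 2 * Real.pi) (bound := fun _ => C) (s := Icc s' (s+1)) (Icc_mem_nhds hs' (by linarith))
    (by
      filter_upwards [Ioi_mem_nhds hs'] with x hx
      refine (md_cont hR (lt_of_le_of_lt ?_ hlt) hc0 n).aestronglyMeasurable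
      have : s' < x := hx
      gcongr)
    ((md_cont hR h hc0 n).intervalIntegrable _ _) (md_cont hR h hcG n).aestronglyMeasurable
    (by
      refine Eventually.of_forall fun θ hθ x hx => ?_
      have : ‖Complex.exp (-(n * θ * Complex.I))‖ = 1 := by simp [Complex.norm_exp]
      rw [norm_mul, this, mul_one]
      rw [uIoc_of_le Real.two_pi_pos.le] at hθ
      exact hC (x, θ) ⟨hx, hθ.1.le, hθ.2⟩)
    intervalIntegrable_const
    (by
      refine Eventually.of_forall fun θ hθ x hx => ?_
      refine ((HasW.curve (γ := fun s => p + pt R s θ) (hφ _ (hmem x hx θ)) (pt_ds p R x θ)).mul_const _).congr_deriv ?_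
      simp [hG]; ring)
  refine key.2.congr_deriv ?_
  have e := md_ibp hR h n hφ h1 h2
  have e2 : md p R G n s = -(md p R (fun z => (z - p) * φ1 z) n s + md p R (fun z => conj (z - p) * φ2 z) n s) := by
    rw [← md_add hR h n hc1 hc2, ← neg_one_mul (md _ _ _ _ _), ← md_cmul]; congr 1; ext z; simp [hG]
  change md p R G n s = _
  rw [e2, ← e]; ring
end

lemma incr_bound {N N' : RR → CC} {C m : RR} (hm : m ≠ 0)
    (hN : ∀ s, 0 ≤ s → HasDerivAt N (N' s) s) (hb : ∀ s, 0 ≤ s → ‖N' s‖ ≤ C * Real.exp (m * s))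
    {s b : RR} (hs : 0 ≤ s) (hsb : s ≤ b) :
    ‖N b - N s‖ ≤ C / m * (Real.exp (m * b) - Real.exp (m * s)) := by
  have := image_norm_le_of_norm_deriv_right_le_deriv_boundary (a := s) (b := b)
    (f := fun x => N x - N s) (f' := N') (B := fun x => C / m * (Real.exp (m * x) - Real.exp (m * s)))
    (B' := fun x => C * Real.exp (m * x))
    (fun x hx => ((hN x (hs.trans hx.1)).continuousAt.sub continuousAt_const).continuousWithinAt)
    (fun x hx => ((hN x (hs.trans hx.1)).sub_const _).hasDerivWithinAt) (by simp)
    (fun x => by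
      have : HasDerivAt (fun x : RR => m * x) (m * 1) x := (hasDerivAt_id x).const_mul m
      refine ((this.exp.sub_const (Real.exp (m * s))).const_mul (C / m)).congr_deriv ?_
      field_simp)
    (fun x hx => hb x (hs.trans hx.1))
  exact this ⟨hsb, le_rfl⟩

lemma decay_lim {N N' : RR → CC} {C m : RR} {L : CC} (hm : 0 < m)
    (hN : ∀ s, 0 ≤ s → HasDerivAt N (N' s) s) (hb : ∀ s, 0 ≤ s → ‖N' s‖ ≤ C * Real.exp (-m * s))
    (hL : Tendsto N atTop (𝓝 L)) {s : RR} (hs : 0 ≤ s) : ‖L - N s‖ ≤ C / m * Real.exp (-m * s) := by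
  have hC : 0 ≤ C := by simpa using (norm_nonneg _).trans (hb 0 le_rfl)
  refine le_of_tendsto ((hL.sub_const (N s)).norm) ?_
  filter_upwards [eventually_ge_atTop s] with b hbs
  refine (incr_bound (neg_ne_zero.mpr hm.ne') hN hb hs hbs).trans ?_
  have := Real.exp_pos (-m * b)
  rw [div_neg, neg_mul, ← mul_neg]
  gcongr; linarith

lemma grow1 {y F : RR → CC} {C a m : RR} (hm : m < a) (hy : ∀ s, 0 ≤ s → HasDerivAt y (-(a * y s + F s)) s)
    (hF : ∀ s, 0 ≤ s → ‖F s‖ ≤ C * Real.exp (-m * s)) :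
    ∃ C', ∀ s, 0 ≤ s → ‖y s‖ ≤ C' * Real.exp (-m * s) := by
  have hC : 0 ≤ C := by simpa using (norm_nonneg _).trans (hF 0 le_rfl)
  have ham : 0 < a - m := sub_pos.mpr hm
  have key : ∀ s, 0 ≤ s → HasDerivAt (fun s => (Real.exp (a * s) : CC) * y s) (-(Real.exp (a * s) * F s)) s := by
    intro s hs
    have : HasDerivAt (fun x : RR => Real.exp (a * x)) (Real.exp (a * s) * (a * 1)) s := ((hasDerivAt_id s).const_mul a).exp
    refine (this.ofReal_comp.mul (hy s hs)).congr_deriv ?_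
    push_cast; ring
  refine ⟨‖y 0‖ + C / (a - m), fun s hs => ?_⟩
  have := incr_bound (C := C) ham.ne' key (fun s hs => by
    rw [norm_neg, norm_mul, Complex.norm_real, Real.norm_of_nonneg (Real.exp_pos _).le]
    calc Real.exp (a * s) * ‖F s‖ ≤ Real.exp (a * s) * (C * Real.exp (-m * s)) := by gcongr; exact hF s hs
      _ = C * Real.exp ((a - m) * s) := by rw [mul_left_comm, ← Real.exp_add]; ring_nf) le_rfl hs
  simp only [mul_zero, Real.exp_zero, Complex.ofReal_one, one_mul] at this
  have h2 : ‖(Real.exp (a * s) : CC) * y s‖ ≤ ‖y 0‖ + C / (a - m) * Real.exp ((a - m) * s) := by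
    have h3 := norm_sub_norm_le ((Real.exp (a * s) : CC) * y s) (y 0)
    have : 0 ≤ C / (a - m) := by positivity
    linarith
  rw [norm_mul, Complex.norm_real, Real.norm_of_nonneg (Real.exp_pos _).le] at h2
  have h4 : 1 ≤ Real.exp ((a - m) * s) := Real.one_le_exp (by positivity)
  have h5 : Real.exp (a * s) * ‖y s‖ ≤ (‖y 0‖ + C / (a - m)) * Real.exp ((a - m) * s) := by
    nlinarith [norm_nonneg (y 0)]
  have h6 : Real.exp ((a - m) * s) = Real.exp (a * s) * Real.exp (-m * s) := by
    rw [← Real.exp_add]; ring_nf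
  rw [h6] at h5
  have := Real.exp_pos (a * s)
  refine le_of_mul_le_mul_left ?_ this
  linarith

lemma Sm.cont {g : CC → CC} {z} (h : Sm g z) : ContinuousAt g z := ContDiffAt.continuousAt h

lemma gradBd {f : CC → CC} {p : CC} {R R' a b : RR} (hR : 0 < R) (hRR : R < R')
    (hf : ∀ z ∈ ball p R', Sm f z) (ha : ∀ z ∈ ball p R', ‖f z‖ ≤ a)
    (hb : ∀ z ∈ ball p R', ‖db (dz f) z‖ ≤ b) : ‖dz f p‖ ≤ a / R + 2 * b * R := by
  have hsub : ∀ z ∈ ann p R', z ∈ ball p R' := fun z hz => hz.2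
  have hlt : ∀ s, 0 ≤ s → R * Real.exp (-s) < R' := fun s hs => by
    have : Real.exp (-s) ≤ 1 := by simpa using hs
    nlinarith
  have hp : p ∈ ball p R' := mem_ball_self (hR.trans hRR)
  have hb0 : 0 ≤ b := (norm_nonneg _).trans (hb p hp)
  have c1 : ContinuousOn (dz f) (ann p R') := fun z hz => (hf z (hsub z hz)).sdz.cont.continuousWithinAt
  have hg : ∀ s, 0 ≤ s → HasDerivAt (md p R (dz f) 0) _ s := fun s hs => md_deriv hR (hlt s hs) 0
    (fun z hz => (hf z (hsub z hz)).sdz.hasW) (fun z hz => (hf z (hsub z hz)).sdz.sdz.cont.continuousWithinAt)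
    (fun z hz => (hf z (hsub z hz)).sdz.sdb.cont.continuousWithinAt)
  have limg : Tendsto (md p R (dz f) 0) atTop (𝓝 (2 * Real.pi * dz f p)) := by
    rw [Metric.tendsto_atTop]; intro ε hε
    obtain ⟨δ, hδ, h⟩ := Metric.continuousAt_iff.mp (hf p hp).sdz.cont (ε / 7) (by positivity)
    have : Tendsto (fun s => R * Real.exp (-s)) atTop (𝓝 (R * 0)) :=
      (Real.tendsto_exp_neg_atTop_nhds_zero).const_mul R
    rw [mul_zero] at this
    obtain ⟨s0, h0⟩ := (this.eventually (gt_mem_nhds hδ)).exists_forall_of_atTop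
    refine ⟨max s0 0, fun s hs => ?_⟩
    have hs0 := (le_max_right _ _).trans hs
    have e := md_add (s := s) (φ := dz f) (ψ := fun _ => - dz f p) hR (hlt s hs0) 0 c1 continuousOn_const
    have e2 : md p R (fun _ => -dz f p) 0 s = -(2 * Real.pi * dz f p) := by simp [md]
    rw [e2, ← sub_eq_add_neg] at e
    rw [dist_eq_norm, ← e]
    refine (md_norm (C := ε / 7) hR (hlt s hs0) 0 fun z hz hd => ?_).trans_lt ?_
    · have := h (x := z) (by rw [hd]; exact h0 s ((le_max_left _ _).trans hs))
      rw [dist_eq_norm, sub_eq_add_neg] at this; exact this.le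
    · have := Real.pi_lt_d2; nlinarith
  have bg : ∀ s, 0 ≤ s → ‖2 * Real.pi * dz f p - md p R (dz f) 0 s‖ ≤ (4 * Real.pi * b * R) / 1 * Real.exp (-1 * s) := by
    intro s hs
    refine decay_lim one_pos hg (fun s hs => ?_) limg hs
    have := md_norm (C := R * Real.exp (-s) * b) (φ := fun z => conj (z - p) * db (dz f) z) hR (hlt s hs) 0 fun z hz hd => by
      rw [norm_mul, RCLike.norm_conj, ← dist_eq_norm, hd]
      gcongr; exact hb z (hsub z hz)
    rw [norm_neg]; simp only [Int.cast_zero, zero_mul, zero_add, norm_mul, Complex.norm_two, neg_mul, one_mul]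
    linarith
  have hk : ∀ s, 0 ≤ s → HasDerivAt (md p R f 1) _ s := fun s hs => md_deriv hR (hlt s hs) 1
    (fun z hz => (hf z (hsub z hz)).hasW) c1
    (fun z hz => (hf z (hsub z hz)).sdb.cont.continuousWithinAt)
  have e1 : ∀ s, 0 ≤ s → md p R (fun z => (z - p) * dz f z) 1 s = R * Real.exp (-s) * md p R (dz f) 0 s := by
    intro s hs
    unfold md
    rw [← intervalIntegral.integral_const_mul]; congr 1; ext θ
    simp [pt, Complex.exp_add, Complex.exp_neg]; field_simp
  set N : RR → CC := fun s => Real.exp (-1 * s) * md p R f 1 s - 2 * Real.pi * dz f p * R * Real.exp (-2 * s) with hN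
  have ex : ∀ c s : RR, HasDerivAt (fun x : RR => (Real.exp (c * x) : CC)) (c * Real.exp (c * s)) s := fun c s => by
    have : HasDerivAt (fun x : RR => Real.exp (c * x)) (Real.exp (c * s) * (c * 1)) s := ((hasDerivAt_id s).const_mul c).exp
    refine this.ofReal_comp.congr_deriv (by push_cast; ring)
  have dN : ∀ s, 0 ≤ s → HasDerivAt N (2 * R * Real.exp (-2 * s) * (2 * Real.pi * dz f p - md p R (dz f) 0 s)) s := by
    intro s hs
    refine (((ex (-1) s).mul (hk s hs)).sub ((ex (-2) s).const_mul (2 * Real.pi * dz f p * R))).congr_deriv ?_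
    have i := md_ibp hR (hlt s hs) 1 (fun z hz => (hf z (hsub z hz)).hasW) c1
      (fun z hz => (hf z (hsub z hz)).sdb.cont.continuousWithinAt)
    rw [e1 s hs] at i
    have e3 : Real.exp (-2 * s) = Real.exp (-s) * Real.exp (-s) := by rw [← Real.exp_add]; ring_nf
    rw [← sub_eq_iff_eq_add'.mpr (sub_eq_iff_eq_add.mp i)]
    rw [e3]; push_cast; simp only [neg_mul, one_mul]; ring
  have limN : Tendsto N atTop (𝓝 0) := by
    have t1 : ∀ c : RR, 0 < c → Tendsto (fun s : RR => (Real.exp (-c * s))) atTop (𝓝 0) := by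
      intro c hc
      simp only [neg_mul]
      exact Real.tendsto_exp_neg_atTop_nhds_zero.comp (tendsto_id.const_mul_atTop hc)
    rw [tendsto_zero_iff_norm_tendsto_zero]
    have := ((t1 1 one_pos).mul_const (a * (2 * Real.pi))).add (((t1 2 two_pos)).const_mul ‖2 * Real.pi * dz f p * R‖)
    simp only [zero_mul, mul_zero, add_zero] at this
    refine squeeze_zero' (Eventually.of_forall fun _ => norm_nonneg _) ?_ this
    filter_upwards [eventually_ge_atTop 0] with s hs
    refine (norm_sub_le _ _).trans ?_
    rw [norm_mul, Complex.norm_real, Real.norm_of_nonneg (Real.exp_pos _).le]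
    rw [norm_mul (_ * _), Complex.norm_real (Real.exp _), Real.norm_of_nonneg (Real.exp_pos _).le]
    gcongr
    exact md_norm hR (hlt s hs) 1 fun z hz _ => ha z (hsub z hz)
  have fin := decay_lim (C := 8 * Real.pi * b * R ^ 2) (by norm_num : (0:RR) < 3) dN (fun s hs => by
    have := bg s hs
    rw [norm_mul, norm_mul, norm_mul, Complex.norm_real, Complex.norm_real, Real.norm_of_nonneg (Real.exp_pos _).le, Real.norm_of_nonneg hR.le, Complex.norm_two]
    calc _ ≤ 2 * R * Real.exp (-2 * s) * (4 * Real.pi * b * R / 1 * Real.exp (-1 * s)) := by gcongr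
      _ = 8 * Real.pi * b * R ^ 2 * (Real.exp (-2 * s) * Real.exp (-1 * s)) := by ring
      _ = _ := by rw [← Real.exp_add]; ring_nf) limN (le_refl 0)
  have m0 := md_norm hR (hlt 0 le_rfl) (φ := f) 1 fun z hz _ => ha z (hsub z hz)
  simp only [hN, mul_zero, Real.exp_zero, Complex.ofReal_one, one_mul, mul_one, zero_sub, norm_neg] at fin
  have h7 : ‖2 * Real.pi * dz f p * R‖ ≤ a * (2 * Real.pi) + 8 * Real.pi * b * R ^ 2 / 3 := by
    have := norm_sub_norm_le (2 * Real.pi * dz f p * R) (md p R f 1 0)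
    rw [norm_sub_rev] at this; linarith
  simp only [norm_mul, Complex.norm_two, Complex.norm_real, Real.norm_of_nonneg Real.pi_pos.le, Real.norm_of_nonneg hR.le] at h7
  have hpi := Real.pi_pos
  have h8 : ‖dz f p‖ * R ≤ a + 4 / 3 * b * R ^ 2 := by
    refine le_of_mul_le_mul_left (a := 2 * Real.pi) ?_ (by positivity)
    linarith
  rw [div_add' _ _ _ hR.ne', le_div_iff₀ hR]
  nlinarith [mul_nonneg hb0 (sq_nonneg R)]

def OO (m : ℕ) (f : RR → CC) : Prop := ∃ C : RR, ∀ s, 0 ≤ s → ‖f s‖ ≤ C * Real.exp (-(m:RR) * s)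

lemma OO.congr {m f g} (h : OO m f) (e : ∀ s, 0 ≤ s → g s = f s) : OO m g := by
  obtain ⟨C, hC⟩ := h; exact ⟨C, fun s hs => by rw [e s hs]; exact hC s hs⟩
lemma OO.add {m f g} (hf : OO m f) (hg : OO m g) : OO m (fun s => f s + g s) := by
  obtain ⟨C, hC⟩ := hf; obtain ⟨D, hD⟩ := hg
  exact ⟨C + D, fun s hs => (norm_add_le _ _).trans (by linarith [hC s hs, hD s hs])⟩
lemma OO.cmul {m f} (hf : OO m f) (c : CC) : OO m (fun s => c * f s) := by
  obtain ⟨C, hC⟩ := hf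
  exact ⟨‖c‖ * C, fun s hs => by rw [norm_mul, mul_assoc]; gcongr; exact hC s hs⟩
lemma OO.sub {m f g} (hf : OO m f) (hg : OO m g) : OO m (fun s => f s - g s) :=
  (hf.add (hg.cmul (-1))).congr fun s _ => by ring
lemma OO.mono {m n f} (hf : OO n f) (h : m ≤ n) : OO m f := by
  obtain ⟨C, hC⟩ := hf
  refine ⟨C, fun s hs => (hC s hs).trans ?_⟩
  have : 0 ≤ C := by simpa using (norm_nonneg _).trans (hC 0 le_rfl)
  have : (m:RR) ≤ n := by exact_mod_cast h
  gcongr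
def EE (R s : RR) : CC := (R * Real.exp (-s) : RR)
lemma EE_norm {R : RR} (hR : 0 < R) (s : RR) (j : ℕ) : ‖EE R s ^ j‖ = R ^ j * Real.exp (-(j:RR) * s) := by
  rw [norm_pow, EE, Complex.norm_real, Real.norm_of_nonneg (by positivity), mul_pow, ← Real.exp_nat_mul]; ring_nf
lemma OO.E {R : RR} (hR : 0 < R) {m f} (hf : OO m f) (j : ℕ) : OO (j + m) (fun s => EE R s ^ j * f s) := by
  obtain ⟨C, hC⟩ := hf
  refine ⟨R ^ j * C, fun s hs => ?_⟩
  rw [norm_mul, EE_norm hR]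
  calc _ ≤ R ^ j * Real.exp (-(j:RR) * s) * (C * Real.exp (-(m:RR) * s)) := by gcongr; exact hC s hs
    _ = R ^ j * C * (Real.exp (-(j:RR) * s) * Real.exp (-(m:RR) * s)) := by ring
    _ = _ := by rw [← Real.exp_add]; push_cast; ring_nf
lemma OO.grow {m : ℕ} {a : ℤ} {y F : RR → CC} (hF : OO m F) (h : (m:ℤ) < a)
    (hy : ∀ s, 0 ≤ s → HasDerivAt y (-(a * y s + 2 * F s)) s) : OO m y := by
  obtain ⟨C, hC⟩ := hF.cmul 2
  exact grow1 (a := (a:RR)) (m := m) (by exact_mod_cast h) (fun s hs => by simpa using hy s hs) hC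

lemma md_pow {p : CC} {R s : RR} (φ : CC → CC) (n : ℤ) (j : ℕ) :
    md p R (fun z => (z - p) ^ j * φ z) n s = EE R s ^ j * md p R φ (n - j) s := by
  unfold md
  rw [← intervalIntegral.integral_const_mul]; congr 1; ext θ
  simp only [pt, EE, Complex.exp_add, add_sub_cancel_left, mul_pow, ← Complex.exp_nat_mul]
  have : Complex.exp (-(((n - j : ℤ) : CC) * θ * Complex.I)) = Complex.exp (j * (θ * Complex.I)) * Complex.exp (-(n * θ * Complex.I)) := by
    rw [← Complex.exp_add]; push_cast; ring_nf
  rw [this]; push_cast; rw [mul_pow, ← Complex.exp_nat_mul]; ring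
lemma md_cpow {p : CC} {R s : RR} (φ : CC → CC) (n : ℤ) (j : ℕ) :
    md p R (fun z => conj (z - p) ^ j * φ z) n s = EE R s ^ j * md p R φ (n + j) s := by
  unfold md
  rw [← intervalIntegral.integral_const_mul]; congr 1; ext θ
  simp only [pt, EE, add_sub_cancel_left, map_mul, ← Complex.exp_conj, map_add, map_neg, Complex.conj_ofReal, Complex.conj_I]
  have : Complex.exp (-(((n + j : ℤ) : CC) * θ * Complex.I)) = Complex.exp (j * (θ * -Complex.I)) * Complex.exp (-(n * θ * Complex.I)) := by
    rw [← Complex.exp_add]; push_cast; ring_nf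
  rw [this]; push_cast; rw [Complex.exp_add, mul_pow, mul_pow, mul_pow, ← Complex.exp_nat_mul, ← Complex.exp_nat_mul]; ring

lemma md_OO {p : CC} {R ε : RR} {φ : CC → CC} (hR : 0 < R) (h : R < ε) (n : ℤ) (m : ℕ) {C : RR}
    (hb : ∀ z ∈ ann p ε, ‖φ z‖ ≤ C * ‖z - p‖ ^ m) : OO m (md p R φ n) := by
  refine ⟨C * R ^ m * (2 * Real.pi), fun s hs => ?_⟩
  have hlt : R * Real.exp (-s) < ε := by
    have : Real.exp (-s) ≤ 1 := by simpa using hs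
    nlinarith
  refine (md_norm hR hlt n (C := C * (R * Real.exp (-s)) ^ m) fun z hz hd => ?_).trans ?_
  · rw [← hd, dist_eq_norm]; exact hb z hz
  · rw [mul_pow, ← Real.exp_nat_mul]; apply le_of_eq; ring_nf

set_option maxHeartbeats 1000000 in
lemma modes0 {R mm : RR} {k g BB β : ℤ → RR → CC} {r0 r1 r2 r3 : CC} (hR : 0 < R) (hm : 0 < mm)
    (dk : ∀ (n : ℤ) (s : RR), 0 ≤ s → HasDerivAt (k n) (-(n * k n s + 2 * g n s)) s)
    (dg : ∀ (n : ℤ) (s : RR), 0 ≤ s → HasDerivAt (g n) (-((n + 6 : ℤ) * g n s + 2 * BB n s)) s)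
    (hBe : ∀ n s, 0 ≤ s → BB n s = conj r0 * k n s + conj r1 * (EE R s ^ 1 * k (n + 1) s) + conj r2 * (EE R s ^ 2 * k (n + 2) s) + conj r3 * (EE R s ^ 3 * k (n + 3) s) + β n s)
    (oβ : ∀ n, OO 4 (β n)) (ok0 : ∀ n, OO 0 (k n)) (og0 : ∀ n, OO 0 (g n))
    (k0re : ∀ s, 0 ≤ s → 2 * Real.pi * mm ≤ (k 0 s).re) : r0 = 0 := by
  by_contra hne
  have hne' : conj r0 ≠ 0 := by simpa using hne
  set Ψ : RR → CC := fun s => (conj r0)⁻¹ * (g 0 s - 3 * k 0 s)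
  have dΨ : ∀ s, 0 ≤ s → HasDerivAt Ψ (-2 * (conj r0)⁻¹ * BB 0 s) s := fun s hs => by
    refine (((dg 0 s hs).sub ((dk 0 s hs).const_mul 3)).const_mul _).congr_deriv ?_
    push_cast; ring
  have oe : OO 1 (fun s => (conj r0)⁻¹ * (BB 0 s - conj r0 * k 0 s)) := by
    refine OO.cmul (OO.congr ((((((ok0 1).E hR 1).cmul (conj r1))).add ((((ok0 2).E hR 2).mono (m := 1) (by norm_num)).cmul (conj r2))).add (((((ok0 3).E hR 3).mono (m := 1) (by norm_num)).cmul (conj r3)).add ((oβ 0).mono (m := 1) (by norm_num)))) fun s hs => ?_) _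
    rw [hBe 0 s hs]; simp only [zero_add]; ring
  obtain ⟨C, hC⟩ := oe
  have oΨ : OO 0 Ψ := ((og0 0).sub ((ok0 0).cmul 3)).cmul _
  obtain ⟨D, hD⟩ := oΨ
  have hC0 : 0 ≤ C := by simpa using (norm_nonneg _).trans (hC 0 le_rfl)
  set c := 2 * Real.pi * mm with hc
  have hcp : 0 < c := by have := Real.pi_pos; positivity
  have t : Tendsto (fun s => C * Real.exp (-s)) atTop (𝓝 (C * 0)) := Real.tendsto_exp_neg_atTop_nhds_zero.const_mul C
  rw [mul_zero] at t
  obtain ⟨s0, hs0⟩ := (t.eventually (gt_mem_nhds (half_pos hcp))).exists_forall_of_atTop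
  set a := max s0 0
  have dle : ∀ s, a ≤ s → (-2 * (conj r0)⁻¹ * BB 0 s).re ≤ -c := fun s hs => by
    have h1 := k0re s ((le_max_right _ _).trans hs)
    have h2 := hC s ((le_max_right _ _).trans hs)
    have h3 := hs0 s ((le_max_left _ _).trans hs)
    have h4 := (Complex.abs_re_le_norm _).trans h2
    have h5 : -2 * (conj r0)⁻¹ * BB 0 s = -2 * k 0 s + -2 * ((conj r0)⁻¹ * (BB 0 s - conj r0 * k 0 s)) := by field_simp; ring
    have h6 := (abs_le.mp h4).1
    simp only [Nat.cast_one, neg_mul, one_mul] at h6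
    rw [h5, Complex.add_re]
    have e1 : (-2 * k 0 s).re = -2 * (k 0 s).re := by simp
    have e2 : ∀ w : CC, (-2 * w).re = -2 * w.re := by intro w; simp
    rw [e2, e2]; linarith
  have mv := fun b (hb : a ≤ b) => image_le_of_deriv_right_le_deriv_boundary (a := a) (b := b) (f := fun s => (Ψ s).re) (f' := fun s => (-2 * (conj r0)⁻¹ * BB 0 s).re)
    (B := fun s => (Ψ a).re + -c * (s - a)) (B' := fun _ => -c)
    (fun x hx => (Complex.continuous_re.continuousAt.comp (dΨ x ((le_max_right _ _).trans hx.1)).continuousAt).continuousWithinAt)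
    (fun x hx => (Complex.reCLM.hasFDerivAt.comp_hasDerivAt x (dΨ x ((le_max_right _ _).trans hx.1))).hasDerivWithinAt) (by simp)
    (by fun_prop) (fun x _ => by
      have : HasDerivAt (fun s => (Ψ a).re + -c * (s - a)) (-c * 1) x := (((hasDerivAt_id x).sub_const a).const_mul (-c)).const_add _
      simpa using this.hasDerivWithinAt) (fun x hx => dle x hx.1) (x := b) ⟨hb, le_rfl⟩
  have hb : a ≤ a + (2 * D + 1) / c := by
    have : 0 ≤ D := by simpa using (norm_nonneg _).trans (hD 0 le_rfl)
    have : 0 ≤ (2 * D + 1) / c := by positivity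
    linarith
  have f1 := mv _ hb
  have a0 : 0 ≤ a := le_max_right _ _
  have f2 := (abs_le.mp ((Complex.abs_re_le_norm _).trans (hD _ (a0.trans hb)))).1
  have f3 := (abs_le.mp ((Complex.abs_re_le_norm _).trans (hD a a0))).2
  simp only [CharP.cast_eq_zero, neg_zero, zero_mul, Real.exp_zero, mul_one, add_sub_cancel_left] at f1 f2 f3
  rw [neg_mul, mul_div_cancel₀ _ hcp.ne'] at f1
  linarith

set_option maxHeartbeats 1000000 in
lemma modes3 {R mm : RR} {k g AA BB α β : ℤ → RR → CC} {r0 r1 r2 r3 : CC} (hR : 0 < R) (hm : 0 < mm)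
    (dk : ∀ (n : ℤ) (s : RR), 0 ≤ s → HasDerivAt (k n) (-(n * k n s + 2 * g n s)) s)
    (dg : ∀ (n : ℤ) (s : RR), 0 ≤ s → HasDerivAt (g n) (-((n + 6 : ℤ) * g n s + 2 * BB n s)) s)
    (I : ∀ (n : ℤ) (s : RR), 0 ≤ s → ((n:CC) * ((n:CC) - 3)) * k n s + 2 * n * g n s = AA n s - BB n s)
    (hAe : ∀ n s, 0 ≤ s → AA n s = r0 * k n s + r1 * (EE R s ^ 1 * k (n - 1) s) + r2 * (EE R s ^ 2 * k (n - 2) s) + r3 * (EE R s ^ 3 * k (n - 3) s) + α n s)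
    (hBe : ∀ n s, 0 ≤ s → BB n s = conj r0 * k n s + conj r1 * (EE R s ^ 1 * k (n + 1) s) + conj r2 * (EE R s ^ 2 * k (n + 2) s) + conj r3 * (EE R s ^ 3 * k (n + 3) s) + β n s)
    (oα : ∀ n, OO 4 (α n)) (oβ : ∀ n, OO 4 (β n)) (ok0 : ∀ n, OO 0 (k n)) (og0 : ∀ n, OO 0 (g n))
    (k0re : ∀ s, 0 ≤ s → 2 * Real.pi * mm ≤ (k 0 s).re) : r0 = 0 ∧ r3 = r1 * r2 - r1 ^ 3 / 4 := by
  have h0 : r0 = 0 := modes0 hR hm dk dg hBe oβ ok0 og0 k0re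
  subst h0
  refine ⟨rfl, ?_⟩
  have hAe' : ∀ n s, 0 ≤ s → AA n s = r1 * (EE R s ^ 1 * k (n - 1) s) + r2 * (EE R s ^ 2 * k (n - 2) s) + r3 * (EE R s ^ 3 * k (n - 3) s) + α n s := fun n s hs => by
    rw [hAe n s hs]; ring
  have mkA : ∀ (n : ℤ) (m a b c : ℕ), m ≤ 4 → m ≤ 1 + a → m ≤ 2 + b → m ≤ 3 + c → OO a (k (n - 1)) → OO b (k (n - 2)) → OO c (k (n - 3)) → OO m (AA n) := by
    intro n m a b c h4 h1 h2 h3 o1 o2 o3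
    exact ((((((o1.E hR 1).mono h1).cmul r1).add (((o2.E hR 2).mono h2).cmul r2)).add (((o3.E hR 3).mono h3).cmul r3)).add ((oα n).mono h4)).congr (hAe' n)
  have mkB : ∀ (n : ℤ) (m a b c : ℕ), m ≤ 4 → m ≤ 1 + a → m ≤ 2 + b → m ≤ 3 + c → OO a (k (n + 1)) → OO b (k (n + 2)) → OO c (k (n + 3)) → OO m (BB n) := by
    intro n m a b c h4 h1 h2 h3 o1 o2 o3
    refine ((((((o1.E hR 1).mono h1).cmul (conj r1)).add (((o2.E hR 2).mono h2).cmul (conj r2))).add (((o3.E hR 3).mono h3).cmul (conj r3))).add ((oβ n).mono h4)).congr fun s hs => ?_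
    rw [hBe n s hs]; simp
  have mkg : ∀ (n : ℤ) (m : ℕ), (m:ℤ) < n + 6 → OO m (BB n) → OO m (g n) := fun n m hmn o => o.grow hmn (dg n)
  have mkk : ∀ (n : ℤ) (m : ℕ), (m:ℤ) < n → OO m (g n) → OO m (k n) := fun n m hmn o => o.grow hmn (dk n)
  have B1 : ∀ n, OO 1 (BB n) := fun n => mkB n 1 0 0 0 (by simp) (by simp) (by simp) (by simp) (ok0 _) (ok0 _) (ok0 _)
  have A1 : OO 1 (AA 1) := mkA 1 1 0 0 0 (by simp) (by simp) (by simp) (by simp) (ok0 _) (ok0 _) (ok0 _)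
  have g1 : ∀ n, 0 ≤ n → OO 1 (g n) := fun n hn => mkg n 1 (by push_cast; omega) (B1 n)
  have k1 : ∀ n, 1 ≤ n → OO 1 (k n) := fun n hn => by
    rcases hn.lt_or_eq with h | h
    · exact mkk n 1 (by push_cast; omega) (g1 n (by omega))
    · subst h
      refine (((g1 1 (by simp)).sub ((A1.sub (B1 1)).cmul (1/2)))).congr fun s hs => ?_
      have := I 1 s hs; push_cast at this; linear_combination (-1/2) * this
  have B2 : ∀ n, 0 ≤ n → OO 2 (BB n) := fun n hn => mkB n 2 1 0 0 (by simp) (by simp) (by simp) (by simp) (k1 _ (by omega)) (ok0 _) (ok0 _)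
  have g2 : ∀ n, 0 ≤ n → OO 2 (g n) := fun n hn => mkg n 2 (by push_cast; omega) (B2 n hn)
  have A2 : OO 2 (AA 2) := mkA 2 2 1 0 0 (by simp) (by simp) (by simp) (by simp) (k1 _ (by omega)) (ok0 _) (ok0 _)
  have k2 : ∀ n, 2 ≤ n → OO 2 (k n) := fun n hn => by
    rcases hn.lt_or_eq with h | h
    · exact mkk n 2 (by push_cast; omega) (g2 n (by omega))
    · subst h
      refine ((((g2 2 (by simp)).cmul 2).sub ((A2.sub (B2 2 (by simp))).cmul (1/2)))).congr fun s hs => ?_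
      have := I 2 s hs; push_cast at this; linear_combination (-1/2) * this
  have B3 : ∀ n, 1 ≤ n → OO 3 (BB n) := fun n hn => mkB n 3 2 2 0 (by simp) (by simp) (by simp) (by simp) (k2 _ (by omega)) (k2 _ (by omega)) (ok0 _)
  have g3 : ∀ n, 1 ≤ n → OO 3 (g n) := fun n hn => mkg n 3 (by push_cast; omega) (B3 n hn)
  have k3 : ∀ n, 4 ≤ n → OO 3 (k n) := fun n hn => mkk n 3 (by push_cast; omega) (g3 n (by omega))
  have B4 : OO 4 (BB 3) := mkB 3 4 3 3 3 (by simp) (by simp) (by simp) (by simp) (k3 _ (by omega)) (k3 _ (by omega)) (k3 _ (by omega))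
  have g4 : OO 4 (g 3) := mkg 3 4 (by norm_num) B4
  have A4 : OO 4 (AA 3) := ((g4.cmul 6).add B4).congr fun s hs => by
    have := I 3 s hs; push_cast at this; linear_combination -this
  have x1 : OO 2 (fun s => k 1 s + r1 / 2 * (EE R s * k 0 s)) := by
    refine ((g2 1 (by simp)).sub (((((((ok0 (-1)).E hR 2).cmul r2).add ((((ok0 (-2)).E hR 3).mono (m := 2) (by simp)).cmul r3)).add ((oα 1).mono (m := 2) (by simp))).sub (B2 1 (by simp))).cmul (1/2))).congr fun s hs => ?_
    have := I 1 s hs; rw [hAe' 1 s hs] at this; norm_num at this; linear_combination (-1/2) * this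
  have x2 : OO 3 (fun s => k 2 s + 1 / 2 * (r1 * (EE R s * k 1 s) + r2 * (EE R s ^ 2 * k 0 s))) := by
    refine (((g3 2 (by simp)).cmul 2).sub ((((((ok0 (-1)).E hR 3).cmul r3).add ((oα 2).mono (m := 3) (by simp))).sub (B3 2 (by simp))).cmul (1/2))).congr fun s hs => ?_
    have := I 2 s hs; rw [hAe' 2 s hs] at this; norm_num at this; linear_combination (-1/2) * this
  have fin : OO 4 (fun s => (r3 - (r1 * r2 - r1 ^ 3 / 4)) * (EE R s ^ 3 * k 0 s)) := by
    refine ((((A4.sub (oα 3)).sub ((x2.E hR 1).cmul r1)).sub ((x1.E hR 2).cmul (r2 - r1 ^ 2 / 2)))).congr fun s hs => ?_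
    rw [hAe' 3 s hs]; norm_num; ring
  obtain ⟨C, hC⟩ := fin
  by_contra hne
  have hne' : 0 < ‖r3 - (r1 * r2 - r1 ^ 3 / 4)‖ := norm_pos_iff.mpr (sub_ne_zero.mpr hne)
  set d := ‖r3 - (r1 * r2 - r1 ^ 3 / 4)‖ with hd
  have hC0 : 0 ≤ C := by simpa using (norm_nonneg _).trans (hC 0 le_rfl)
  set c := d * (R ^ 3 * (2 * Real.pi * mm)) with hc
  have hcp : 0 < c := by have := Real.pi_pos; positivity
  have t : Tendsto (fun s => C * Real.exp (-s)) atTop (𝓝 (C * 0)) := Real.tendsto_exp_neg_atTop_nhds_zero.const_mul C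
  rw [mul_zero] at t
  obtain ⟨s, hs1, hs0⟩ := ((t.eventually (gt_mem_nhds hcp)).and (eventually_ge_atTop 0)).exists
  have h1 := hC s hs0
  rw [norm_mul, norm_mul, EE_norm hR, ← hd] at h1
  have h2 : 2 * Real.pi * mm ≤ ‖k 0 s‖ := (k0re s hs0).trans (Complex.re_le_norm _)
  have e4 : Real.exp (-((4:ℕ):RR) * s) = Real.exp (-((3:ℕ):RR) * s) * Real.exp (-s) := by rw [← Real.exp_add]; push_cast; ring_nf
  rw [e4] at h1
  have e3 := Real.exp_pos (-((3:ℕ):RR) * s)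
  have h3 : d * (R ^ 3 * Real.exp (-((3:ℕ):RR) * s) * (2 * Real.pi * mm)) ≤ d * (R ^ 3 * Real.exp (-((3:ℕ):RR) * s) * ‖k 0 s‖) := by gcongr
  have : Real.exp (-((3:ℕ):RR) * s) * c ≤ Real.exp (-((3:ℕ):RR) * s) * (C * Real.exp (-s)) := by
    rw [hc]; linarith
  have := le_of_mul_le_mul_left this e3
  linarith

set_option maxHeartbeats 1000000 in
theorem localModes {p : CC} {ε mm M : RR} {κ hb : CC → RR} {h Q ρ : CC → CC} {r0 r1 r2 r3 : CC} (hε : 0 < ε)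
    (hm : 0 < mm) (hκ : ∀ z ∈ ann p ε, mm ≤ κ z ∧ κ z ≤ M) (hh : ∀ z ∈ ann p ε, ‖(z - p) * h z‖ ≤ M)
    (hρ : ∀ z ∈ ann p ε, ‖ρ z‖ ≤ M) (hρc : ContinuousOn ρ (ann p ε)) (hQc : ContinuousOn Q (ann p ε))
    (hbc : ContinuousOn hb (ann p ε))
    (Wh : ∀ z ∈ ann p ε, HasW h (Q z - h z ^ 2) (hb z) z)
    (WK : ∀ z ∈ ann p ε, HasW (fun z => (κ z : CC)) (κ z * (1 / (z - p) + h z)) (κ z * (1 / conj (z - p) + conj (h z))) z)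
    (hQ : ∀ z ∈ ann p ε, (z - p) ^ 2 * Q z - 2 = r0 + r1 * (z - p) + r2 * (z - p) ^ 2 + r3 * (z - p) ^ 3 + (z - p) ^ 4 * ρ z) :
    r0 = 0 ∧ r3 = r1 * r2 - r1 ^ 3 / 4 := by
  set A := ann p ε with hA
  obtain ⟨R, hR, hRε⟩ := exists_between hε
  have hlt : ∀ s, 0 ≤ s → R * Real.exp (-s) < ε := fun s hs => by
    have : Real.exp (-s) ≤ 1 := by simpa using hs
    nlinarith
  have hx : ∀ z ∈ A, z - p ≠ 0 := fun z hz => sub_ne_zero.mpr hz.1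
  have hxc : ∀ z ∈ A, conj (z - p) ≠ 0 := fun z hz => (map_ne_zero _).mpr (hx z hz)
  set K : CC → CC := fun z => (κ z : CC) with hK
  set F : CC → CC := fun z => K z * (1 + (z - p) * h z) with hF
  set G : CC → CC := fun z => K z * (1 + conj (z - p) * conj (h z)) with hG
  set r : CC → CC := fun z => (z - p) ^ 2 * Q z - 2 with hr
  have Wx : ∀ z, HasW (fun z => z - p) 1 0 z := fun z => ((hasDerivAt_id z).sub_const p).hasW
  have Wxc : ∀ z, HasW (fun z => conj (z - p)) 0 1 z := fun z => (Wx z).conj.cd (by simp) (by simp)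
  replace WK : ∀ z ∈ A, HasW K (K z * (1 / (z - p) + h z)) (K z * (1 / conj (z - p) + conj (h z))) z := WK
  have cK : ContinuousOn K A := fun z hz => (WK z hz).continuousAt.continuousWithinAt
  have ch : ContinuousOn h A := fun z hz => (Wh z hz).continuousAt.continuousWithinAt
  have cx : ContinuousOn (fun z => z - p) A := by fun_prop
  have cxc : ContinuousOn (fun z => conj (z - p)) A := fun z _ => (Wxc z).continuousAt.continuousWithinAt
  have chc : ContinuousOn (fun z => conj (h z)) A := Complex.continuous_conj.comp_continuousOn ch
  have cQc : ContinuousOn (fun z => conj (Q z)) A := Complex.continuous_conj.comp_continuousOn hQc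
  have cbC : ContinuousOn (fun z => (hb z : CC)) A := Complex.continuous_ofReal.comp_continuousOn hbc
  have cix : ContinuousOn (fun z => 1 / (z - p)) A := continuousOn_const.div cx hx
  have cixc : ContinuousOn (fun z => 1 / conj (z - p)) A := continuousOn_const.div cxc hxc
  have cF : ContinuousOn F A := by fun_prop
  have cG : ContinuousOn G A := by fun_prop
  have cr : ContinuousOn r A := by fun_prop
  have crc : ContinuousOn (fun z => conj (r z)) A := Complex.continuous_conj.comp_continuousOn cr
  set F1 : CC → CC := fun z => K z * (1 / (z - p) + h z) * (1 + (z - p) * h z) + K z * (h z + (z - p) * (Q z - h z ^ 2)) with hF1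
  set F2 : CC → CC := fun z => K z * (1 / conj (z - p) + conj (h z)) * (1 + (z - p) * h z) + K z * ((z - p) * hb z) with hF2
  set G1 : CC → CC := fun z => K z * (1 / (z - p) + h z) * (1 + conj (z - p) * conj (h z)) + K z * (conj (z - p) * hb z) with hG1
  set G2 : CC → CC := fun z => K z * (1 / conj (z - p) + conj (h z)) * (1 + conj (z - p) * conj (h z)) + K z * (conj (h z) + conj (z - p) * (conj (Q z) - conj (h z) ^ 2)) with hG2
  have WF : ∀ z ∈ A, HasW F (F1 z) (F2 z) z := fun z hz =>
    ((WK z hz).mul ((hasW_const 1 z).add ((Wx z).mul (Wh z hz)))).cd (by simp [hF1]) (by simp [hF2])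
  have WG : ∀ z ∈ A, HasW G (G1 z) (G2 z) z := fun z hz =>
    ((WK z hz).mul ((hasW_const 1 z).add ((Wxc z).mul (Wh z hz).conj))).cd (by simp [hG1]) (by simp [hG2])
  have cF1 : ContinuousOn F1 A := by fun_prop
  have cF2 : ContinuousOn F2 A := by fun_prop
  have cG1 : ContinuousOn G1 A := by fun_prop
  have cG2 : ContinuousOn G2 A := by fun_prop
  have cK1 : ContinuousOn (fun z => K z * (1 / (z - p) + h z)) A := by fun_prop
  have cK2 : ContinuousOn (fun z => K z * (1 / conj (z - p) + conj (h z))) A := by fun_prop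
  set k : ℤ → RR → CC := md p R K with hk
  set g : ℤ → RR → CC := md p R G with hg
  set AA : ℤ → RR → CC := md p R (fun z => r z * K z) with hAA
  set BB : ℤ → RR → CC := md p R (fun z => conj (r z) * K z) with hBB
  have eK : ∀ z ∈ A, conj (z - p) * (K z * (1 / conj (z - p) + conj (h z))) = G z := fun z hz => by
    have := hxc z hz; simp only [hG]; field_simp
  have eG : ∀ z ∈ A, conj (z - p) * G2 z = 3 * G z + conj (r z) * K z := fun z hz => by
    have := hxc z hz; simp only [hG, hG2, hr, hK]; simp only [map_sub, map_mul, map_pow, map_ofNat] at this ⊢; field_simp; ring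
  have eF : ∀ z ∈ A, (z - p) * F1 z = 3 * F z + r z * K z := fun z hz => by
    have := hx z hz; simp only [hF, hF1, hr, hK]; field_simp; ring
  have eFG : ∀ z ∈ A, conj (z - p) * F2 z = (z - p) * G1 z := fun z hz => by
    have := hx z hz; have := hxc z hz; simp only [hF2, hG1]; field_simp
  have crK : ContinuousOn (fun z => conj (r z) * K z) A := crc.mul cK
  have crK' : ContinuousOn (fun z => r z * K z) A := cr.mul cK
  have cFr : ContinuousOn (fun z => 3 * F z) A := by fun_prop
  have cGr : ContinuousOn (fun z => 3 * G z) A := by fun_prop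
  have dk : ∀ n s, 0 ≤ s → HasDerivAt (k n) (-(n * k n s + 2 * g n s)) s := fun n s hs => by
    have := md_deriv hR (hlt s hs) n WK cK1 cK2
    rwa [md_congr hR (hlt s hs) n eK] at this
  have dg : ∀ n s, 0 ≤ s → HasDerivAt (g n) (-((n + 6 : ℤ) * g n s + 2 * BB n s)) s := fun n s hs => by
    have := md_deriv hR (hlt s hs) n WG cG1 cG2
    rw [md_congr hR (hlt s hs) n eG, md_add hR (hlt s hs) n cGr crK, md_cmul] at this
    refine this.congr_deriv ?_
    simp only [hg, hBB]; push_cast; ring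
  have I : ∀ (n : ℤ) (s : RR), 0 ≤ s → ((n:CC) * ((n:CC) - 3)) * k n s + 2 * n * g n s = AA n s - BB n s := fun n s hs => by
    have i1 := md_ibp hR (hlt s hs) n WK cK1 cK2
    have i2 := md_ibp hR (hlt s hs) n WF cF1 cF2
    have i3 := md_ibp hR (hlt s hs) n WG cG1 cG2
    rw [md_congr hR (hlt s hs) n eK] at i1
    rw [md_congr hR (hlt s hs) n eF, md_congr hR (hlt s hs) n eFG, md_add hR (hlt s hs) n cFr crK', md_cmul] at i2
    rw [md_congr hR (hlt s hs) n eG, md_add hR (hlt s hs) n cGr crK, md_cmul] at i3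
    have eK1 : ∀ z ∈ A, (z - p) * (K z * (1 / (z - p) + h z)) = F z := fun z hz => by
      have := hx z hz; simp only [hF]; field_simp
    rw [md_congr hR (hlt s hs) n eK1] at i1
    simp only [hk, hg, hAA, hBB]
    linear_combination (3 - n : CC) * i1 - i2 - i3
  set α : ℤ → RR → CC := md p R (fun z => (z - p) ^ 4 * (ρ z * K z)) with hα
  set β : ℤ → RR → CC := md p R (fun z => conj (z - p) ^ 4 * (conj (ρ z) * K z)) with hβ
  have cρc : ContinuousOn (fun z => conj (ρ z)) A := Complex.continuous_conj.comp_continuousOn hρc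
  have hAe : ∀ n s, 0 ≤ s → AA n s = r0 * k n s + r1 * (EE R s ^ 1 * k (n - 1) s) + r2 * (EE R s ^ 2 * k (n - 2) s) + r3 * (EE R s ^ 3 * k (n - 3) s) + α n s := fun n s hs => by
    have e : ∀ z ∈ A, r z * K z = (((r0 * K z + r1 * ((z - p) ^ 1 * K z)) + r2 * ((z - p) ^ 2 * K z)) + r3 * ((z - p) ^ 3 * K z)) + (z - p) ^ 4 * (ρ z * K z) := fun z hz => by
      simp only [hr]; rw [hQ z hz]; ring
    have l := hlt s hs
    simp only [hAA]
    rw [md_congr hR l n e, md_add hR l n (by fun_prop) (by fun_prop), md_add hR l n (by fun_prop) (by fun_prop), md_add hR l n (by fun_prop) (by fun_prop), md_add hR l n (by fun_prop) (by fun_prop), md_cmul, md_cmul, md_cmul, md_cmul, md_pow, md_pow, md_pow]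
    simp [hk, hα]
  have hBe : ∀ n s, 0 ≤ s → BB n s = conj r0 * k n s + conj r1 * (EE R s ^ 1 * k (n + 1) s) + conj r2 * (EE R s ^ 2 * k (n + 2) s) + conj r3 * (EE R s ^ 3 * k (n + 3) s) + β n s := fun n s hs => by
    have e : ∀ z ∈ A, conj (r z) * K z = (((conj r0 * K z + conj r1 * (conj (z - p) ^ 1 * K z)) + conj r2 * (conj (z - p) ^ 2 * K z)) + conj r3 * (conj (z - p) ^ 3 * K z)) + conj (z - p) ^ 4 * (conj (ρ z) * K z) := fun z hz => by
      simp only [hr]; rw [hQ z hz]; simp only [map_add, map_mul, map_pow]; ring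
    have l := hlt s hs
    simp only [hBB]
    rw [md_congr hR l n e, md_add hR l n (by fun_prop) (by fun_prop), md_add hR l n (by fun_prop) (by fun_prop), md_add hR l n (by fun_prop) (by fun_prop), md_add hR l n (by fun_prop) (by fun_prop), md_cmul, md_cmul, md_cmul, md_cmul, md_cpow, md_cpow, md_cpow]
    simp [hk, hβ]
  have hM : 0 ≤ M := (norm_nonneg _).trans (hh (p + pt R 0 0) (pt_mem hR (hlt 0 le_rfl) 0))
  have nK : ∀ z ∈ A, ‖K z‖ ≤ M := fun z hz => by
    rw [hK, Complex.norm_real, Real.norm_of_nonneg (hm.le.trans (hκ z hz).1)]; exact (hκ z hz).2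
  have oα : ∀ n, OO 4 (α n) := fun n => md_OO (C := M * M) hR hRε n 4 fun z hz => by
    rw [norm_mul, norm_mul, norm_pow, mul_comm]; gcongr
    exacts [hρ z hz, nK z hz]
  have oβ : ∀ n, OO 4 (β n) := fun n => md_OO (C := M * M) hR hRε n 4 fun z hz => by
    rw [norm_mul, norm_mul, norm_pow, RCLike.norm_conj, RCLike.norm_conj, mul_comm]; gcongr
    exacts [hρ z hz, nK z hz]
  have ok0 : ∀ n, OO 0 (k n) := fun n => md_OO (C := M) hR hRε n 0 fun z hz => by simpa using nK z hz
  have og0 : ∀ n, OO 0 (g n) := fun n => md_OO (C := M * (1 + M)) hR hRε n 0 fun z hz => by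
    simp only [hG, pow_zero, mul_one]
    rw [norm_mul]
    have := hh z hz
    have h2 : ‖1 + conj (z - p) * conj (h z)‖ ≤ 1 + M := by
      refine (norm_add_le _ _).trans ?_
      rw [← map_mul, RCLike.norm_conj]; simpa using this
    gcongr; exact nK z hz
  have k0re : ∀ s, 0 ≤ s → 2 * Real.pi * mm ≤ (k 0 s).re := fun s hs => by
    have e : k 0 s = ((∫ θ in (0:RR)..(2 * Real.pi), κ (p + pt R s θ) : RR) : CC) := by
      rw [← intervalIntegral.integral_ofReal]; simp [hk, md, hK]
    rw [e, Complex.ofReal_re]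
    have hc : Continuous fun θ : RR => κ (p + pt R s θ) := by
      have := md_cont hR (hlt s hs) cK 0
      exact (Complex.continuous_re.comp this).congr fun θ => by simp [hK]
    have := intervalIntegral.integral_mono_on (a := 0) (b := 2 * Real.pi) Real.two_pi_pos.le (continuous_const (y := mm) |>.intervalIntegrable (μ := MeasureTheory.volume) _ _) (hc.intervalIntegrable _ _) (fun θ _ => (hκ _ (pt_mem hR (hlt s hs) θ)).1)
    simpa using this
  exact modes3 hR hm dk dg I hAe hBe oα oβ ok0 og0 k0re

def Uc (u : CC → RR) : CC → CC := fun z => (u z : CC)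
def hp (u : CC → RR) (z : CC) : CC := -(1/2) * dz (Uc u) z
def Qp (u : CC → RR) (z : CC) : CC := -(1/2) * dz (dz (Uc u)) z + (1/4) * dz (Uc u) z ^ 2
def Hp (u : CC → RR) (z : CC) : CC := (Real.exp (-(u z) / 2) : RR)
def Liou (u : CC → RR) (z : CC) : Prop := Sm (Uc u) z ∧ db (dz (Uc u)) z = -(Real.exp (u z) : RR) / 4

lemma fderiv_Uc {u : CC → RR} {z : CC} (h : DifferentiableAt RR u z) (v : CC) :
    fderiv RR (Uc u) z v = ((fderiv RR u z v : RR) : CC) := by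
  have := (Complex.ofRealCLM.hasFDerivAt.comp z h.hasFDerivAt)
  change fderiv RR (Complex.ofRealCLM ∘ u) z v = _
  rw [this.fderiv]; rfl

lemma liou_lap {u : CC → RR} {z : CC} (h : ∀ n : ℕ, ContDiffAt RR n u z) :
    Sm (Uc u) z ∧ db (dz (Uc u)) z = (lapl u z : RR) / 4 := by
  have hu : ContDiffAt RR ∞ u z := contDiffAt_infty.mpr h
  have hU : Sm (Uc u) z := Complex.ofRealCLM.contDiff.contDiffAt.comp z hu
  refine ⟨hU, ?_⟩
  have ev : ∀ᶠ w in 𝓝 z, DifferentiableAt RR u w := by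
    filter_upwards [(h 1).eventually (by simp)] with w hw using hw.differentiableAt (by simp)
  have key : ∀ v : CC, fderiv RR (fderiv RR (Uc u)) z v v = ((fderiv RR (fun w => fderiv RR u w v) z v : RR) : CC) := fun v => by
    rw [← fderiv_fd hU]
    have e : (fun x => fderiv RR (Uc u) x v) =ᶠ[𝓝 z] Uc (fun w => fderiv RR u w v) := by
      filter_upwards [ev] with w hw using fderiv_Uc hw v
    rw [e.fderiv_eq, fderiv_Uc]
    exact ((hu.fderiv_right (m := ∞) (by simp)).clm_apply contDiffAt_const).differentiableAt (by simp)
  rw [hU.lap, key, key, lapl]; push_cast; ring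

lemma Liou.of {u : CC → RR} {z : CC} (h : ∀ n : ℕ, ContDiffAt RR n u z) (h2 : lapl u z + Real.exp (u z) = 0) : Liou u z := by
  have := liou_lap h
  refine ⟨this.1, ?_⟩
  rw [this.2, show lapl u z = -Real.exp (u z) by linarith]; push_cast; ring

lemma Liou.wU {u z} (h : Liou u z) : HasW (Uc u) (dz (Uc u) z) (conj (dz (Uc u) z)) z := by
  have a := h.1.hasW
  have b : HasW (Uc u) _ _ z := a.conj.congr (by filter_upwards with w; simp [Uc]) rfl rfl
  exact a.cd rfl (b.unique a).2.symm.symm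
lemma Liou.wU1 {u z} (h : Liou u z) : HasW (dz (Uc u)) (dz (dz (Uc u)) z) (-(Real.exp (u z) : RR) / 4) z :=
  h.1.sdz.hasW.cd rfl h.2.symm
lemma Liou.wh {u z} (h : Liou u z) : HasW (hp u) (Qp u z - hp u z ^ 2) ((Real.exp (u z) / 8 : RR) : CC) z := by
  refine ((hasW_const (-(1/2)) z).mul h.wU1).cd ?_ ?_
  · simp [Qp, hp]; ring
  · push_cast; ring
lemma Liou.wexp {u z} (h : Liou u z) (c : RR) : HasW (fun z => ((Real.exp (c * u z) : RR) : CC))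
    (c * dz (Uc u) z * (Real.exp (c * u z) : RR)) (c * conj (dz (Uc u) z) * (Real.exp (c * u z) : RR)) z := by
  have := HasW.comp (Complex.hasDerivAt_exp _) ((hasW_const c z).mul h.wU)
  refine this.congr (by filter_upwards with w; simp [Uc]) ?_ ?_ <;> simp [Uc] <;> ring
lemma Liou.wH {u z} (h : Liou u z) : HasW (Hp u) (hp u z * Hp u z) (conj (hp u z) * Hp u z) z := by
  have := h.wexp (-1/2)
  have e : ∀ w, Hp u w = ((Real.exp ((-1/2) * u w) : RR) : CC) := fun w => by simp only [Hp]; ring_nf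
  refine this.congr (by filter_upwards with w; exact e w) ?_ ?_ <;> rw [e] <;> simp [hp, Complex.conj_ofNat] <;> ring

lemma Liou.holo {u z} (h : ∀ᶠ w in 𝓝 z, Liou u w) : DifferentiableAt CC (Qp u) z := by
  have h0 := h.self_of_nhds
  have s1 := h0.1.sdz
  have a := ((hasW_const (-(1/2)) z).mul s1.sdz.hasW).add ((hasW_const (1/4) z).mul (h0.wU1.mul h0.wU1))
  have e : db (dz (dz (Uc u))) z = -(dz (Uc u) z * (Real.exp (u z) : RR)) / 4 := by
    rw [← s1.comm]
    have b := (hasW_const (-1/4) z).mul (h0.wexp 1)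
    have : HasW (db (dz (Uc u))) _ _ z := b.congr (by filter_upwards [h] with w hw; rw [hw.2]; simp; ring) rfl rfl
    rw [this.dz_eq]; simp; ring
  have : HasW (Qp u) (dz (Qp u) z) 0 z := by
    have c := a.congr (g' := Qp u) (by filter_upwards with w; simp [Qp]; ring) rfl rfl
    have d := hasW_of_diff c.differentiableAt
    refine d.cd rfl ?_
    rw [c.db_eq, e]; simp; ring
  exact this.hasDerivAt.differentiableAt

lemma grad2 {f : CC → CC} {p : CC} {ε C B : RR} (n : ℕ) (hε : ε ≤ 1) (hB : 0 ≤ B) (hf : ∀ z ∈ ann p ε, Sm f z)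
    (hC : ∀ z ∈ ann p ε, ‖f z‖ * ‖z - p‖ ^ n ≤ C) (hb : ∀ z ∈ ann p ε, ‖db (dz f) z‖ ≤ B) :
    ∀ z ∈ ann p (ε / 2), ‖dz f z‖ * ‖z - p‖ ^ (n + 1) ≤ 4 * 2 ^ n * C + B := fun z hz => by
  have x0 : 0 < ‖z - p‖ := norm_pos_iff.mpr (sub_ne_zero.mpr hz.1)
  have xe : ‖z - p‖ < ε / 2 := by rw [← dist_eq_norm]; exact hz.2
  have hbl : ∀ w ∈ ball z (‖z - p‖ / 2), ‖z - p‖ / 2 ≤ ‖w - p‖ ∧ w ∈ ann p ε := fun w hw => by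
    have h1 : ‖w - z‖ < ‖z - p‖ / 2 := by rw [← dist_eq_norm]; exact hw
    have h2 : ‖z - p‖ ≤ ‖w - p‖ + ‖w - z‖ := by
      rw [show z - p = (w - p) - (w - z) by ring]; exact norm_sub_le _ _
    have h3 : ‖w - p‖ ≤ ‖z - p‖ + ‖w - z‖ := by
      rw [show w - p = (z - p) + (w - z) by ring]; exact norm_add_le _ _
    refine ⟨by linarith, fun e => ?_, by rw [dist_eq_norm]; linarith⟩
    rw [e, sub_self, norm_zero] at h2; rw [e] at h1; linarith
  have hC0 : 0 ≤ C := le_trans (by positivity) (hC z ⟨hz.1, by rw [dist_eq_norm]; linarith⟩)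
  have := gradBd (f := f) (p := z) (R := ‖z - p‖ / 4) (R' := ‖z - p‖ / 2) (a := C * (2 / ‖z - p‖) ^ n) (b := B) (by positivity) (by linarith)
    (fun w hw => hf w (hbl w hw).2) (fun w hw => ?_) (fun w hw => hb w (hbl w hw).2)
  · calc _ ≤ (C * (2 / ‖z - p‖) ^ n / (‖z - p‖ / 4) + 2 * B * (‖z - p‖ / 4)) * ‖z - p‖ ^ (n + 1) := by gcongr
      _ = 4 * 2 ^ n * C + B * (‖z - p‖ ^ (n + 2) / 2) := by rw [div_pow]; field_simp; ring
      _ ≤ 4 * 2 ^ n * C + B * 1 := by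
        have : ‖z - p‖ ^ (n + 2) ≤ 1 := pow_le_one₀ x0.le (by linarith)
        gcongr; linarith
      _ = _ := by ring
  · have hw' := hbl w hw
    have : 0 < ‖w - p‖ := by linarith [hw'.1]
    have h1 := hC w hw'.2
    calc ‖f w‖ = ‖f w‖ * ‖w - p‖ ^ n * (1 / ‖w - p‖) ^ n := by rw [one_div, inv_pow]; field_simp
      _ ≤ C * (2 / ‖z - p‖) ^ n := by
        gcongr ?_ * ?_ ^ n
        rw [div_le_div_iff₀ this x0]; linarith [hw'.1]

lemma AnalyticAt.dsl {f : CC → CC} {p : CC} (h : AnalyticAt CC f p) : AnalyticAt CC (dslope f p) p :=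
  let ⟨_, hq⟩ := h; ⟨_, hq.has_fpower_series_dslope_fslope⟩
lemma dsl_eq (f : CC → CC) (p z : CC) : f z = f p + (z - p) * dslope f p z := by
  have := sub_smul_dslope f p z; rw [smul_eq_mul] at this; rw [this]; ring

lemma liou_log {p z : CC} (h : z ≠ p) : Sm (fun z => Complex.log ((z - p) * conj (z - p))) z ∧
    HasW (fun z => Complex.log ((z - p) * conj (z - p))) (1 / (z - p)) (1 / conj (z - p)) z ∧
    Complex.log ((z - p) * conj (z - p)) = (2 * Real.log ‖z - p‖ : RR) := by
  have hx := sub_ne_zero.mpr h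
  have hx' : conj (z - p) ≠ 0 := (map_ne_zero _).mpr hx
  have hn : 0 < ‖z - p‖ := norm_pos_iff.mpr hx
  have e : (z - p) * conj (z - p) = ((‖z - p‖ ^ 2 : RR) : CC) := by rw [Complex.mul_conj, Complex.normSq_eq_norm_sq]
  have hs : (z - p) * conj (z - p) ∈ Complex.slitPlane := by
    rw [e]; exact Complex.ofReal_mem_slitPlane.mpr (by positivity)
  have Wx : HasW (fun z => z - p) 1 0 z := ((hasDerivAt_id z).sub_const p).hasW
  refine ⟨?_, ?_, ?_⟩
  · refine ((Complex.contDiffAt_log hs (n := ∞)).restrict_scalars RR).comp z (f := fun z => (z - p) * conj (z - p)) ?_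
    have : Sm (fun z => z - p) z := contDiffAt_id.sub contDiffAt_const
    exact this.mul (Complex.conjCLE.contDiff.contDiffAt.comp z this)
  · refine (HasW.comp (g := fun z => (z - p) * conj (z - p)) (Complex.hasDerivAt_log hs) (Wx.mul Wx.conj)).cd ?_ ?_ <;> simp only [map_one, map_zero] <;> field_simp <;> ring
  · rw [e, ← Complex.ofReal_log (by positivity), Real.log_pow]; norm_cast

theorem localQ {u : CC → RR} {p : CC} {ε C : RR} (hε : 0 < ε) (hL : ∀ z ∈ ann p ε, Liou u z)
    (hC : ∀ z ∈ ann p ε, |u z - 4 * Real.log (dist z p)| ≤ C) :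
    ∃ (t e c : CC) (ρ : CC → CC), AnalyticAt CC ρ p ∧ c = t * e - t ^ 3 / 4 ∧
      ∀ᶠ z in 𝓝[≠] p, Qp u z = 2 / (z - p) ^ 2 + t / (z - p) + e + c * (z - p) + (z - p) ^ 2 * ρ z := by
  wlog h1 : ε ≤ 1 generalizing ε
  · have i1 : ∀ z ∈ ann p 1, z ∈ ann p ε := fun z hz => ⟨hz.1, hz.2.trans (not_le.mp h1)⟩
    exact this one_pos (fun z hz => hL z (i1 z hz)) (fun z hz => hC z (i1 z hz)) le_rfl
  have hx : ∀ {δ : RR}, ∀ z ∈ ann p δ, z - p ≠ 0 := fun z hz => sub_ne_zero.mpr hz.1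
  have hxn : ∀ {δ : RR}, ∀ z ∈ ann p δ, 0 < ‖z - p‖ := fun z hz => norm_pos_iff.mpr (hx z hz)
  have sub : ∀ {δ δ' : RR}, δ ≤ δ' → ∀ z ∈ ann p δ, z ∈ ann p δ' := fun h z hz => ⟨hz.1, hz.2.trans_le h⟩
  have nx : ∀ z ∈ ann p ε, ‖z - p‖ ≤ 1 := fun z hz => by rw [← dist_eq_norm]; exact hz.2.le.trans h1
  have hC0 : 0 ≤ C := by
    have : p + (ε / 2 : RR) ∈ ann p ε := ⟨by simpa using hε.ne', by
      rw [dist_eq_norm, add_sub_cancel_left, Complex.norm_real, Real.norm_of_nonneg (by positivity)]; linarith⟩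
    exact (abs_nonneg _).trans (hC _ this)
  have eu : ∀ z ∈ ann p ε, Real.exp (u z) ≤ Real.exp C * ‖z - p‖ ^ 4 := fun z hz => by
    have := (abs_le.mp (hC z hz)).2
    rw [← Real.exp_log (hxn z hz), ← Real.exp_nat_mul, ← Real.exp_add, Real.exp_le_exp, ← dist_eq_norm]
    push_cast; linarith
  have ope : ∀ {δ : RR}, δ ≤ ε → ∀ z ∈ ann p δ, ∀ᶠ w in 𝓝 z, Liou u w := fun h z hz =>
    eventually_of_mem ((ann_open p _).mem_nhds (sub h z hz)) hL
  set f : CC → CC := fun z => Uc u z - 2 * Complex.log ((z - p) * conj (z - p)) with hf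
  have sf : ∀ z ∈ ann p ε, Sm f z := fun z hz => (hL z hz).1.sub (contDiffAt_const.mul (liou_log hz.1).1)
  have wf : ∀ z ∈ ann p ε, dz f z = dz (Uc u) z - 2 / (z - p) := fun z hz => by
    have := ((hL z hz).wU.sub ((hasW_const 2 z).mul (liou_log hz.1).2.1)).dz_eq
    rw [hf, this]; ring
  have Wi : ∀ z ∈ ann p ε, HasW (fun z => 2 / (z - p)) (-2 / (z - p) ^ 2) 0 z := fun z hz => by
    have := ((((hasDerivAt_id z).sub_const p).inv (hx z hz)).const_mul 2).hasW
    exact this.congr (by filter_upwards with w; simp [div_eq_mul_inv]) (by simp; ring) rfl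
  have wf1 : ∀ z ∈ ann p ε, HasW (dz f) (dz (dz (Uc u)) z + 2 / (z - p) ^ 2) (-(Real.exp (u z) : RR) / 4) z := fun z hz =>
    ((hL z hz).wU1.sub (Wi z hz)).congr (eventually_of_mem ((ann_open p _).mem_nhds hz) wf) (by ring) (by ring)
  have nexp : ∀ z, ‖(-(Real.exp (u z) : RR) / 4 : CC)‖ ≤ Real.exp (u z) := fun z => by
    rw [norm_div, norm_neg, Complex.norm_real, Real.norm_of_nonneg (Real.exp_pos _).le]; norm_num; linarith [Real.exp_pos (u z)]
  have b1 := grad2 (f := f) (p := p) (C := C) (B := Real.exp C) 0 h1 (Real.exp_pos _).le sf (fun z hz => by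
    rw [hf, pow_zero, mul_one]; simp only []; rw [(liou_log hz.1).2.2, Uc]
    have : ((u z : CC) - 2 * ((2 * Real.log ‖z - p‖ : RR) : CC)) = ((u z - 4 * Real.log (dist z p) : RR) : CC) := by rw [dist_eq_norm]; push_cast; ring
    rw [this, Complex.norm_real]; exact hC z hz) (fun z hz => by
    rw [(wf1 z hz).db_eq]
    refine (nexp z).trans ((eu z hz).trans (mul_le_of_le_one_right (Real.exp_pos _).le (pow_le_one₀ (norm_nonneg _) (nx z hz)))))
  set C1 := 4 * 2 ^ 0 * C + Real.exp C
  have hC1 : 0 ≤ C1 := by positivity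
  have bU : ∀ z ∈ ann p (ε / 2), ‖dz (Uc u) z‖ * ‖z - p‖ ≤ C1 + 2 := fun z hz => by
    have h2 := b1 z hz
    rw [zero_add, pow_one] at h2
    have e : dz (Uc u) z = dz f z + 2 / (z - p) := by rw [wf z (sub (by linarith) z hz)]; ring
    calc _ ≤ (‖dz f z‖ + ‖2 / (z - p)‖) * ‖z - p‖ := by rw [e]; gcongr; exact norm_add_le _ _
      _ = ‖dz f z‖ * ‖z - p‖ + 2 := by rw [norm_div]; have := (hxn z hz).ne'; field_simp; norm_num
      _ ≤ _ := by linarith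
  have b2 := grad2 (f := dz f) (p := p) (C := C1) (B := Real.exp C * (C1 + 2)) 1 (by linarith : ε / 2 ≤ 1) (by positivity)
    (fun z hz => (sf z (sub (by linarith) z hz)).sdz) (fun z hz => by simpa using b1 z hz) (fun z hz => by
      have hz' := sub (by linarith : ε / 2 ≤ ε) z hz
      rw [← (sf z hz').sdz.comm]
      have : HasW (db (dz f)) _ _ z := ((hasW_const (-1/4) z).mul ((hL z hz').wexp 1)).congr
        (eventually_of_mem ((ann_open p _).mem_nhds hz') fun w hw => by rw [(wf1 w hw).db_eq]; simp; ring) rfl rfl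
      rw [this.dz_eq]
      have e : (0 * ((Real.exp (1 * u z) : RR) : CC) + -1 / 4 * (((1:RR):CC) * dz (Uc u) z * ((Real.exp (1 * u z) : RR) : CC))) = (-(Real.exp (u z) : RR) / 4 : CC) * dz (Uc u) z := by simp; ring
      rw [e, norm_mul]
      have n1 := (nexp z).trans (eu z hz')
      have n2 := nx z hz'
      have n3 := hxn z hz
      calc _ ≤ (Real.exp C * ‖z - p‖ ^ 4) * ‖dz (Uc u) z‖ := by gcongr
        _ = Real.exp C * ‖z - p‖ ^ 3 * (‖dz (Uc u) z‖ * ‖z - p‖) := by ring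
        _ ≤ Real.exp C * 1 * (C1 + 2) := by gcongr; exacts [pow_le_one₀ n3.le n2, bU z hz]
        _ = _ := by ring)
  set C2 := 4 * 2 ^ 1 * C1 + Real.exp C * (C1 + 2)
  have e4 : ε / 2 / 2 ≤ ε := by linarith
  set q : CC → CC := fun z => (z - p) ^ 2 * Qp u z - 2 with hq
  have bq : ∀ z ∈ ann p (ε / 2 / 2), ‖q z‖ ≤ 1 / 2 * C2 + 1 + 1 / 4 * (C1 + 2) ^ 2 + 2 := fun z hz => by
    have a1 := b2 z hz
    have a2 := bU z (sub (by linarith) z hz)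
    rw [(wf1 z (sub e4 z hz)).dz_eq] at a1
    have := hx z hz
    have e : q z = -(1/2) * ((dz (dz (Uc u)) z + 2 / (z - p) ^ 2) * (z - p) ^ (1 + 1)) + 1 + 1 / 4 * (dz (Uc u) z * (z - p)) ^ 2 - 2 := by
      simp only [hq, Qp]; field_simp; ring
    rw [e]
    refine (norm_sub_le _ _).trans ?_
    refine (add_le_add_left ((norm_add_le _ _).trans (add_le_add_left (norm_add_le _ _) _)) _).trans ?_
    have a3 : (‖dz (Uc u) z‖ * ‖z - p‖) ^ 2 ≤ (C1 + 2) ^ 2 := by gcongr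
    norm_num at a1 ⊢
    linarith
  have dq : ∀ z ∈ ann p (ε / 2 / 2), DifferentiableAt CC q z := fun z hz => by
    have := Liou.holo (ope e4 z hz)
    fun_prop
  have seq : ball p (ε / 2 / 2) \ {p} = ann p (ε / 2 / 2) := by ext z; simp [ann, and_comm]
  set g := Function.update q p (limUnder (𝓝[≠] p) q) with hg
  have gd : DifferentiableOn CC g (ball p (ε / 2 / 2)) := Complex.differentiableOn_update_limUnder_of_bddAbove (ball_mem_nhds p (by positivity))
    (by rw [seq]; exact fun z hz => (dq z hz).differentiableWithinAt) (by rw [seq]; exact ⟨_, by rintro _ ⟨z, hz, rfl⟩; exact bq z hz⟩)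
  have ga : AnalyticAt CC g p := gd.analyticAt (ball_mem_nhds p (by positivity))
  have gq : ∀ z, z ≠ p → g z = q z := fun z hz => Function.update_of_ne hz _ _
  obtain ⟨g1, hg1⟩ : ∃ g1, g1 = dslope g p := ⟨_, rfl⟩
  obtain ⟨g2, hg2⟩ : ∃ g2, g2 = dslope g1 p := ⟨_, rfl⟩
  obtain ⟨g3, hg3⟩ : ∃ g3, g3 = dslope g2 p := ⟨_, rfl⟩
  obtain ⟨ρ, hρ⟩ : ∃ ρ, ρ = dslope g3 p := ⟨_, rfl⟩
  have ρa : AnalyticAt CC ρ p := by rw [hρ, hg3, hg2, hg1]; exact ga.dsl.dsl.dsl.dsl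
  have ex : ∀ z, z ≠ p → q z = g p + g1 p * (z - p) + g2 p * (z - p) ^ 2 + g3 p * (z - p) ^ 3 + (z - p) ^ 4 * ρ z := fun z hz => by
    rw [← gq z hz, dsl_eq g p z, ← hg1, dsl_eq g1 p z, ← hg2, dsl_eq g2 p z, ← hg3, dsl_eq g3 p z, ← hρ]; ring
  obtain ⟨δ0, hδ0, hδ⟩ := Metric.eventually_nhds_iff_ball.mp (ρa.eventually_analyticAt.and (ρa.continuousAt.norm.eventually (gt_mem_nhds (lt_add_one ‖ρ p‖))))
  set δ := min δ0 (ε / 2 / 2)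
  have s0 : ∀ z ∈ ann p δ, z ∈ ball p δ0 := fun z hz => hz.2.trans_le (min_le_left _ _)
  have s1 : ∀ z ∈ ann p δ, z ∈ ann p (ε / 2) := fun z hz => sub (by linarith) z (sub (min_le_right _ _) z hz)
  have s2 : ∀ z ∈ ann p δ, z ∈ ann p ε := fun z hz => sub (by linarith) z (s1 z hz)
  obtain ⟨r0, r3⟩ := localModes (p := p) (ε := δ) (mm := Real.exp (-C / 2)) (M := max (Real.exp (C / 2)) (max (C1 + 2) (‖ρ p‖ + 1)))
    (κ := fun z => ‖z - p‖ ^ 2 * Real.exp (-(u z) / 2)) (hb := fun z => Real.exp (u z) / 8) (h := hp u) (Q := Qp u) (ρ := ρ)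
    (r0 := g p) (r1 := g1 p) (r2 := g2 p) (r3 := g3 p) (by positivity) (Real.exp_pos _) (fun z hz => by
      have h2 := abs_le.mp (hC z (s2 z hz))
      have e : ‖z - p‖ ^ 2 * Real.exp (-(u z) / 2) = Real.exp (-(u z - 4 * Real.log (dist z p)) / 2) := by
        rw [dist_eq_norm]; nth_rw 1 [← Real.exp_log (hxn z hz)]; rw [← Real.exp_nat_mul, ← Real.exp_add]; push_cast; ring_nf
      beta_reduce; rw [e]
      exact ⟨Real.exp_le_exp.mpr (by linarith), le_max_of_le_left (Real.exp_le_exp.mpr (by linarith))⟩)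
    (fun z hz => le_max_of_le_right (le_max_of_le_left (by
      have := bU z (s1 z hz)
      rw [hp, norm_mul, norm_mul]; norm_num; linarith [norm_nonneg (dz (Uc u) z), mul_nonneg (norm_nonneg (dz (Uc u) z)) (norm_nonneg (z - p))])))
    (fun z hz => le_max_of_le_right (le_max_of_le_right (hδ z (s0 z hz)).2.le))
    (fun z hz => (hδ z (s0 z hz)).1.continuousAt.continuousWithinAt)
    (fun z hz => (Liou.holo (ope le_rfl z (s2 z hz))).continuousAt.continuousWithinAt)
    (fun z hz => by
      have := (hL z (s2 z hz)).wexp 1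
      have c := Complex.continuous_re.continuousAt.comp this.continuousAt
      refine (ContinuousAt.div_const (f := fun z => Real.exp (u z)) ?_ 8).continuousWithinAt
      exact c.congr (by filter_upwards with w; simp [← Complex.ofReal_exp]))
    (fun z hz => (hL z (s2 z hz)).wh)
    (fun z hz => by
      have Wx : HasW (fun z => z - p) 1 0 z := ((hasDerivAt_id z).sub_const p).hasW
      have x1 := hx z hz
      have x2 : conj (z - p) ≠ 0 := (map_ne_zero _).mpr x1
      have e : ∀ w, ((‖w - p‖ ^ 2 * Real.exp (-(u w) / 2) : RR) : CC) = (w - p) * conj (w - p) * Hp u w := fun w => by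
        rw [Complex.mul_conj, Complex.normSq_eq_norm_sq, Hp]; push_cast; ring
      refine ((Wx.mul Wx.conj).mul (hL z (s2 z hz)).wH).congr (by filter_upwards with w; exact e w) ?_ ?_ <;> rw [e] <;>
        simp only [map_one, map_zero] <;> field_simp <;> ring)
    (fun z hz => ex z hz.1)
  refine ⟨g1 p, g2 p, g3 p, ρ, ρa, r3, ?_⟩
  filter_upwards [self_mem_nhdsWithin] with z hz
  have x1 : z - p ≠ 0 := sub_ne_zero.mpr hz
  have := ex z hz
  rw [r0] at this
  simp only [hq] at this
  field_simp
  linear_combination this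

namespace PeriodPair
variable (L : PeriodPair)

def zt (z : CC) : CC := ∑' l : L.lattice, (1 / (z - l) + 1 / l + z / (l:CC) ^ 2)

lemma zt_bound (r : RR) (hr : 0 < r) (s : CC) (hs : ‖s‖ < r) (l : CC) (h : 2 * r ≤ ‖l‖) :
    ‖1 / (s - l) + 1 / l + s / l ^ 2‖ ≤ 2 * r ^ 2 * ‖l‖ ^ (-3 : RR) := by
  have h0 : 0 < ‖l‖ := by linarith
  have hl : l ≠ 0 := norm_pos_iff.1 h0
  have h1 : ‖l‖ / 2 ≤ ‖s - l‖ := by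
    rw [norm_sub_rev]; exact .trans (by linarith) (norm_sub_norm_le l s)
  have hsl : s - l ≠ 0 := norm_pos_iff.1 (by linarith)
  rw [show 1 / (s - l) + 1 / l + s / l ^ 2 = s ^ 2 / ((s - l) * l ^ 2) by field_simp; ring,
    norm_div, norm_mul, norm_pow, norm_pow, Real.rpow_neg h0.le, show (3:RR) = (3:ℕ) by norm_num, Real.rpow_natCast,
    ← div_eq_mul_inv, div_le_div_iff₀ (by positivity) (by positivity)]
  calc ‖s‖ ^ 2 * ‖l‖ ^ 3 ≤ r ^ 2 * ‖l‖ ^ 3 := by gcongr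
    _ = 2 * r ^ 2 * (‖l‖ / 2 * ‖l‖ ^ 2) := by ring
    _ ≤ _ := by gcongr

lemma summ3 (c : RR) : Summable fun l : L.lattice => c * ‖l‖ ^ (-3 : RR) :=
  (ZLattice.summable_norm_rpow _ _ (by simp; norm_num)).mul_left _

lemma cof (r : RR) : ∀ᶠ l : L.lattice in cofinite, r ≤ ‖(l:CC)‖ := by
  refine (isCompact_iff_finite.mp (isCompact_closedBall (0 : L.lattice) r)).subset fun l hl => ?_
  have : ¬ (r ≤ ‖(l:CC)‖) := hl
  simp only [mem_closedBall, dist_zero_right]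
  exact (not_le.1 this).le

lemma zt_lu : HasSumLocallyUniformly (fun (l : L.lattice) z => 1 / (z - l) + 1 / l + z / (l:CC) ^ 2) L.zt :=
  L.hasSumLocallyUniformly_aux _ (fun r l => 2 * r ^ 2 * ‖l‖ ^ (-3 : RR)) (fun r _ => L.summ3 _)
    fun r hr => by
      filter_upwards [eventually_ge_atTop (2 * r)] with R hR x hx l hl
      exact zt_bound r hr x hx l (by rw [hl]; exact hR)
lemma zt_hasSum (z : CC) : HasSum (fun l : L.lattice => 1 / (z - l) + 1 / l + z / (l:CC) ^ 2) (L.zt z) :=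
  L.zt_lu.tendstoLocallyUniformlyOn (s := univ) |>.tendsto_at (mem_univ z)

lemma sub_ne {z : CC} (hz : z ∉ L.lattice) (l : L.lattice) : z - l ≠ 0 := fun e =>
  hz (by rw [sub_eq_zero.1 e]; exact l.2)
lemma open_compl : IsOpen {z : CC | z ∉ L.lattice} := L.isClosed_lattice.isOpen_compl
lemma ev_compl {z : CC} (hz : z ∉ L.lattice) : ∀ᶠ w in 𝓝 z, w ∉ L.lattice := L.open_compl.mem_nhds hz
lemma ev_punct (z : CC) : ∀ᶠ w in 𝓝[≠] z, w ∉ L.lattice := by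
  have := L.compl_lattice_sdiff_singleton_mem_nhds z
  filter_upwards [nhdsWithin_le_nhds this, self_mem_nhdsWithin] with w hw h2 h3
  exact hw ⟨h3, h2⟩

lemma zt_d {z : CC} (hz : z ∉ L.lattice) : HasDerivAt L.zt (-L.weierstrassP z) z := by
  have hd : ∀ (l : L.lattice) w, w ∉ L.lattice → HasDerivAt (fun z => 1 / (z - l) + 1 / l + z / (l:CC) ^ 2)
      (-(1 / (w - l) ^ 2 - 1 / (l:CC) ^ 2)) w := fun l w hw => by
    have h1 := L.sub_ne hw l
    have := ((((hasDerivAt_id w).sub_const (l:CC)).inv h1).add_const (1 / (l:CC))).add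
      ((hasDerivAt_id w).div_const ((l:CC) ^ 2))
    refine (this.congr_of_eventuallyEq (by filter_upwards with x; simp)).congr_deriv ?_
    simp; ring
  have := L.zt_lu.tendstoLocallyUniformlyOn (s := {z : CC | z ∉ L.lattice})
  have hF : ∀ s : Finset L.lattice, DifferentiableOn CC (fun z => ∑ l ∈ s, (1 / (z - l) + 1 / l + z / (l:CC) ^ 2)) {z : CC | z ∉ L.lattice} :=
    fun s => .fun_sum fun l _ w hw => (hd l w hw).differentiableAt.differentiableWithinAt
  have d1 := (this.differentiableOn (.of_forall hF) L.open_compl).differentiableAt (L.open_compl.mem_nhds hz)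
  have d2 := (this.deriv (.of_forall hF) L.open_compl).tendsto_at hz
  have d3 := (L.hasSum_weierstrassP z).neg
  refine d1.hasDerivAt.congr_deriv (Eq.symm ?_)
  refine tendsto_nhds_unique ?_ d2
  refine d3.congr fun s => ?_
  simp only [Function.comp]
  rw [deriv_fun_sum fun l _ => (hd l z hz).differentiableAt]
  exact Finset.sum_congr rfl fun l _ => (hd l z hz).deriv.symm

lemma zt_an {z : CC} (hz : z ∉ L.lattice) : AnalyticAt CC L.zt z :=
  DifferentiableOn.analyticAt (s := {z : CC | z ∉ L.lattice}) (fun w hw => (L.zt_d hw).differentiableAt.differentiableWithinAt)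
    (L.open_compl.mem_nhds hz)

lemma zt_neg (z : CC) : L.zt (-z) = -L.zt z := by
  rw [zt, ← (Equiv.neg L.lattice).tsum_eq, zt, ← tsum_neg]
  congr with l
  rcases eq_or_ne z l with h | h
  · subst h; simp; ring
  · have h1 : z - l ≠ 0 := sub_ne_zero.2 h
    simp only [Equiv.neg_apply, NegMemClass.coe_neg]
    rw [show -z - -(l:CC) = -(z - l) by ring, neg_sq, div_neg, div_neg, neg_div]; ring

def El (w : CC) : CC := (1 - w) * Complex.exp (w + w ^ 2 / 2)
lemma El_d (w : CC) : HasDerivAt El (-w ^ 2 * Complex.exp (w + w ^ 2 / 2)) w := by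
  have := ((hasDerivAt_id w).const_sub 1).mul ((((hasDerivAt_id w).add (((hasDerivAt_id w).pow 2).div_const 2))).cexp)
  refine (this.congr_of_eventuallyEq (by filter_upwards with x; simp [El])).congr_deriv ?_
  simp; ring
lemma El_bd (w : CC) (hw : ‖w‖ ≤ 1) : ‖El w - 1‖ ≤ Real.exp 2 * ‖w‖ ^ 3 := by
  have := (convex_closedBall (0:CC) ‖w‖).norm_image_sub_le_of_norm_hasDerivWithin_le (f := El) (C := ‖w‖ ^ 2 * Real.exp 2)
    (fun x _ => (El_d x).hasDerivWithinAt) (fun x hx => ?_) (x := 0) (y := w) (by simp) (by simp)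
  · simp only [El, sub_zero, ne_eq, OfNat.ofNat_ne_zero, not_false_eq_true, zero_pow, zero_div, add_zero, Complex.exp_zero, mul_one] at this ⊢
    exact this.trans (le_of_eq (by ring))
  · have hx : ‖x‖ ≤ ‖w‖ := by simpa using hx
    rw [norm_mul, norm_neg, norm_pow, Complex.norm_exp]
    gcongr
    refine (Complex.re_le_norm _).trans ((norm_add_le _ _).trans ?_)
    rw [norm_div, norm_pow]; norm_num
    nlinarith [norm_nonneg x]

def pg (z : CC) : CC := ∏' l : L.lattice, (1 + (El (z / l) - 1))
def sg (z : CC) : CC := z * L.pg z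

lemma pg_bd (r : RR) : ∀ᶠ l : L.lattice in cofinite, ∀ z ∈ ball (0:CC) r,
    ‖El (z / l) - 1‖ ≤ (Real.exp 2 * r ^ 3) * ‖l‖ ^ (-3 : RR) := by
  filter_upwards [L.cof (max r 1)] with l hl z hz
  have hz : ‖z‖ < r := by simpa using hz
  have h0 : 0 < ‖(l:CC)‖ := lt_of_lt_of_le (by positivity) hl
  have hle : ‖z / l‖ ≤ 1 := by
    rw [norm_div, div_le_one h0]; exact hz.le.trans ((le_max_left _ _).trans hl)
  refine (El_bd _ hle).trans ?_
  have : ‖l‖ = ‖(l:CC)‖ := rfl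
  rw [this, Real.rpow_neg h0.le, show (3:RR) = (3:ℕ) by norm_num, Real.rpow_natCast, norm_div, div_pow, div_eq_mul_inv, ← mul_assoc]
  gcongr

lemma pg_lu (r : RR) : MultipliableLocallyUniformlyOn (fun (l : L.lattice) z => 1 + (El (z / l) - 1)) (ball 0 r) :=
  Summable.multipliableLocallyUniformlyOn_one_add isOpen_ball (L.summ3 (Real.exp 2 * r ^ 3)) (L.pg_bd r) fun l => by
    have : Continuous El := continuous_iff_continuousAt.2 fun w => (El_d w).continuousAt
    fun_prop
lemma fac_diff (l : CC) : Differentiable CC fun z => 1 + (El (z / l) - 1) := by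
  have : Differentiable CC El := fun w => (El_d w).differentiableAt
  fun_prop
lemma pg_diff : Differentiable CC L.pg := fun z => by
  refine ((L.pg_lu (‖z‖ + 1)).hasProdLocallyUniformlyOn.differentiableOn (.of_forall fun s => ?_) isOpen_ball).differentiableAt
    (isOpen_ball.mem_nhds (by simp))
  exact Differentiable.differentiableOn (Differentiable.fun_finset_prod (fun l _ => fac_diff l))
lemma pg_summ (z : CC) : Summable fun l : L.lattice => ‖El (z / l) - 1‖ := by
  refine Summable.of_norm_bounded_eventually (L.summ3 (Real.exp 2 * (‖z‖ + 1) ^ 3)) ?_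
  filter_upwards [L.pg_bd (‖z‖ + 1)] with l hl
  simpa using hl z (by simp)
lemma El_zero : El 0 = 1 := by simp [El]
lemma pg_ne {z : CC} (hz : ∀ l ∈ L.lattice, l ≠ 0 → z ≠ l) : L.pg z ≠ 0 := by
  refine tprod_one_add_ne_zero_of_summable (fun l => ?_) (L.pg_summ z)
  rw [add_sub_cancel]
  rcases eq_or_ne (l:CC) 0 with h | h
  · simp [h, El_zero]
  · simp only [El, ne_eq, mul_eq_zero, Complex.exp_ne_zero, or_false, sub_eq_zero]
    intro e
    exact hz l l.2 h ((eq_div_iff h).1 e |>.symm.trans (one_mul _))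
lemma pg_zero : L.pg 0 = 1 := by simp [pg, El_zero]
lemma sg_diff : Differentiable CC L.sg := differentiable_id.mul L.pg_diff
lemma sg_an (z : CC) : AnalyticAt CC L.sg z := L.sg_diff.analyticAt z
lemma sg_ne {z : CC} (hz : z ∉ L.lattice) : L.sg z ≠ 0 :=
  mul_ne_zero (fun e => hz (e ▸ L.lattice.zero_mem)) (L.pg_ne fun l hl _ e => hz (e ▸ hl))
lemma sg_zero {z : CC} (hz : z ∈ L.lattice) : L.sg z = 0 := by
  rcases eq_or_ne z 0 with h | h
  · simp [sg, h]
  · rw [sg, pg, tprod_of_exists_eq_zero, mul_zero]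
    exact ⟨⟨z, hz⟩, by simp [El, h]⟩
lemma sg_zd : HasDerivAt L.sg 1 0 := by
  have := (hasDerivAt_id (0:CC)).mul (L.pg_diff 0).hasDerivAt
  exact this.congr_deriv (by simp [pg_zero])

lemma zt_split (z : CC) : L.zt z = 1 / z + ∑' l : L.lattice, if l = 0 then 0 else (1 / (z - l) + 1 / l + z / (l:CC) ^ 2) := by
  rw [zt, (L.zt_hasSum z).summable.tsum_eq_add_tsum_ite 0]; simp

lemma sg_d {z : CC} (hz : z ∉ L.lattice) : HasDerivAt L.sg (L.zt z * L.sg z) z := by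
  have h0 : z ≠ 0 := fun e => hz (e ▸ L.lattice.zero_mem)
  have hp := L.pg_ne (z := z) fun l hl _ e => hz (e ▸ hl)
  have hl : ∀ l : L.lattice, logDeriv (fun z : CC => 1 + (El (z / l) - 1)) z =
      if l = 0 then 0 else (1 / (z - l) + 1 / l + z / (l:CC) ^ 2) := fun l => by
    rcases eq_or_ne l 0 with h | h
    · subst h; simp [El_zero, logDeriv]
    · have h' : (l:CC) ≠ 0 := by simpa using h
      have h1 := L.sub_ne hz l
      have : HasDerivAt (fun z : CC => 1 + (El (z / l) - 1)) _ z :=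
        ((HasDerivAt.comp (h₂ := El) z (El_d (z / l)) ((hasDerivAt_id' z).div_const (l:CC))).sub_const 1).const_add 1
      rw [logDeriv_apply, this.deriv, if_neg h, add_sub_cancel, El]
      have h3 : (l:CC) - z ≠ 0 := by rw [← neg_sub]; exact neg_ne_zero.2 h1
      have h2 : 1 - z / l ≠ 0 := by rw [one_sub_div h']; exact div_ne_zero h3 h'
      have := Complex.exp_ne_zero (z / l + (z / l) ^ 2 / 2)
      rw [div_eq_iff (mul_ne_zero h2 this)]
      simp only [one_div]
      field_simp
      ring
  have hs : Summable fun l : L.lattice => logDeriv (fun z : CC => 1 + (El (z / l) - 1)) z := by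
    simp_rw [hl]
    have := (L.zt_hasSum z).summable
    refine (this.update 0 0).congr fun l => ?_
    rw [Function.update_apply]
  have key := logDeriv_tprod_eq_tsum (isOpen_ball (x := (0:CC)) (ε := ‖z‖ + 1)) (x := z) (by simp)
    (f := fun (l : L.lattice) z => 1 + (El (z / l) - 1)) (fun l e => hp ?_) (fun l => (fac_diff l).differentiableOn) hs
    (L.pg_lu _) hp
  · have d := (hasDerivAt_id z).mul (L.pg_diff z).hasDerivAt
    refine d.congr_deriv ?_
    rw [show (fun x : CC => ∏' l : L.lattice, (1 + (El (x / l) - 1))) = L.pg from rfl, logDeriv_apply, div_eq_iff hp] at key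
    rw [key, zt_split, sg]
    simp_rw [hl]
    simp only [id]; field_simp
  · exact tprod_of_exists_eq_zero ⟨l, e⟩

lemma sg_neg (z : CC) : L.sg (-z) = -L.sg z := by
  rw [sg, sg, pg, ← (Equiv.neg L.lattice).tprod_eq]
  simp [pg]
end PeriodPair

lemma dsl2 {f : CC → CC} {p : CC} (hf : AnalyticAt CC f p) (h0 : f p = 0) (h1 : deriv f p = 0) :
    ∃ g, AnalyticAt CC g p ∧ ∀ z, f z = (z - p) ^ 2 * g z := by
  refine ⟨_, hf.dsl.dsl, fun z => ?_⟩
  rw [dsl_eq f p z, h0, dsl_eq (dslope f p) p z, dslope_same, h1]; ring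
lemma dsl1 {f : CC → CC} {p : CC} (hf : AnalyticAt CC f p) (h0 : f p = 0) :
    ∃ g, AnalyticAt CC g p ∧ g p = deriv f p ∧ ∀ z, f z = (z - p) * g z :=
  ⟨_, hf.dsl, dslope_same _ _, fun z => by rw [dsl_eq f p z, h0]; ring⟩
lemma odd_zero {f : CC → CC} (h : ∀ᶠ z in 𝓝 (0:CC), f (-z) = -f z) : f 0 = 0 := by
  have := h.self_of_nhds; rw [neg_zero] at this; exact self_eq_neg.1 this
lemma even_d {f : CC → CC} (h : ∀ᶠ z in 𝓝 (0:CC), f (-z) = f z) : deriv f 0 = 0 := by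
  have e : (fun z => f (-z)) =ᶠ[𝓝 0] f := h
  have := e.deriv_eq
  rw [deriv_comp_neg, neg_zero] at this; exact neg_eq_self.1 this
lemma eq_of_punct {f g : CC → CC} {p : CC} (hf : ContinuousAt f p) (hg : ContinuousAt g p) (h : f =ᶠ[𝓝[≠] p] g) : f p = g p :=
  tendsto_nhds_unique (hf.tendsto.mono_left nhdsWithin_le_nhds) ((hg.tendsto.mono_left nhdsWithin_le_nhds).congr' h.symm)
lemma eq_nhds_of_punct {f g : CC → CC} {p : CC} (h : f =ᶠ[𝓝[≠] p] g) (h0 : f p = g p) : f =ᶠ[𝓝 p] g := by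
  rw [EventuallyEq, eventually_nhdsWithin_iff] at h
  filter_upwards [h] with z hz
  rcases eq_or_ne z p with e | e
  · rw [e, h0]
  · exact hz e
lemma punct_add {p w : CC} {P : CC → Prop} (h : ∀ᶠ z in 𝓝[≠] (p + w), P z) : ∀ᶠ z in 𝓝[≠] p, P (z + w) := by
  have : Tendsto (fun z => z + w) (𝓝[≠] p) (𝓝[≠] (p + w)) :=
    (continuous_add_const w).continuousAt.continuousWithinAt.tendsto_nhdsWithin fun z hz => by simpa using hz
  exact this.eventually h
lemma punct_neg {p : CC} {P : CC → Prop} (h : ∀ᶠ z in 𝓝[≠] (-p), P z) : ∀ᶠ z in 𝓝[≠] p, P (-z) := by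
  have : Tendsto (fun z : CC => -z) (𝓝[≠] p) (𝓝[≠] (-p)) :=
    continuous_neg.continuousAt.continuousWithinAt.tendsto_nhdsWithin fun z hz => by simpa using hz
  exact this.eventually h
lemma ev_pp {p : CC} {P : CC → Prop} (h : ∀ᶠ z in 𝓝[≠] p, P z) : ∀ᶠ z in 𝓝[≠] p, ∀ᶠ y in 𝓝 z, P y := by
  rw [eventually_nhdsWithin_iff] at h
  filter_upwards [nhdsWithin_le_nhds h.eventually_nhds, self_mem_nhdsWithin] with z hz hne
  filter_upwards [hz, isOpen_compl_singleton.mem_nhds hne] with y h1 h2 using h1 h2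

def Disc (S : Set CC) : Prop := ∀ p, ∀ᶠ z in 𝓝[≠] p, z ∉ S
lemma Disc.union {S T : Set CC} (h : Disc S) (h' : Disc T) : Disc (S ∪ T) := fun p => by
  filter_upwards [h p, h' p] with z a b c using c.elim a b
def ExtAt (φ : CC → CC) (p : CC) : Prop := ∃ ψ, AnalyticAt CC ψ p ∧ φ =ᶠ[𝓝[≠] p] ψ
lemma AnalyticAt.ext {φ : CC → CC} {p : CC} (h : AnalyticAt CC φ p) : ExtAt φ p := ⟨φ, h, EventuallyEq.rfl⟩
lemma ExtAt.lim {φ ψ : CC → CC} {p : CC} (h : ContinuousAt ψ p) (h2 : φ =ᶠ[𝓝[≠] p] ψ) : limUnder (𝓝[≠] p) φ = ψ p :=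
  ((h.tendsto.mono_left nhdsWithin_le_nhds).congr' h2.symm).limUnder_eq

namespace PeriodPair
variable (L : PeriodPair)

lemma disc : Disc L.lattice := L.ev_punct
lemma disc_add (a : CC) : Disc {z | z - a ∈ L.lattice} := fun p => by
  have := L.ev_punct (p - a)
  rw [show p - a = p + -a by ring] at this
  simpa [sub_eq_add_neg] using punct_add this

lemma liouQ {S : Set CC} (hS : Disc S) {φ : CC → CC} (b : CC → CC) (hper : ∀ w ∈ L.lattice, ∀ z ∉ S, φ (z + w) = φ z + b w)
    (hext : ∀ p, ∃ w ∈ L.lattice, ExtAt φ (p + w)) :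
    ∃ α c, (∀ w ∈ L.lattice, α * w = b w) ∧ (∀ p, ∀ᶠ z in 𝓝[≠] p, φ z = α * z + c) ∧
      ∀ p ψ, ContinuousAt ψ p → φ =ᶠ[𝓝[≠] p] ψ → ψ p = α * p + c := by
  have hE : ∀ p, ExtAt φ p := fun p => by
    obtain ⟨w, hw, ψ, h1, h2⟩ := hext p
    refine ⟨fun z => ψ (z + w) - b w, ?_, ?_⟩
    · exact (AnalyticAt.comp_of_eq' h1 (f := fun z => z + w) (by fun_prop) rfl).fun_sub analyticAt_const
    · filter_upwards [punct_add h2, hS p] with z hz hs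
      rw [← hz, hper w hw z hs]; ring
  choose ψ h1 h2 using hE
  set F : CC → CC := fun p => limUnder (𝓝[≠] p) φ with hF
  have hFe : ∀ p, F =ᶠ[𝓝 p] ψ p := fun p => by
    apply eq_nhds_of_punct
    · filter_upwards [ev_pp (h2 p), nhdsWithin_le_nhds (h1 p).eventually_analyticAt] with z hz ha
      exact ExtAt.lim ha.continuousAt (nhdsWithin_le_nhds hz)
    · exact ExtAt.lim (h1 p).continuousAt (h2 p)
  have hFa : ∀ p, AnalyticAt CC F p := fun p => (h1 p).congr (hFe p).symm
  have hFd : Differentiable CC F := fun p => (hFa p).differentiableAt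
  have hFφ : ∀ p, ∀ᶠ z in 𝓝[≠] p, φ z = F z := fun p => by
    filter_upwards [h2 p, nhdsWithin_le_nhds (hFe p)] with z a b
    rw [a, b]
  have hFp : ∀ w ∈ L.lattice, ∀ z, F (z + w) = F z + b w := fun w hw z => by
    refine eq_of_punct (f := fun z => F (z + w)) (g := fun z => F z + b w) ?_ ?_ ?_
    · exact hFd.continuous.continuousAt.comp' (by fun_prop)
    · exact hFd.continuous.continuousAt.add_const _
    · filter_upwards [hFφ z, punct_add (hFφ (z + w)), hS z] with y e1 e2 e3
      rw [← e1, ← e2, hper w hw y e3]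
  have hdp : ∀ w ∈ L.lattice, ∀ z, deriv F (z + w) = deriv F z := fun w hw z => by
    have : (fun z => F (z + w)) = fun z => F z + b w := funext (hFp w hw)
    have := congrArg (fun f => deriv f z) this
    simpa [deriv_comp_add_const] using this
  have hdd : Differentiable CC (deriv F) := fun p => (hFa p).deriv.differentiableAt
  have hbd : Bornology.IsBounded (range (deriv F)) := by
    have hK : IsCompact (closure (ZSpan.fundamentalDomain L.basis)) := (ZSpan.fundamentalDomain_isBounded L.basis).isCompact_closure
    refine (hK.image hdd.continuous).isBounded.subset ?_
    rintro _ ⟨z, rfl⟩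
    refine ⟨ZSpan.fract L.basis z, subset_closure (ZSpan.fract_mem_fundamentalDomain _ _), ?_⟩
    have hm : ((ZSpan.floor L.basis z : Submodule.span ℤ (range L.basis)) : CC) ∈ L.lattice := by
      rw [lattice_eq_span_range_basis]; exact Subtype.coe_prop _
    have e : z = ZSpan.fract L.basis z + (ZSpan.floor L.basis z : CC) := by rw [ZSpan.fract_apply]; ring
    conv_rhs => rw [e]
    rw [hdp _ hm]
  have hc : ∀ z, deriv F z = deriv F 0 := fun z => hdd.apply_eq_apply_of_bounded hbd z 0
  have hlin : ∀ z, F z = deriv F 0 * z + F 0 := fun z => by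
    have := is_const_of_deriv_eq_zero (f := fun z => F z - deriv F 0 * z) (by fun_prop) (fun x => by
      rw [deriv_fun_sub (hFd x) (by fun_prop), deriv_const_mul_id', hc]; simp) z 0
    simp at this; rw [← this]; ring
  refine ⟨deriv F 0, F 0, fun w hw => ?_, fun p => ?_, fun p ξ hξ he => ?_⟩
  · have := hFp w hw 0
    rw [zero_add, hlin w] at this; linear_combination this
  · filter_upwards [hFφ p] with z hz
    rw [hz, hlin]
  · rw [← hlin]; exact (ExtAt.lim hξ he).symm

lemma liouC {S : Set CC} (hS : Disc S) {φ : CC → CC} (hper : ∀ w ∈ L.lattice, ∀ z ∉ S, φ (z + w) = φ z)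
    (hext : ∀ p, ∃ w ∈ L.lattice, ExtAt φ (p + w)) :
    ∃ c, (∀ p, ∀ᶠ z in 𝓝[≠] p, φ z = c) ∧ ∀ p ψ, ContinuousAt ψ p → φ =ᶠ[𝓝[≠] p] ψ → ψ p = c := by
  obtain ⟨α, c, h1, h2, h3⟩ := L.liouQ hS (φ := φ) (fun _ => 0) (fun w hw z hz => by simp [hper w hw z hz]) hext
  have h0 : α = 0 := by
    have := h1 _ L.ω₁_mem_lattice
    refine (mul_eq_zero.1 this).resolve_right fun e => L.ω₁_div_two_notMem_lattice ?_
    rw [e]; simp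
  simp only [h0, zero_mul, zero_add] at h2 h3
  exact ⟨c, h2, h3⟩

lemma ctb : (L.lattice : Set CC).Countable := by
  have : Countable L.lattice := L.latticeEquivProd.toEquiv.countable_iff.2 inferInstance
  exact Set.to_countable _
lemma conn_of {S : Set CC} (hS : S.Countable) : IsPreconnected Sᶜ :=
  (hS.isPathConnected_compl_of_one_lt_rank (by rw [Complex.rank_real_complex]; norm_num)).isConnected.isPreconnected
lemma conn : IsPreconnected {z : CC | z ∉ L.lattice} := conn_of L.ctb

lemma add_mem_iff {z w : CC} (hw : w ∈ L.lattice) : z + w ∈ L.lattice ↔ z ∈ L.lattice :=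
  L.lattice.add_mem_iff_left hw
lemma neg_mem_iff' {z : CC} : -z ∈ L.lattice ↔ z ∈ L.lattice := L.lattice.neg_mem_iff

def et (w : CC) : CC := L.zt (L.ω₁ / 2 + w) - L.zt (L.ω₁ / 2)
lemma zt_add {z w : CC} (hw : w ∈ L.lattice) (hz : z ∉ L.lattice) : L.zt (z + w) = L.zt z + L.et w := by
  have hd : ∀ x ∉ L.lattice, HasDerivAt (fun z => L.zt (z + w) - L.zt z) 0 x := fun x hx => by
    have := ((L.zt_d (z := x + w) (by rwa [L.add_mem_iff hw])).comp_add_const x w).sub (L.zt_d hx)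
    refine this.congr_deriv ?_
    rw [show ℘[L] (x + w) = ℘[L] x from L.weierstrassP_add_coe x ⟨w, hw⟩]; ring
  have := L.open_compl.is_const_of_deriv_eq_zero L.conn (f := fun z => L.zt (z + w) - L.zt z)
    (fun x hx => (hd x hx).differentiableAt.differentiableWithinAt) (fun x hx => (hd x hx).deriv)
    (x := z) (y := L.ω₁ / 2) hz L.ω₁_div_two_notMem_lattice
  rw [et, ← this]; ring
lemma et_add {v w : CC} (hv : v ∈ L.lattice) (hw : w ∈ L.lattice) : L.et (v + w) = L.et v + L.et w := by
  have h0 := L.ω₁_div_two_notMem_lattice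
  have := L.zt_add hw (z := L.ω₁ / 2 + v) (by rwa [L.add_mem_iff hv])
  rw [et, ← add_assoc, this, et.eq_def L v]; ring
lemma et_zero : L.et 0 = 0 := by simp [et]
lemma et_neg {v : CC} (hv : v ∈ L.lattice) : L.et (-v) = -L.et v := by
  have := L.et_add hv (L.neg_mem_iff'.2 hv)
  rw [add_neg_cancel, et_zero] at this; linear_combination -this
lemma et_half {w : CC} (hw : w ∈ L.lattice) (h2 : w / 2 ∉ L.lattice) : L.et w = 2 * L.zt (w / 2) := by
  have := L.zt_add hw (z := -(w / 2)) (by rwa [L.neg_mem_iff'])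
  rw [zt_neg, show -(w / 2) + w = w / 2 by ring] at this; linear_combination -this

def Cs (w : CC) : CC := L.sg (L.ω₁ / 2 + w) / (Complex.exp (L.et w * (L.ω₁ / 2)) * L.sg (L.ω₁ / 2))
lemma Cs_ne {w : CC} (hw : w ∈ L.lattice) : L.Cs w ≠ 0 := by
  have h0 := L.ω₁_div_two_notMem_lattice
  exact div_ne_zero (L.sg_ne (by rwa [L.add_mem_iff hw])) (mul_ne_zero (Complex.exp_ne_zero _) (L.sg_ne h0))
lemma sg_add {w : CC} (hw : w ∈ L.lattice) (z : CC) : L.sg (z + w) = L.Cs w * Complex.exp (L.et w * z) * L.sg z := by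
  by_cases hz : z ∈ L.lattice
  · rw [L.sg_zero hz, L.sg_zero (L.lattice.add_mem hz hw), mul_zero]
  have hd : ∀ x ∉ L.lattice, HasDerivAt (fun z => L.sg (z + w) / (Complex.exp (L.et w * z) * L.sg z)) 0 x := fun x hx => by
    have hs := L.sg_ne hx
    have := ((L.sg_d (z := x + w) (by rwa [L.add_mem_iff hw])).comp_add_const x w).fun_div
      ((((hasDerivAt_id' x).const_mul (L.et w)).cexp).fun_mul (L.sg_d hx)) (mul_ne_zero (Complex.exp_ne_zero _) hs)
    refine this.congr_deriv ?_
    rw [L.zt_add hw hx, div_eq_zero_iff]; left; ring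
  have := L.open_compl.is_const_of_deriv_eq_zero L.conn (f := fun z => L.sg (z + w) / (Complex.exp (L.et w * z) * L.sg z))
    (fun x hx => (hd x hx).differentiableAt.differentiableWithinAt) (fun x hx => (hd x hx).deriv)
    (x := z) (y := L.ω₁ / 2) hz L.ω₁_div_two_notMem_lattice
  rw [Cs, ← this]
  have := Complex.exp_ne_zero (L.et w * z)
  field_simp [L.sg_ne hz]

lemma legendre {v w : CC} (hv : v ∈ L.lattice) (hw : w ∈ L.lattice) :
    ∃ n : ℤ, L.et v * w - L.et w * v = n * (2 * Real.pi * Complex.I) := by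
  have h0 := L.sg_ne L.ω₁_div_two_notMem_lattice
  have e1 := L.sg_add hv (L.ω₁ / 2 + w)
  have e2 := L.sg_add hw (L.ω₁ / 2 + v)
  rw [L.sg_add hw] at e1; rw [L.sg_add hv] at e2
  rw [show L.ω₁ / 2 + v + w = L.ω₁ / 2 + w + v by ring, e1, mul_add, mul_add, Complex.exp_add, Complex.exp_add] at e2
  have : Complex.exp (L.et v * w) = Complex.exp (L.et w * v) := by
    have a := Complex.exp_ne_zero (L.et v * (L.ω₁ / 2))
    have b := Complex.exp_ne_zero (L.et w * (L.ω₁ / 2))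
    have k := mul_ne_zero (mul_ne_zero (mul_ne_zero (L.Cs_ne hv) (L.Cs_ne hw)) (mul_ne_zero a b)) h0
    refine mul_left_cancel₀ k ?_
    linear_combination e2
  obtain ⟨n, hn⟩ := Complex.exp_eq_exp_iff_exists_int.1 this
  exact ⟨n, by rw [hn]; ring⟩

lemma zt_l : ∃ β, AnalyticAt CC β 0 ∧ ∀ᶠ z in 𝓝[≠] 0, L.zt z = 1 / z + z ^ 2 * β z := by
  have hpa : AnalyticAt CC L.pg 0 := L.pg_diff.analyticAt 0
  have h0 : L.pg 0 ≠ 0 := by rw [pg_zero]; exact one_ne_zero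
  set ρ : CC → CC := fun z => deriv L.pg z / L.pg z with hρ
  have hρa : AnalyticAt CC ρ 0 := hpa.deriv.fun_div hpa h0
  have e1 : ∀ᶠ z in 𝓝[≠] 0, L.zt z = 1 / z + ρ z := by
    filter_upwards [L.ev_punct 0] with z hz
    have hz0 : z ≠ 0 := fun e => hz (e ▸ L.lattice.zero_mem)
    have hp := L.pg_ne (z := z) fun l hl _ e => hz (e ▸ hl)
    have := (L.sg_d hz).unique ((hasDerivAt_id z).mul (L.pg_diff z).hasDerivAt)
    simp only [sg, id, one_mul] at this
    simp only [hρ]; field_simp; linear_combination this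
  have hpe : ∀ z, L.pg (-z) = L.pg z := fun z => by
    rw [pg, ← (Equiv.neg L.lattice).tprod_eq]; simp [pg]
  have hρ0 : ρ 0 = 0 := by
    simp only [hρ]; rw [even_d (Eventually.of_forall hpe), zero_div]
  have e2 : ∀ᶠ z in 𝓝[≠] 0, deriv ρ z = -L.weierstrassPExcept 0 z := by
    filter_upwards [ev_pp e1, L.ev_punct 0, self_mem_nhdsWithin] with z h1 h2 h3
    have e : ρ =ᶠ[𝓝 z] fun z => L.zt z - z⁻¹ := by
      filter_upwards [h1] with y hy; rw [hy]; ring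
    rw [e.deriv_eq, ((L.zt_d h2).fun_sub (hasDerivAt_inv h3)).deriv]
    have := L.weierstrassPExcept_add ⟨0, L.lattice.zero_mem⟩ z
    simp only [sub_zero] at this
    rw [← this]; simp
  have := eq_of_punct hρa.deriv.continuousAt (L.analyticAt_weierstrassPExcept 0).neg.continuousAt e2
  obtain ⟨g, g1, g2⟩ := dsl2 hρa hρ0 (by rw [this]; simp)
  refine ⟨g, g1, ?_⟩
  filter_upwards [e1] with z hz
  rw [hz, g2, sub_zero]

lemma P_l : ∃ γ, AnalyticAt CC γ 0 ∧ ∀ᶠ z in 𝓝[≠] 0, ℘[L] z = 1 / z ^ 2 + z ^ 2 * γ z := by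
  obtain ⟨g, g1, g2⟩ := dsl2 (L.analyticAt_weierstrassPExcept 0) (L.weierstrassPExcept_zero 0)
    (even_d (Eventually.of_forall fun z => by rw [weierstrassPExcept_neg, neg_zero]))
  refine ⟨g, g1, .of_forall fun z => ?_⟩
  have := L.weierstrassPExcept_add ⟨0, L.lattice.zero_mem⟩ z
  simp only [sub_zero] at this
  rw [← this, g2]; simp; ring
lemma P_an {z : CC} (hz : z ∉ L.lattice) : AnalyticAt CC ℘[L] z := L.analyticOnNhd_weierstrassP z hz
lemma P_add {w : CC} (hw : w ∈ L.lattice) (z : CC) : ℘[L] (z + w) = ℘[L] z := L.weierstrassP_add_coe z ⟨w, hw⟩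
lemma zero_mem' : (0:CC) ∈ L.lattice := L.lattice.zero_mem
end PeriodPair

namespace PeriodPair
variable (L : PeriodPair) {a : CC}

lemma sub_iff {z w : CC} (hw : w ∈ L.lattice) : z - w ∈ L.lattice ↔ z ∈ L.lattice := L.lattice.sub_mem_iff_left hw
lemma swap_iff {z w : CC} : z - w ∈ L.lattice ↔ w - z ∈ L.lattice := by rw [← L.neg_mem_iff', neg_sub]
def Gf (a z : CC) : CC := L.zt (z - a) - L.zt z + L.zt a
lemma ztc_an {z : CC} (hz : z - a ∉ L.lattice) : AnalyticAt CC (fun z => L.zt (z - a)) z :=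
  AnalyticAt.comp_of_eq' (L.zt_an hz) (f := fun z => z - a) (by fun_prop) rfl
lemma Pc_an {z : CC} (hz : z - a ∉ L.lattice) : AnalyticAt CC (fun z => ℘[L] (z - a)) z :=
  AnalyticAt.comp_of_eq' (L.P_an hz) (f := fun z => z - a) (by fun_prop) rfl
lemma G_l (ha : a ∉ L.lattice) : ∃ A, AnalyticAt CC A 0 ∧ A 0 = -℘[L] a ∧ ∀ᶠ z in 𝓝[≠] 0, L.Gf a z = -1 / z + z * A z := by
  obtain ⟨β, hβ, h⟩ := L.zt_l
  have ha' : (0:CC) - a ∉ L.lattice := by rw [zero_sub]; rwa [L.neg_mem_iff']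
  obtain ⟨g, g1, g2, g3⟩ := dsl1 ((L.ztc_an ha').fun_add (analyticAt_const (v := L.zt a))) (by simp [zt_neg])
  refine ⟨fun z => g z - z * β z, g1.fun_sub (analyticAt_id.fun_mul hβ), ?_, ?_⟩
  · have := ((L.zt_d ha').comp_sub_const 0 a).add_const (L.zt a)
    simp only [zero_mul, sub_zero]
    rw [g2, this.deriv, zero_sub, weierstrassP_neg]
  · filter_upwards [h] with z hz
    have := g3 z
    rw [Gf, hz]; linear_combination this
lemma G_sq (ha : a ∉ L.lattice) {z : CC} (hz : z ∉ L.lattice) (hza : z - a ∉ L.lattice) :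
    L.Gf a z ^ 2 = ℘[L] (z - a) + ℘[L] z + ℘[L] a := by
  obtain ⟨A, hA, hA0, hAe⟩ := L.G_l ha
  obtain ⟨γ, hγ, hγe⟩ := L.P_l
  have ha' : (0:CC) - a ∉ L.lattice := by rw [zero_sub]; rwa [L.neg_mem_iff']
  set φ : CC → CC := fun z => L.Gf a z ^ 2 - ℘[L] (z - a) - ℘[L] z with hφ
  have han : ∀ z, z ∉ L.lattice → z - a ∉ L.lattice → AnalyticAt CC φ z := fun z hz hza =>
    ((((((L.ztc_an hza).fun_sub (L.zt_an hz)).fun_add analyticAt_const).fun_pow 2).fun_sub (L.Pc_an hza)).fun_sub (L.P_an hz))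
  set ψ : CC → CC := fun z => -2 * A z + z ^ 2 * A z ^ 2 - ℘[L] (z - a) - z ^ 2 * γ z with hψ
  have hψa : AnalyticAt CC ψ 0 := by
    have := L.Pc_an ha'
    simp only [hψ]; fun_prop
  have e0 : φ =ᶠ[𝓝[≠] 0] ψ := by
    filter_upwards [hAe, hγe, self_mem_nhdsWithin] with z h1 h2 h3
    have h3 : z ≠ 0 := h3
    simp only [hφ, hψ]; rw [h1, h2]; field_simp; ring
  have hsym : ∀ z, φ (a - z) = φ z := fun z => by
    simp only [hφ, Gf]
    rw [show a - z - a = -z by ring, show a - z = -(z - a) by ring, zt_neg, zt_neg, weierstrassP_neg, weierstrassP_neg]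
    ring
  obtain ⟨c, hc1, hc2⟩ := L.liouC (L.disc.union (L.disc_add a)) (φ := φ) (fun w hw z hz => by
      simp only [mem_union, not_or] at hz
      simp only [hφ, Gf]
      rw [L.P_add hw, L.zt_add hw hz.1, show z + w - a = z - a + w by ring, L.P_add hw, L.zt_add hw hz.2]
      ring) fun p => by
    by_cases h1 : p ∈ L.lattice
    · exact ⟨-p, L.neg_mem_iff'.2 h1, by rw [add_neg_cancel]; exact ⟨ψ, hψa, e0⟩⟩
    by_cases h2 : p - a ∈ L.lattice
    · refine ⟨a - p, L.swap_iff.2 h2, fun z => ψ (a - z), ?_, ?_⟩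
      · exact AnalyticAt.comp_of_eq' hψa (f := fun z => a - z) (by fun_prop) (by ring)
      · have := punct_neg (p := a) (P := fun z => φ (z + a) = ψ (z + a)) (punct_add (w := a) (by rw [neg_add_cancel]; exact e0))
        rw [add_sub_cancel]
        filter_upwards [this] with z hz
        rw [← hsym z, ← neg_add_eq_sub, hz]
    · exact ⟨0, L.zero_mem', by rw [add_zero]; exact (han p h1 h2).ext⟩
  have k1 := hc2 0 ψ hψa.continuousAt e0
  have k2 := hc2 z φ (han z hz hza).continuousAt EventuallyEq.rfl
  rw [← k1] at k2
  simp only [hψ, hφ, hA0, zero_sub, weierstrassP_neg] at k2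
  linear_combination k2

def Y (a z : CC) : CC := Complex.exp (L.zt a * z) * L.sg (z - a) / (L.sg z * L.sg (-a))
def mu (a w : CC) : CC := Complex.exp (L.zt a * w - a * L.et w)
lemma mu_ne (a w : CC) : L.mu a w ≠ 0 := Complex.exp_ne_zero _
lemma mu_add {v w : CC} (hv : v ∈ L.lattice) (hw : w ∈ L.lattice) : L.mu a (v + w) = L.mu a v * L.mu a w := by
  rw [mu, mu, mu, ← Complex.exp_add, L.et_add hv hw]; ring_nf
lemma mu_neg (a w : CC) : L.mu (-a) w = (L.mu a w)⁻¹ := by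
  rw [mu, mu, ← Complex.exp_neg, zt_neg]; ring_nf
lemma Y_add {w : CC} (hw : w ∈ L.lattice) (a z : CC) : L.Y a (z + w) = L.mu a w * L.Y a z := by
  have h1 := L.Cs_ne hw
  have h2 := Complex.exp_ne_zero (L.et w * z)
  rw [Y, Y, show z + w - a = z - a + w by ring, L.sg_add hw, L.sg_add hw, mu,
    show L.zt a * w - a * L.et w = L.zt a * w + L.et w * (z - a) + -(L.et w * z) by ring, Complex.exp_add, Complex.exp_add,
    mul_add (L.zt a), Complex.exp_add, Complex.exp_neg]
  have : ∀ x1 x2 c e s1 s2 s3 e2 : CC, c ≠ 0 → e ≠ 0 → x1 * x2 * (c * e2 * s1) / (c * e * s2 * s3) = x2 * e2 * e⁻¹ * (x1 * s1 / (s2 * s3)) := by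
    intro x1 x2 c e s1 s2 s3 e2 hc he
    rcases eq_or_ne s2 0 with h | h
    · simp [h]
    rcases eq_or_ne s3 0 with h' | h'
    · simp [h']
    field_simp
  exact this _ _ _ _ _ _ _ _ h1 h2
lemma Y_neg (a z : CC) : L.Y (-a) z = -L.Y a (-z) := by
  rw [Y, Y, zt_neg, show -z - a = -(z - -a) by ring, sg_neg, sg_neg, sg_neg, sg_neg, neg_mul_comm, neg_neg]; simp [neg_div]
lemma Y_an (ha : a ∉ L.lattice) {z : CC} (hz : z ∉ L.lattice) : AnalyticAt CC (L.Y a) z := by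
  have h1 := L.sg_an z
  have h2 : AnalyticAt CC (fun z => L.sg (z - a)) z := AnalyticAt.comp_of_eq' (L.sg_an (z - a)) (f := fun z => z - a) (by fun_prop) rfl
  have h3 := mul_ne_zero (L.sg_ne hz) (L.sg_ne (z := -a) (by rwa [L.neg_mem_iff']))
  unfold Y
  exact (AnalyticAt.fun_mul (by fun_prop) h2).fun_div (h1.fun_mul analyticAt_const) h3
lemma Y_zero_iff (ha : a ∉ L.lattice) {z : CC} (hz : z ∉ L.lattice) : L.Y a z = 0 ↔ z - a ∈ L.lattice := by
  have h3 := mul_ne_zero (L.sg_ne hz) (L.sg_ne (z := -a) (by rwa [L.neg_mem_iff']))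
  rw [Y, div_eq_zero_iff, or_iff_left h3, mul_eq_zero, or_iff_right (Complex.exp_ne_zero _)]
  exact ⟨fun h => by_contra fun h' => L.sg_ne h' h, L.sg_zero⟩
lemma Y_l (ha : a ∉ L.lattice) : ∃ R, AnalyticAt CC R 0 ∧ ∀ᶠ z in 𝓝[≠] 0, L.Y a z = 1 / z + z * R z := by
  have hna : -a ∉ L.lattice := by rwa [L.neg_mem_iff']
  have hpa : AnalyticAt CC L.pg 0 := L.pg_diff.analyticAt 0
  have h2 : AnalyticAt CC (fun z => L.sg (z - a)) 0 := AnalyticAt.comp_of_eq' (L.sg_an (0 - a)) (f := fun z => z - a) (by fun_prop) rfl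
  have h0 : L.pg 0 ≠ 0 := by rw [pg_zero]; exact one_ne_zero
  have hs := L.sg_ne hna
  set f : CC → CC := fun z => Complex.exp (L.zt a * z) * L.sg (z - a) / (L.pg z * L.sg (-a)) - 1 with hf
  have hpe : ∀ z, L.pg (-z) = L.pg z := fun z => by
    rw [pg, ← (Equiv.neg L.lattice).tprod_eq]; simp [pg]
  have d : HasDerivAt f 0 0 := by
    have d1 := ((hasDerivAt_id' (0:CC)).const_mul (L.zt a)).cexp
    have d2 := (L.sg_d (z := 0 - a) (by rwa [zero_sub])).comp_sub_const 0 a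
    have d3 := (L.pg_diff 0).hasDerivAt.mul_const (L.sg (-a))
    refine (((d1.fun_mul d2).fun_div d3 (mul_ne_zero h0 hs)).sub_const 1).congr_deriv ?_
    rw [even_d (Eventually.of_forall hpe)]
    simp [zt_neg]
  obtain ⟨g, g1, g2⟩ := dsl2 (f := f) (((AnalyticAt.fun_mul (by fun_prop) h2).fun_div (hpa.fun_mul analyticAt_const) (mul_ne_zero h0 hs)).fun_sub analyticAt_const)
    (by simp [hf, pg_zero, hs]) d.deriv
  refine ⟨g, g1, ?_⟩
  filter_upwards [L.ev_punct 0, self_mem_nhdsWithin] with z h1 h3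
  have h3 : z ≠ 0 := h3
  have hp := L.pg_ne (z := z) fun l hl _ e => h1 (e ▸ hl)
  have := g2 z
  simp only [hf, sub_zero] at this
  have e : L.Y a z = (f z + 1) / z := by
    rw [Y, sg.eq_def L z]; simp only [hf]; field_simp; ring
  rw [e, g2]; field_simp; ring
lemma Y_mul (ha : a ∉ L.lattice) {z : CC} (hz : z ∉ L.lattice) : L.Y a z * L.Y (-a) z = ℘[L] z - ℘[L] a := by
  have hna : -a ∉ L.lattice := by rwa [L.neg_mem_iff']
  obtain ⟨R, hR, hRe⟩ := L.Y_l ha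
  obtain ⟨R', hR', hRe'⟩ := L.Y_l hna
  obtain ⟨γ, hγ, hγe⟩ := L.P_l
  set φ : CC → CC := fun z => L.Y a z * L.Y (-a) z - ℘[L] z with hφ
  have han : ∀ z, z ∉ L.lattice → AnalyticAt CC φ z := fun z hz =>
    ((L.Y_an ha hz).fun_mul (L.Y_an hna hz)).fun_sub (L.P_an hz)
  obtain ⟨c, hc1, hc2⟩ := L.liouC L.disc (φ := φ) (fun w hw z hz => by
      simp only [hφ]
      rw [L.Y_add hw, L.Y_add hw, L.P_add hw, mu_neg]
      field_simp [L.mu_ne a w]) fun p => by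
    by_cases h1 : p ∈ L.lattice
    · refine ⟨-p, L.neg_mem_iff'.2 h1, ?_⟩
      rw [add_neg_cancel]
      refine ⟨fun z => R z + R' z + z ^ 2 * R z * R' z - z ^ 2 * γ z, by fun_prop, ?_⟩
      filter_upwards [hRe, hRe', hγe, self_mem_nhdsWithin] with z h1 h2 h3 h4
      have h4 : z ≠ 0 := h4
      simp only [hφ]; rw [h1, h2, h3]; field_simp; ring
    · exact ⟨0, L.zero_mem', by rw [add_zero]; exact (han p h1).ext⟩
  have k1 := hc2 a φ (han a ha).continuousAt EventuallyEq.rfl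
  have k2 := hc2 z φ (han z hz).continuousAt EventuallyEq.rfl
  simp only [hφ] at k1 k2
  rw [(L.Y_zero_iff ha ha).2 (by rw [sub_self]; exact L.zero_mem')] at k1
  linear_combination k2 - k1
lemma P_eq (ha : a ∉ L.lattice) {z : CC} (hz : z ∉ L.lattice) (h : ℘[L] z = ℘[L] a) : z - a ∈ L.lattice ∨ z + a ∈ L.lattice := by
  have := L.Y_mul ha hz
  rw [h, sub_self, mul_eq_zero, L.Y_zero_iff ha hz, L.Y_zero_iff (by rwa [L.neg_mem_iff']) hz, sub_neg_eq_add] at this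
  exact this
lemma Y_d0 {z : CC} (ha : a ∉ L.lattice) (hz : z ∉ L.lattice) (hza : z - a ∉ L.lattice) : HasDerivAt (L.Y a) (L.Gf a z * L.Y a z) z := by
  have h1 := L.sg_ne hz
  have h3 := (L.sg_ne (z := -a) (by rwa [L.neg_mem_iff']))
  refine (((((hasDerivAt_id' z).const_mul (L.zt a)).cexp.fun_mul ((L.sg_d hza).comp_sub_const z a)).fun_div
    ((L.sg_d hz).mul_const (L.sg (-a)))) (mul_ne_zero h1 h3)).congr_deriv ?_
  rw [Gf, Y]; field_simp; ring
def Y1 (a z : CC) : CC := deriv (L.Y a) z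
lemma Y_d {z : CC} (ha : a ∉ L.lattice) (hz : z ∉ L.lattice) : HasDerivAt (L.Y a) (L.Y1 a z) z :=
  (L.Y_an ha hz).differentiableAt.hasDerivAt
lemma Y1_an {z : CC} (ha : a ∉ L.lattice) (hz : z ∉ L.lattice) : AnalyticAt CC (L.Y1 a) z := (L.Y_an ha hz).deriv
lemma Y1_G {z : CC} (ha : a ∉ L.lattice) (hz : z ∉ L.lattice) (hza : z - a ∉ L.lattice) : L.Y1 a z = L.Gf a z * L.Y a z := (L.Y_d0 ha hz hza).deriv
lemma G_d {z : CC} (hz : z ∉ L.lattice) (hza : z - a ∉ L.lattice) : HasDerivAt (L.Gf a) (℘[L] z - ℘[L] (z - a)) z :=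
  ((((L.zt_d hza).comp_sub_const z a).fun_sub (L.zt_d hz)).add_const (L.zt a)).congr_deriv (by ring)
lemma Y1_d {z : CC} (ha : a ∉ L.lattice) (hz : z ∉ L.lattice) : HasDerivAt (L.Y1 a) ((2 * ℘[L] z + ℘[L] a) * L.Y a z) z := by
  have h := L.Y1_an ha hz
  refine h.differentiableAt.hasDerivAt.congr_deriv ?_
  refine eq_of_punct h.deriv.continuousAt
    (((L.P_an hz).continuousAt.const_mul 2).add_const (℘[L] a) |>.mul (L.Y_an ha hz).continuousAt) ?_
  filter_upwards [L.disc z, L.disc_add a z] with y h1 h2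
  have h2' : y - a ∉ L.lattice := h2
  have e : L.Y1 a =ᶠ[𝓝 y] fun z => L.Gf a z * L.Y a z := by
    have : ∀ᶠ x in 𝓝 y, x - a ∉ L.lattice := (continuous_sub_right a).continuousAt.eventually (L.ev_compl h2')
    filter_upwards [L.ev_compl h1, this] with x k1 k2 using L.Y1_G ha k1 k2
  rw [e.deriv_eq, ((L.G_d h1 h2').fun_mul (L.Y_d0 ha h1 h2')).deriv]
  have := L.G_sq ha h1 h2'
  simp only [Pi.mul_apply]
  linear_combination L.Y a y * this
lemma Y1_add {w z : CC} (hw : w ∈ L.lattice) : L.Y1 a (z + w) = L.mu a w * L.Y1 a z := by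
  have : (fun z => L.Y a (z + w)) = fun z => L.mu a w * L.Y a z := funext (L.Y_add hw a)
  have := congrArg (fun f => deriv f z) this
  simpa [Y1, deriv_comp_add_const, deriv_const_mul_field] using this
lemma P_d {z : CC} (hz : z ∉ L.lattice) : HasDerivAt ℘[L] (℘'[L] z) z := by
  rw [← deriv_weierstrassP]; exact (L.P_an hz).differentiableAt.hasDerivAt
lemma wr_const {y1 y2 d1 d2 q : CC → CC} {S : Set CC} (hS : IsPreconnected S) (ho : IsOpen S)
    (h1 : ∀ z ∈ S, HasDerivAt y1 (d1 z) z) (h1' : ∀ z ∈ S, HasDerivAt d1 (q z * y1 z) z)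
    (h2 : ∀ z ∈ S, HasDerivAt y2 (d2 z) z) (h2' : ∀ z ∈ S, HasDerivAt d2 (q z * y2 z) z) {z w : CC} (hz : z ∈ S) (hw : w ∈ S) :
    y1 z * d2 z - d1 z * y2 z = y1 w * d2 w - d1 w * y2 w := by
  have hd : ∀ x ∈ S, HasDerivAt (fun z => y1 z * d2 z - d1 z * y2 z) 0 x := fun x hx =>
    (((h1 x hx).fun_mul (h2' x hx)).fun_sub ((h1' x hx).fun_mul (h2 x hx))).congr_deriv (by ring)
  exact ho.is_const_of_deriv_eq_zero hS (f := fun z => y1 z * d2 z - d1 z * y2 z)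
    (fun x hx => (hd x hx).differentiableAt.differentiableWithinAt) (fun x hx => (hd x hx).deriv) hz hw
lemma Y_W (ha : a ∉ L.lattice) {z : CC} (hz : z ∉ L.lattice) :
    L.Y a z * L.Y1 (-a) z - L.Y1 a z * L.Y (-a) z = -℘'[L] a := by
  have hna : -a ∉ L.lattice := by rwa [L.neg_mem_iff']
  rw [wr_const L.conn L.open_compl (q := fun z => 2 * ℘[L] z + ℘[L] a) (fun z hz => L.Y_d ha hz) (fun z hz => L.Y1_d ha hz)
    (fun z hz => L.Y_d hna hz) (fun z hz => by simpa using L.Y1_d hna hz) hz ha]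
  have e : (fun z => L.Y a z * L.Y (-a) z) =ᶠ[𝓝 a] fun z => ℘[L] z - ℘[L] a := by
    filter_upwards [L.ev_compl ha] with z hz using L.Y_mul ha hz
  have := e.deriv_eq
  rw [((L.Y_d ha ha).fun_mul (L.Y_d hna ha)).deriv, ((L.P_d ha).sub_const _).deriv] at this
  have h0 := (L.Y_zero_iff ha ha).2 (by rw [sub_self]; exact L.zero_mem')
  rw [h0] at this ⊢; linear_combination -this
lemma Pd_ne (ha : a ∉ L.lattice) (h2 : 2 * a ∉ L.lattice) : ℘'[L] a ≠ 0 := by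
  have hna : -a ∉ L.lattice := by rwa [L.neg_mem_iff']
  intro h
  have h0 := (L.Y_zero_iff ha ha).2 (by rw [sub_self]; exact L.zero_mem')
  have hW := L.Y_W ha ha
  rw [h, h0, zero_mul, zero_sub, neg_zero, neg_eq_zero, mul_eq_zero, L.Y_zero_iff hna ha, sub_neg_eq_add, ← two_mul, or_iff_left h2] at hW
  have d : HasDerivAt (L.Y a) (Complex.exp (L.zt a * a) / (L.sg a * L.sg (-a))) a := by
    have d2 : HasDerivAt (fun z => L.sg (z - a)) 1 a := HasDerivAt.comp_sub_const a a (by rw [sub_self]; exact L.sg_zd)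
    refine (((((hasDerivAt_id' a).const_mul (L.zt a)).cexp.fun_mul d2).fun_div
      ((L.sg_diff a).hasDerivAt.mul_const (L.sg (-a)))) (mul_ne_zero (L.sg_ne ha) (L.sg_ne hna))).congr_deriv ?_
    rw [sub_self, L.sg_zero L.zero_mem']
    have := L.sg_ne ha; have := L.sg_ne hna
    field_simp; ring
  have := d.unique (L.Y_d ha ha)
  rw [hW] at this
  exact div_ne_zero (Complex.exp_ne_zero _) (mul_ne_zero (L.sg_ne ha) (L.sg_ne hna)) this
end PeriodPair

namespace PeriodPair
variable (L : PeriodPair) {a h : CC}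

lemma half_mem {m n : ℤ} (H : (m:CC) * (L.ω₁ / 2) + n * (L.ω₂ / 2) ∈ L.lattice) : (∃ k, m = 2 * k) ∧ ∃ k, n = 2 * k := by
  obtain ⟨p, q, e⟩ := mem_lattice.1 H
  have := LinearIndependent.pair_iff.mp L.indep (p - m / 2) (q - n / 2) (by simp; linear_combination e)
  exact ⟨⟨p, by have := this.1; have : (m:RR) = 2 * p := by linarith
                exact_mod_cast this⟩, ⟨q, by have := this.2; have : (n:RR) = 2 * q := by linarith
                                             exact_mod_cast this⟩⟩
lemma h1_mem : L.ω₁ / 2 ∉ L.lattice := L.ω₁_div_two_notMem_lattice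
lemma h2_mem : L.ω₂ / 2 ∉ L.lattice := L.ω₂_div_two_notMem_lattice
lemma h3_mem : L.ω₁ / 2 + L.ω₂ / 2 ∉ L.lattice := fun H => by
  have := (L.half_mem (m := 1) (n := 1) (by simpa using H)).1; omega
lemma h12_mem : L.ω₁ / 2 - L.ω₂ / 2 ∉ L.lattice := fun H => by
  have := (L.half_mem (m := 1) (n := -1) (by simpa [sub_eq_add_neg] using H)).1; omega

lemma no_lin (c : CC) : ¬ ∀ w ∈ L.lattice, L.et w = c * w := fun H => by
  obtain ⟨β, hβ, hβe⟩ := L.zt_l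
  obtain ⟨γ, hγ, hγe⟩ := L.P_l
  set f : CC → CC := fun z => L.zt z - c * z with hf
  have hfp : ∀ w ∈ L.lattice, ∀ z ∉ L.lattice, f (z + w) = f z := fun w hw z hz => by
    simp only [hf]; rw [L.zt_add hw hz, H w hw]; ring
  set φ : CC → CC := fun z => f z ^ 2 - ℘[L] z with hφ
  have han : ∀ z, z ∉ L.lattice → AnalyticAt CC φ z := fun z hz =>
    (((L.zt_an hz).fun_sub (by fun_prop)).fun_pow 2).fun_sub (L.P_an hz)
  obtain ⟨k, -, hk⟩ := L.liouC L.disc (φ := φ) (fun w hw z hz => by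
      simp only [hφ]; rw [hfp w hw z hz, L.P_add hw]) fun p => by
    by_cases h1 : p ∈ L.lattice
    · refine ⟨-p, L.neg_mem_iff'.2 h1, ?_⟩
      rw [add_neg_cancel]
      refine ⟨fun z => 2 * (z * β z - c) + z ^ 2 * (z * β z - c) ^ 2 - z ^ 2 * γ z, by fun_prop, ?_⟩
      filter_upwards [hβe, hγe, self_mem_nhdsWithin] with z h1 h3 h4
      have h4 : z ≠ 0 := h4
      simp only [hφ, hf]; rw [h1, h3]; field_simp; ring
    · exact ⟨0, L.zero_mem', by rw [add_zero]; exact (han p h1).ext⟩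
  have hz : ∀ w ∈ L.lattice, w / 2 ∉ L.lattice → f (w / 2) = 0 := fun w hw hh => by
    simp only [hf]
    have := L.et_half hw hh
    rw [H w hw] at this; linear_combination -this / 2
  have k1 := hk _ φ (han _ L.h1_mem).continuousAt EventuallyEq.rfl
  have k2 := hk _ φ (han _ L.h2_mem).continuousAt EventuallyEq.rfl
  simp only [hφ] at k1 k2
  rw [hz _ L.ω₁_mem_lattice L.h1_mem] at k1
  rw [hz _ L.ω₂_mem_lattice L.h2_mem] at k2
  rcases L.P_eq L.h2_mem L.h1_mem (by linear_combination k2 - k1) with h | h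
  · exact L.h12_mem h
  · exact L.h3_mem h

lemma Pd_half (hh : h ∉ L.lattice) (h2 : 2 * h ∈ L.lattice) : ℘'[L] h = 0 := by
  have := L.derivWeierstrassP_add_coe (-h) ⟨2 * h, h2⟩
  rw [derivWeierstrassP_neg] at this
  simp only [show -h + 2 * h = h by ring] at this
  exact self_eq_neg.1 this
lemma et_two (hh : h ∉ L.lattice) (h2 : 2 * h ∈ L.lattice) : L.et (2 * h) = 2 * L.zt h := by
  rw [L.et_half h2 (by rwa [mul_div_cancel_left₀ _ two_ne_zero]), mul_div_cancel_left₀ _ two_ne_zero]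
lemma Y_half (hh : h ∉ L.lattice) (h2 : 2 * h ∈ L.lattice) (z : CC) : L.Y (-h) z = L.Y h z := by
  have e1 := L.sg_add h2 (z - h)
  have e2 := L.sg_add h2 (-h)
  rw [show -h + 2 * h = h by ring] at e2
  rw [show z - h + 2 * h = z - -h by ring] at e1
  have hC := L.Cs_ne h2
  have hs := L.sg_ne (z := -h) (by rwa [L.neg_mem_iff'])
  rw [Y, Y, e1, neg_neg, e2, L.et_two hh h2, zt_neg, show 2 * L.zt h * (z - h) = L.zt h * z + L.zt h * z + 2 * L.zt h * -h by ring,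
    Complex.exp_add, Complex.exp_add, neg_mul, Complex.exp_neg]
  have x1 := Complex.exp_ne_zero (L.zt h * z)
  have x2 := Complex.exp_ne_zero (2 * L.zt h * -h)
  rcases eq_or_ne (L.sg z) 0 with h | h
  · simp [h]
  field_simp
lemma Y_sq (hh : h ∉ L.lattice) (h2 : 2 * h ∈ L.lattice) {z : CC} (hz : z ∉ L.lattice) : L.Y h z ^ 2 = ℘[L] z - ℘[L] h := by
  rw [← L.Y_mul hh hz, L.Y_half hh h2, sq]
lemma Y_shift (hh : h ∉ L.lattice) (h2 : 2 * h ∈ L.lattice) :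
    ∃ d, d ≠ 0 ∧ ∀ z, z ∉ L.lattice → z - h ∉ L.lattice → L.Y h z * L.Y h (z - h) = d := by
  have hm := L.neg_mem_iff'.2 h2
  have hs := L.sg_ne (z := -h) (by rwa [L.neg_mem_iff'])
  refine ⟨L.Cs (-(2 * h)) * Complex.exp (-(L.zt h * h)) / L.sg (-h) ^ 2, div_ne_zero (mul_ne_zero (L.Cs_ne hm) (Complex.exp_ne_zero _)) (pow_ne_zero 2 hs),
    fun z hz hzh => ?_⟩
  have e1 := L.sg_add hm z
  rw [L.et_neg h2, L.et_two hh h2] at e1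
  rw [Y, Y, show z - h - h = z + -(2 * h) by ring, e1, mul_sub, sub_eq_add_neg (L.zt h * z), Complex.exp_add,
    show -(2 * L.zt h) * z = -(L.zt h * z) + -(L.zt h * z) by ring, Complex.exp_add, Complex.exp_neg (L.zt h * z)]
  have := L.sg_ne hz; have := L.sg_ne hzh; have := Complex.exp_ne_zero (L.zt h * z)
  field_simp
lemma P_surj (c : CC) : ∃ z, z ∉ L.lattice ∧ ℘[L] z = c := by
  by_contra! H
  obtain ⟨γ, hγ, hγe⟩ := L.P_l
  have han : ∀ z, z ∉ L.lattice → AnalyticAt CC (fun z => (℘[L] z - c)⁻¹) z := fun z hz =>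
    ((L.P_an hz).fun_sub analyticAt_const).fun_inv (sub_ne_zero.2 (H z hz))
  have ha : AnalyticAt CC (fun z => z ^ 2 / (1 + z ^ 4 * γ z - c * z ^ 2)) 0 :=
    AnalyticAt.fun_div (by fun_prop) (by fun_prop) (by simp)
  have he : (fun z => (℘[L] z - c)⁻¹) =ᶠ[𝓝[≠] 0] fun z => z ^ 2 / (1 + z ^ 4 * γ z - c * z ^ 2) := by
    filter_upwards [hγe, self_mem_nhdsWithin] with z h1 h3
    have h3 : z ≠ 0 := h3
    rw [h1, ← one_div_div, one_div]; congr 1; field_simp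
  obtain ⟨k, -, hk⟩ := L.liouC L.disc (φ := fun z => (℘[L] z - c)⁻¹) (fun w hw z hz => by simp only [L.P_add hw]) fun p => by
    by_cases h1 : p ∈ L.lattice
    · exact ⟨-p, L.neg_mem_iff'.2 h1, by rw [add_neg_cancel]; exact ⟨_, ha, he⟩⟩
    · exact ⟨0, L.zero_mem', by rw [add_zero]; exact (han p h1).ext⟩
  have k1 := hk _ _ (han _ L.h1_mem).continuousAt EventuallyEq.rfl
  have k2 := hk 0 _ ha.continuousAt he
  rw [← k2] at k1
  simp only [ne_eq, OfNat.ofNat_ne_zero, not_false_eq_true, zero_pow, zero_div, inv_eq_zero, sub_eq_zero] at k1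
  exact H _ L.h1_mem k1

lemma cubic : ∃ e2 e3 : CC, e2 ≠ ℘[L] (L.ω₁ / 2) ∧ e3 ≠ ℘[L] (L.ω₁ / 2) ∧ e2 ≠ e3 ∧ ℘[L] (L.ω₁ / 2) + e2 + e3 = 0 ∧
    (∀ z ∉ L.lattice, ℘'[L] z ^ 2 = 4 * (℘[L] z - ℘[L] (L.ω₁ / 2)) * (℘[L] z - e2) * (℘[L] z - e3)) ∧
    ∀ z ∉ L.lattice, ℘[L] z = ℘[L] (L.ω₁ / 2) ∨ ℘[L] z = e2 ∨ ℘[L] z = e3 → 2 * z ∈ L.lattice := by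
  have m1 : 2 * (L.ω₁ / 2) ∈ L.lattice := by rw [mul_div_cancel₀ _ two_ne_zero]; exact L.ω₁_mem_lattice
  have m2 : 2 * (L.ω₂ / 2) ∈ L.lattice := by rw [mul_div_cancel₀ _ two_ne_zero]; exact L.ω₂_mem_lattice
  have m3 : 2 * (L.ω₁ / 2 + L.ω₂ / 2) ∈ L.lattice := by rw [mul_add]; exact L.lattice.add_mem m1 m2
  have q1 := L.Pd_half L.h1_mem m1
  have q2 := L.Pd_half L.h2_mem m2
  have q3 := L.Pd_half L.h3_mem m3
  have s1 := L.derivWeierstrassP_sq _ L.h1_mem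
  have s2 := L.derivWeierstrassP_sq _ L.h2_mem
  have s3 := L.derivWeierstrassP_sq _ L.h3_mem
  have n1 : ℘[L] (L.ω₂ / 2) ≠ ℘[L] (L.ω₁ / 2) := fun e => by
    rcases L.P_eq L.h1_mem L.h2_mem e with h | h
    · exact L.h12_mem (L.swap_iff.1 h)
    · exact L.h3_mem (by rwa [add_comm] at h)
  have n2 : ℘[L] (L.ω₁ / 2 + L.ω₂ / 2) ≠ ℘[L] (L.ω₁ / 2) := fun e => by
    rcases L.P_eq L.h1_mem L.h3_mem e with h | h
    · exact L.h2_mem (by rwa [add_sub_cancel_left] at h)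
    · exact L.h2_mem (by rw [add_right_comm, ← two_mul, add_comm, L.add_mem_iff m1] at h; exact h)
  have n3 : ℘[L] (L.ω₂ / 2) ≠ ℘[L] (L.ω₁ / 2 + L.ω₂ / 2) := fun e => by
    rcases L.P_eq L.h2_mem L.h3_mem e.symm with h | h
    · exact L.h1_mem (by rwa [add_sub_cancel_right] at h)
    · exact L.h1_mem (by rw [add_assoc, ← two_mul, L.add_mem_iff m2] at h; exact h)
  have hp : ∀ h z, h ∉ L.lattice → 2 * h ∈ L.lattice → z ∉ L.lattice → ℘[L] z = ℘[L] h → 2 * z ∈ L.lattice := fun h z hh h2 hz e => by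
    rcases L.P_eq hh hz e with h' | h'
    · have := L.lattice.add_mem (L.lattice.add_mem h' h') h2
      ring_nf at this ⊢; exact this
    · have := L.lattice.sub_mem (L.lattice.add_mem h' h') h2
      ring_nf at this ⊢; exact this
  refine ⟨℘[L] (L.ω₂ / 2), ℘[L] (L.ω₁ / 2 + L.ω₂ / 2), n1, n2, n3, ?_⟩
  rw [q1] at s1; rw [q2] at s2; rw [q3] at s3
  generalize hA : ℘[L] (L.ω₁ / 2) = A at *
  generalize hB : ℘[L] (L.ω₂ / 2) = B at *
  generalize hC : ℘[L] (L.ω₁ / 2 + L.ω₂ / 2) = C at *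
  have t1 : 4 * (A ^ 2 + A * B + B ^ 2) = L.g₂ := mul_left_cancel₀ (sub_ne_zero.2 n1) (by linear_combination s1 - s2)
  have t2 : 4 * (A ^ 2 + A * C + C ^ 2) = L.g₂ := mul_left_cancel₀ (sub_ne_zero.2 n2) (by linear_combination s1 - s3)
  have t3 : A + B + C = 0 := mul_left_cancel₀ (sub_ne_zero.2 n3) (by linear_combination (t1 - t2) / 4)
  refine ⟨t3, fun z hz => ?_, fun z hz hh => ?_⟩
  · rw [L.derivWeierstrassP_sq z hz]
    have : C = -A - B := by linear_combination t3
    subst this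
    rw [← t1] at s1 ⊢; linear_combination -s1
  · rcases hh with e | e | e
    · exact hp _ z L.h1_mem m1 hz (e.trans hA.symm)
    · exact hp _ z L.h2_mem m2 hz (e.trans hB.symm)
    · exact hp _ z L.h3_mem m3 hz (e.trans hC.symm)
end PeriodPair

lemma conj8 : conj (8:CC) = 8 := Complex.conj_ofReal 8
def Sol (Ω : Set CC) (q y y' : CC → CC) : Prop := ∀ z ∈ Ω, HasDerivAt y (y' z) z ∧ HasDerivAt y' (q z * y z) z
def HPair (Ω : Set CC) (q H H' : CC → CC) : Prop := ∀ z ∈ Ω, conj (H z) = H z ∧ H z ≠ 0 ∧ HasW H (H' z) (conj (H' z)) z ∧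
  HasW H' (q z * H z) ((1 / 8 + H' z * conj (H' z)) / H z) z
lemma HPair.congr {Ω : Set CC} {q q' H H' : CC → CC} (h : HPair Ω q H H') (e : ∀ z ∈ Ω, q z = q' z) : HPair Ω q' H H' := fun z hz => by
  rw [← e z hz]; exact h z hz
lemma HPair.mono {Ω Ω' : Set CC} {q H H' : CC → CC} (h : HPair Ω q H H') (e : Ω' ⊆ Ω) : HPair Ω' q H H' := fun z hz => h z (e hz)
lemma Liou.hpair {u : CC → RR} {Ω : Set CC} (h : ∀ z ∈ Ω, Liou u z) : HPair Ω (Qp u) (Hp u) (fun z => hp u z * Hp u z) := fun z hz => by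
  have h0 : Hp u z ≠ 0 := by simp [Hp, -Complex.ofReal_exp, Real.exp_ne_zero]
  have hc : conj (Hp u z) = Hp u z := Complex.conj_ofReal _
  refine ⟨hc, h0, (h z hz).wH.cd rfl (by simp [hc]), ((h z hz).wh.mul (h z hz).wH).cd (by ring) ?_⟩
  have : ((Real.exp (u z) / 8 : RR) : CC) * Hp u z ^ 2 = 1 / 8 := by
    rw [Hp]; norm_cast
    rw [← Real.exp_nat_mul, div_mul_eq_mul_div, ← Real.exp_add, show u z + (2:ℕ) * (-(u z) / 2) = 0 by push_cast; ring]; simp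
  rw [map_mul, hc, div_eq_iff h0, ← this]; ring

lemma HPair.core {Ω : Set CC} {q H H' y d : CC → CC} (hH : HPair Ω q H H') (hs : Sol Ω q y d) :
    Sol Ω q (fun z => conj (H z * d z - H' z * y z)) (fun z => H' z * conj (d z) - conj (y z) * ((1 / 8 + H' z * conj (H' z)) / H z)) := fun z hz => by
  obtain ⟨hc, h0, w0, w1⟩ := hH z hz
  obtain ⟨s0, s1⟩ := hs z hz
  constructor
  · refine (((w0.mul s1.hasW).sub (w1.mul s0.hasW)).conj.cd ?_ ?_).hasDerivAt
    · simp [hc, conj8]; ring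
    · simp; ring
  · have wD := ((hasW_const (1/8) z).add (w1.mul w1.conj)).mul (w0.inv h0)
    refine ((w1.mul s1.hasW.conj).sub (s0.hasW.conj.mul wD) |>.congr (g' := fun z => H' z * conj (d z) - conj (y z) * ((1 / 8 + H' z * conj (H' z)) / H z)) (by filter_upwards with w; rw [div_eq_mul_inv]) (a' := q z * conj (H z * d z - H' z * y z)) (b' := 0) ?_ ?_).hasDerivAt
    · simp [hc, conj8]; field_simp; ring
    · simp [hc]; field_simp; ring

lemma sol_lin {Ω : Set CC} {q y1 y2 d1 d2 k k' : CC → CC} (hp : IsPreconnected Ω) (ho : IsOpen Ω) {z0 : CC} (hz₀ : z0 ∈ Ω)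
    (h1 : Sol Ω q y1 d1) (h2 : Sol Ω q y2 d2) (hk : Sol Ω q k k') (hW : y1 z0 * d2 z0 - d1 z0 * y2 z0 ≠ 0) :
    ∃ a b, ∀ z ∈ Ω, k z = a * y1 z + b * y2 z := by
  set W := y1 z0 * d2 z0 - d1 z0 * y2 z0 with hWd
  refine ⟨(k z0 * d2 z0 - k' z0 * y2 z0) / W, (y1 z0 * k' z0 - d1 z0 * k z0) / W, fun z hz => ?_⟩
  have e1 := PeriodPair.wr_const hp ho (fun z hz => (hk z hz).1) (fun z hz => (hk z hz).2) (fun z hz => (h2 z hz).1) (fun z hz => (h2 z hz).2) hz hz₀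
  have e2 := PeriodPair.wr_const hp ho (fun z hz => (h1 z hz).1) (fun z hz => (h1 z hz).2) (fun z hz => (hk z hz).1) (fun z hz => (hk z hz).2) hz hz₀
  have e3 := PeriodPair.wr_const hp ho (fun z hz => (h1 z hz).1) (fun z hz => (h1 z hz).2) (fun z hz => (h2 z hz).1) (fun z hz => (h2 z hz).2) hz hz₀
  rw [← hWd] at e3
  rw [← e1, ← e2]; field_simp; rw [← e3]; ring

lemma sol_ind {Ω : Set CC} {q y1 y2 d1 d2 : CC → CC} (ho : IsOpen Ω) {z0 : CC} (hz₀ : z0 ∈ Ω)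
    (h1 : Sol Ω q y1 d1) (h2 : Sol Ω q y2 d2) (hW : y1 z0 * d2 z0 - d1 z0 * y2 z0 ≠ 0) {a b : CC}
    (h : ∀ z ∈ Ω, a * y1 z + b * y2 z = 0) : a = 0 ∧ b = 0 := by
  have e0 := h z0 hz₀
  have e1 := (((h1 z0 hz₀).1.const_mul a).fun_add ((h2 z0 hz₀).1.const_mul b)).unique ((hasDerivAt_const z0 (0:CC)).congr_of_eventuallyEq
    (by filter_upwards [ho.mem_nhds hz₀] with z hz using h z hz))
  constructor <;> refine (mul_eq_zero.1 ?_).resolve_right hW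
  · linear_combination d2 z0 * e0 - y2 z0 * e1
  · linear_combination -d1 z0 * e0 + y1 z0 * e1

theorem lemU {Ω : Set CC} {q H H' y1 y2 d1 d2 : CC → CC} (hp : IsPreconnected Ω) (ho : IsOpen Ω) {z0 : CC} (hz₀ : z0 ∈ Ω)
    (hH : HPair Ω q H H') (h1 : Sol Ω q y1 d1) (h2 : Sol Ω q y2 d2) (hW : y1 z0 * d2 z0 - d1 z0 * y2 z0 ≠ 0)
    {w μ ν χ : CC} (hw : ∀ z ∈ Ω, z + w ∈ Ω) (hHw : ∀ z ∈ Ω, H (z + w) = H z) (hHw' : ∀ z ∈ Ω, H' (z + w) = H' z)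
    (e1 : ∀ z ∈ Ω, y1 (z + w) = μ * y1 z) (e2 : ∀ z ∈ Ω, y2 (z + w) = ν * y2 z + χ * y1 z) :
    ν = conj μ ∧ (conj μ = μ → χ = 0) := by
  have hk := hH.core h1
  obtain ⟨a, b, hab⟩ := sol_lin hp ho hz₀ h1 h2 hk hW
  have hd : ∀ z ∈ Ω, d1 (z + w) = μ * d1 z := fun z hz =>
    ((h1 _ (hw z hz)).1.comp_add_const z w).unique (((h1 z hz).1.const_mul μ).congr_of_eventuallyEq
      (by filter_upwards [ho.mem_nhds hz] with z hz using e1 z hz))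
  have hb : b ≠ 0 := fun hb => by
    have hab : ∀ z ∈ Ω, conj (H z * d1 z - H' z * y1 z) = a * y1 z := fun z hz => by rw [hab z hz, hb]; ring
    have key : ∀ z ∈ Ω, (a * conj a + 1 / 8) * y1 z + 0 * y2 z = 0 := fun z hz => by
      obtain ⟨hc, h0, -, -⟩ := hH z hz
      have t1 := (hk z hz).1.unique (((h1 z hz).1.const_mul a).congr_of_eventuallyEq
        (by filter_upwards [ho.mem_nhds hz] with z hz using hab z hz))
      have t0 := hab z hz
      have t2 := congrArg conj t0
      simp only [map_mul, map_sub, Complex.conj_conj, hc] at t0 t2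
      have t3 : H' z * conj (d1 z) * H z - conj (y1 z) * (1 / 8 + H' z * conj (H' z)) = a * d1 z * H z := by
        rw [← t1]; field_simp
      have t4 := congrArg conj (show a * conj a * conj (y1 z) + 1/8 * conj (y1 z) = 0 by
        linear_combination -a * t2 - t3 + H' z * t0)
      simp [conj8] at t4
      linear_combination t4
    have := (sol_ind ho hz₀ h1 h2 hW key).1
    rw [Complex.mul_conj] at this
    have t5 : (Complex.normSq a + 1 / 8 : RR) = 0 := by
      apply Complex.ofReal_injective; push_cast; exact this
    have := Complex.normSq_nonneg a
    linarith
  have key : ∀ z ∈ Ω, (a * μ + b * χ - conj μ * a) * y1 z + (b * ν - conj μ * b) * y2 z = 0 := fun z hz => by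
    have t1 := hab _ (hw z hz)
    have t2 := hab z hz
    rw [hHw z hz, hHw' z hz, hd z hz, e1 z hz, e2 z hz] at t1
    simp only [map_sub, map_mul] at t1 t2
    linear_combination -t1 + conj μ * t2
  obtain ⟨k1, k2⟩ := sol_ind ho hz₀ h1 h2 hW key
  refine ⟨mul_left_cancel₀ hb (by linear_combination k2), fun h => mul_left_cancel₀ hb ?_⟩
  rw [h] at k1; linear_combination k1

namespace PeriodPair
variable (L : PeriodPair) {a h : CC}

def Good (a : CC) : Prop := 2 * a ∉ L.lattice ∧ ∀ w ∈ L.lattice, ‖L.mu a w‖ = 1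
lemma two_mem {w : CC} (hw : w ∈ L.lattice) : 2 * w ∈ L.lattice := by rw [two_mul]; exact add_mem hw hw
lemma mu_two {w : CC} (hw : w ∈ L.lattice) : L.mu a (2 * w) = L.mu a w ^ 2 := by rw [two_mul, L.mu_add hw hw, sq]
lemma Good.nm {L : PeriodPair} (h : L.Good a) : a ∉ L.lattice := fun H => h.1 (L.two_mem H)
lemma mu_half (hh : h ∉ L.lattice) (h2 : 2 * h ∈ L.lattice) {w : CC} (hw : w ∈ L.lattice) : L.mu h w ^ 2 = 1 := by
  obtain ⟨z, hz, hz'⟩ := L.P_surj (℘[L] h + 1)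
  have e1 := L.Y_add hw h z
  have e2 := L.Y_add hw (-h) z
  have e3 := L.Y_sq hh h2 hz
  rw [L.Y_half hh h2, L.Y_half hh h2, e1, mu_neg] at e2
  have h0 : L.Y h z ≠ 0 := fun h0 => by rw [h0, hz'] at e3; simp at e3
  have := mul_right_cancel₀ h0 e2
  have h1 := L.mu_ne h w
  rw [sq]; nth_rewrite 1 [this]; exact inv_mul_cancel₀ h1

lemma Y_sol (ha : a ∉ L.lattice) : Sol {z | z ∉ L.lattice} (fun z => 2 * ℘[L] z + ℘[L] a) (L.Y a) (L.Y1 a) :=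
  fun _ hz => ⟨L.Y_d ha hz, L.Y1_d ha hz⟩

lemma second (hh : h ∉ L.lattice) (h2 : 2 * h ∈ L.lattice) : ∃ (S : CC → CC) (d : CC), d ≠ 0 ∧
    (∀ z, z ∉ L.lattice → z - h ∉ L.lattice → HasDerivAt S (1 / L.Y h z ^ 2) z) ∧
    ∀ z, z - h ∉ L.lattice → ∀ w ∈ L.lattice, S (z + w) = S z + d * (L.et w + ℘[L] h * w) := by
  obtain ⟨d, hd, hdd⟩ := L.Y_shift hh h2
  refine ⟨fun z => -(L.zt (z - h) + ℘[L] h * z) / d ^ 2, -1 / d ^ 2, by simp [hd], fun z hz hzh => ?_, fun z hz w hw => ?_⟩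
  · refine (((((L.zt_d hzh).comp_sub_const z h).fun_add ((hasDerivAt_id' z).const_mul (℘[L] h))).fun_neg).div_const (d ^ 2)).congr_deriv ?_
    have e1 := hdd z hz hzh
    have e2 := L.Y_sq hh h2 hzh
    have h0 : L.Y h z ≠ 0 := fun h0 => hd (by rw [← e1, h0, zero_mul])
    have : d ^ 2 = L.Y h z ^ 2 * (℘[L] (z - h) - ℘[L] h) := by rw [← e2, ← e1]; ring
    rw [div_eq_div_iff (pow_ne_zero 2 hd) (pow_ne_zero 2 h0), this]; ring
  · simp only
    rw [show z + w - h = z - h + w by ring, L.zt_add hw hz]; ring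

theorem lameGood {S : Set CC} (hSc : S.Countable) (hScl : IsClosed S) (hSL : ∀ z ∈ L.lattice, z ∈ S)
    (hSp : ∀ z ∉ S, ∀ w ∈ L.lattice, z + w ∉ S) {q α β γ δ H H' : CC → CC} (ha : a ∉ L.lattice)
    (hT : ∀ T, S ⊆ T → ∀ y d, Sol Tᶜ (fun z => 2 * ℘[L] z + ℘[L] a) y d → Sol Tᶜ q (fun z => α z * y z + β z * d z) (fun z => γ z * y z + δ z * d z))
    (hdet : ∀ z ∉ S, α z * δ z - β z * γ z ≠ 0)
    (hper : ∀ w ∈ L.lattice, ∀ z ∉ S, α (z + 2 * w) = α z ∧ β (z + 2 * w) = β z)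
    (hH : HPair Sᶜ q H H') (hHp : ∀ w ∈ L.lattice, ∀ z ∉ S, H (z + 2 * w) = H z ∧ H' (z + 2 * w) = H' z) : L.Good a := by
  have hna : -a ∉ L.lattice := by rwa [L.neg_mem_iff']
  have hsub : Sᶜ ⊆ {z | z ∉ L.lattice} := fun z hz hz' => hz (hSL z hz')
  obtain ⟨z0, hz₀, hz₀a⟩ : ∃ z, z ∉ S ∧ z - a ∉ L.lattice := by
    have : (S ∪ {z | z - a ∈ L.lattice}).Countable := hSc.union (L.ctb.preimage (sub_left_injective))
    obtain ⟨z, hz⟩ := (this.dense_compl RR).nonempty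
    simp only [mem_compl_iff, mem_union, not_or] at hz
    exact ⟨z, hz.1, hz.2⟩
  have s1 := L.Y_sol ha
  by_cases h2 : 2 * a ∈ L.lattice
  · exfalso
    obtain ⟨F, d, hd, hF, hFp⟩ := L.second ha h2
    set T := S ∪ {z | z - a ∈ L.lattice} with hTd
    have hTc : T.Countable := hSc.union (L.ctb.preimage (sub_left_injective))
    have hTcl : IsClosed T := hScl.union (L.isClosed_lattice.preimage (continuous_sub_right a))
    have hST : S ⊆ T := subset_union_left
    have hTm : ∀ z ∈ Tᶜ, z ∉ S ∧ z ∉ L.lattice ∧ z - a ∉ L.lattice := fun z hz => by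
      simp only [hTd, mem_compl_iff, mem_union, not_or] at hz
      exact ⟨hz.1, hsub hz.1, hz.2⟩
    have hY0 : ∀ z ∈ Tᶜ, L.Y a z ≠ 0 := fun z hz => by
      rw [Ne, L.Y_zero_iff ha (hTm z hz).2.1]; exact (hTm z hz).2.2
    have s2 : Sol Tᶜ (fun z => 2 * ℘[L] z + ℘[L] a) (fun z => L.Y a z * F z) (fun z => L.Y1 a z * F z + 1 / L.Y a z) := fun z hz => by
      have m := hTm z hz
      have h0 := hY0 z hz
      have d0 := L.Y_d ha m.2.1
      have dF := hF z m.2.1 m.2.2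
      refine ⟨(d0.fun_mul dF).congr_deriv (by field_simp), (((L.Y1_d ha m.2.1).fun_mul dF).fun_add ((hasDerivAt_const z (1:CC)).fun_div d0 h0)).congr_deriv (by field_simp; ring)⟩
    have s1' : Sol Tᶜ (fun z => 2 * ℘[L] z + ℘[L] a) (L.Y a) (L.Y1 a) := fun z hz => s1 z (hTm z hz).2.1
    have hz₀T : z0 ∈ Tᶜ := by simp [hTd, hz₀, hz₀a]
    have key : ∀ w ∈ L.lattice, L.et w = -℘[L] a * w := fun w hw => by
      have hw2 := L.two_mem hw
      have := (lemU (conn_of hTc) hTcl.isOpen_compl hz₀T (hH.mono (compl_subset_compl.2 hST)) (hT T hST _ _ s1') (hT T hST _ _ s2) (by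
          have t := hdet z0 hz₀
          have h0 := hY0 z0 hz₀T
          have e : L.Y a z0 * (1 / L.Y a z0) = 1 := by field_simp
          refine fun H => t ?_
          linear_combination H - (α z0 * δ z0 - β z0 * γ z0) * e) (w := 2 * w) (μ := 1) (ν := 1) (χ := d * (L.et (2 * w) + ℘[L] a * (2 * w)))
        (fun z hz => by
          have m := hTm z hz
          simp only [hTd, mem_compl_iff, mem_union, not_or, mem_setOf_eq]
          exact ⟨hSp z m.1 _ hw2, by rw [show z + 2 * w - a = z - a + 2 * w by ring, L.add_mem_iff hw2]; exact m.2.2⟩)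
        (fun z hz => (hHp w hw z (hTm z hz).1).1) (fun z hz => (hHp w hw z (hTm z hz).1).2)
        (fun z hz => by
          have m := hTm z hz
          rw [(hper w hw z m.1).1, (hper w hw z m.1).2, L.Y_add hw2, L.Y1_add hw2, L.mu_two hw, L.mu_half ha h2 hw]; ring)
        (fun z hz => by
          have m := hTm z hz
          rw [(hper w hw z m.1).1, (hper w hw z m.1).2, L.Y_add hw2, L.Y1_add hw2, L.mu_two hw, L.mu_half ha h2 hw, hFp z m.2.2 _ hw2]; ring)).2 (by simp)
      have := (mul_eq_zero.1 this).resolve_left hd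
      rw [two_mul, L.et_add hw hw] at this
      linear_combination this / 2
    exact L.no_lin _ key
  · refine ⟨h2, fun w hw => ?_⟩
    have hw2 := L.two_mem hw
    have s1' : Sol Sᶜ (fun z => 2 * ℘[L] z + ℘[L] a) (L.Y a) (L.Y1 a) := fun z hz => s1 z (hsub hz)
    have s2' : Sol Sᶜ (fun z => 2 * ℘[L] z + ℘[L] a) (L.Y (-a)) (L.Y1 (-a)) := fun z hz => by
      have := L.Y_sol hna z (hsub hz); rwa [weierstrassP_neg] at this
    have := (lemU (conn_of hSc) hScl.isOpen_compl hz₀ hH (hT S subset_rfl _ _ s1') (hT S subset_rfl _ _ s2') (by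
          have t := mul_ne_zero (hdet z0 hz₀) (L.Pd_ne ha h2)
          have e := L.Y_W ha (hsub hz₀)
          refine fun H => t ?_
          linear_combination -H + (α z0 * δ z0 - β z0 * γ z0) * e) (w := 2 * w) (μ := L.mu a w ^ 2) (ν := (L.mu a w ^ 2)⁻¹) (χ := 0)
        (fun z hz => hSp z hz _ hw2)
        (fun z hz => (hHp w hw z hz).1) (fun z hz => (hHp w hw z hz).2)
        (fun z hz => by
          rw [(hper w hw z hz).1, (hper w hw z hz).2, L.Y_add hw2, L.Y1_add hw2, L.mu_two hw]; ring)
        (fun z hz => by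
          rw [(hper w hw z hz).1, (hper w hw z hz).2, L.Y_add hw2, L.Y1_add hw2, mu_neg, L.mu_two hw]; ring)).1
    have h0 := pow_ne_zero 2 (L.mu_ne a w)
    rw [inv_eq_iff_eq_inv] at this
    have t := congrArg norm this
    rw [norm_inv, RCLike.norm_conj, norm_pow] at t
    have p := norm_pos_iff.2 (L.mu_ne a w)
    have : (‖L.mu a w‖ ^ 2) ^ 2 = 1 := by
      nth_rewrite 1 [sq]; nth_rewrite 1 [t]; exact inv_mul_cancel₀ (by positivity)
    have : ‖L.mu a w‖ ^ 2 = 1 := by nlinarith [sq_nonneg ‖L.mu a w‖]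
    nlinarith
end PeriodPair

namespace PeriodPair
variable (L : PeriodPair) {a h : CC}

lemma fin_max {S : Set CC} (hS : IsClosed S) (hSn : S.Nonempty) (hSp : ∀ w ∈ L.lattice, ∀ z ∈ S, z + w ∈ S) {N : CC → RR}
    (hN : ContinuousOn N S) (hNp : ∀ w ∈ L.lattice, ∀ z, N (z + w) = N z) : ∃ z ∈ S, ∀ w ∈ S, N w ≤ N z := by
  have hK : IsCompact (closure (ZSpan.fundamentalDomain L.basis)) := (ZSpan.fundamentalDomain_isBounded L.basis).isCompact_closure
  have red : ∀ z ∈ S, ∃ y ∈ closure (ZSpan.fundamentalDomain L.basis) ∩ S, N y = N z := fun z hz => by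
    have hm : ((ZSpan.floor L.basis z : Submodule.span ℤ (range L.basis)) : CC) ∈ L.lattice := by
      rw [lattice_eq_span_range_basis]; exact Subtype.coe_prop _
    have e : ZSpan.fract L.basis z = z + -(ZSpan.floor L.basis z : CC) := by rw [ZSpan.fract_apply]; ring
    refine ⟨ZSpan.fract L.basis z, ⟨subset_closure (ZSpan.fract_mem_fundamentalDomain _ _), ?_⟩, ?_⟩
    · rw [e]; exact hSp _ (L.neg_mem_iff'.2 hm) z hz
    · rw [e]; exact hNp _ (L.neg_mem_iff'.2 hm) z
  obtain ⟨z1, hz₁⟩ := hSn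
  obtain ⟨y1, hy₁, -⟩ := red z1 hz₁
  obtain ⟨z, hz, hm⟩ := (hK.inter_right hS).exists_isMaxOn ⟨y1, hy₁⟩ (hN.mono inter_subset_right)
  refine ⟨z, hz.2, fun w hw => ?_⟩
  obtain ⟨y, hy, e⟩ := red w hw
  rw [← e]; exact hm hy

open Classical in
def fr (a z : CC) : CC := if z ∈ L.lattice then 1 else L.Y a z / L.Y (-a) z
lemma fr_of {z : CC} (hz : z ∉ L.lattice) : L.fr a z = L.Y a z / L.Y (-a) z := if_neg hz
lemma fr_mem {z : CC} (hz : z ∈ L.lattice) : L.fr a z = 1 := if_pos hz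
lemma fr_per (hg : L.Good a) {w : CC} (hw : w ∈ L.lattice) (z : CC) : ‖L.fr a (z + w)‖ = ‖L.fr a z‖ := by
  by_cases hz : z ∈ L.lattice
  · rw [L.fr_mem hz, L.fr_mem (add_mem hz hw)]
  · rw [L.fr_of hz, L.fr_of (by rwa [L.add_mem_iff hw]), L.Y_add hw, L.Y_add hw, mu_neg, norm_div, norm_div, norm_mul, norm_mul, norm_inv, hg.2 w hw]
    simp
lemma fr_c0 (hg : L.Good a) : ContinuousAt (L.fr a) 0 := by
  have ha := hg.nm
  obtain ⟨R, r1, r2⟩ := L.Y_l ha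
  obtain ⟨T, t1, t2⟩ := L.Y_l (a := -a) (by rwa [L.neg_mem_iff'])
  have : L.fr a =ᶠ[𝓝 0] fun z => (1 + z ^ 2 * R z) / (1 + z ^ 2 * T z) := eq_nhds_of_punct (by
    filter_upwards [r2, t2, L.ev_punct 0, self_mem_nhdsWithin] with z e1 e2 e3 e4
    have e4 : z ≠ 0 := e4
    rw [L.fr_of e3, e1, e2, ← mul_div_mul_left _ _ e4]
    congr 1 <;> field_simp) (by simp [L.fr_mem L.zero_mem'])
  refine ContinuousAt.congr ?_ this.symm
  exact (AnalyticAt.fun_div (𝕜 := CC) (by fun_prop) (by fun_prop) (by simp)).continuousAt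
lemma fr_an (ha : a ∉ L.lattice) {z : CC} (hz : z ∉ L.lattice) (h0 : ℘[L] z ≠ ℘[L] a) :
    L.fr a z ≠ 0 ∧ HasDerivAt (L.fr a) (℘'[L] a / (℘[L] z - ℘[L] a) * L.fr a z) z := by
  have hna : -a ∉ L.lattice := by rwa [L.neg_mem_iff']
  have e0 := L.Y_mul ha hz
  have e1 := L.Y_W ha hz
  have hx := sub_ne_zero.2 h0
  rw [← e0] at hx ⊢
  obtain ⟨h1, h2⟩ := mul_ne_zero_iff.1 hx
  refine ⟨by rw [L.fr_of hz]; exact div_ne_zero h1 h2, ?_⟩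
  refine (((L.Y_d ha hz).fun_div (L.Y_d hna hz) h2).congr_of_eventuallyEq ?_).congr_deriv ?_
  · filter_upwards [L.ev_compl hz] with w hw using L.fr_of hw
  · rw [L.fr_of hz]; field_simp; linear_combination -e1
lemma fr_neg (hz : (℘[L] h) ≠ ℘[L] a) (ha : a ∉ L.lattice) : L.fr a (-h) = (L.fr a h)⁻¹ := by
  by_cases hz : h ∈ L.lattice
  · rw [L.fr_mem hz, L.fr_mem (L.neg_mem_iff'.2 hz), inv_one]
  · rw [L.fr_of hz, L.fr_of (by rwa [L.neg_mem_iff'])]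
    have e1 := L.Y_neg a h
    have e2 := L.Y_neg (-a) h
    rw [neg_neg] at e2
    rw [e1, e2, inv_div, neg_div_neg_eq]
lemma fr_half (hg : L.Good a) (hz : (℘[L] h) ≠ ℘[L] a) (h2 : 2 * h ∈ L.lattice) : ‖L.fr a h‖ = 1 := by
  have e1 := L.fr_per hg h2 (-h)
  rw [show -h + 2 * h = h by ring, L.fr_neg hz hg.nm, norm_inv] at e1
  by_cases hh : h ∈ L.lattice
  · rw [L.fr_mem hh, norm_one]
  have := norm_pos_iff.2 (L.fr_an hg.nm hh hz).1
  have : ‖L.fr a h‖ ^ 2 = 1 := by rw [sq]; nth_rewrite 1 [e1]; exact inv_mul_cancel₀ this.ne'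
  nlinarith

lemma excl0 (hg : L.Good a) {e1 e2 e3 A β : CC} (hs : e1 + e2 + e3 = 0)
    (hq : ∀ z ∉ L.lattice, ℘'[L] z ^ 2 = 4 * (℘[L] z - e1) * (℘[L] z - e2) * (℘[L] z - e3))
    (ht : ∀ z ∉ L.lattice, ℘[L] z = e1 ∨ ℘[L] z = e3 → 2 * z ∈ L.lattice) (hc : ℘[L] a = -2 * e1)
    (hA : A = e1 - e2) (hB : β * A = e1 - e3) (hA0 : A ≠ 0) {J U : Set RR} (hJ : IsClosed J) (hU : IsOpen U) (hUJ : U ⊆ J) (hUn : U.Nonempty)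
    (hJ0 : ∀ v ∈ J, v ≠ 0) (hJU : ∀ v ∈ J, v ∉ U → v = 1 ∨ (v:CC) = 1 + β)
    (hU1 : ∀ v ∈ U, ((v:CC) - 1) * (v - β) * (v - 1 - β) ≠ 0)
    (hU2 : ∀ v ∈ U, ∀ s : RR, β * (1 + β) ≠ s ^ 2 * (((v:CC) - 1) * (v - β) * (v - 1 - β))) : False := by
  have ha := hg.nm
  set S : Set CC := {z | z ∈ L.lattice ∨ ∃ v ∈ J, ℘[L] z = A * v - 2 * e1} with hSd
  have hne : ∀ v ∈ J, A * (v:CC) - 2 * e1 ≠ ℘[L] a := fun v hv H => by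
    rw [hc] at H
    have : A * (v:CC) = 0 := by linear_combination H
    exact hJ0 v hv (by exact_mod_cast (mul_eq_zero.1 this).resolve_left hA0)
  have key : ∀ z ∉ L.lattice, ∀ v ∈ U, ℘[L] z = A * v - 2 * e1 → ∃ y ∈ S, ‖L.fr a z‖ < ‖L.fr a y‖ := fun z hz v hv hzv => by
    by_contra! hmax
    have hq1 : ℘'[L] z ^ 2 = 4 * A ^ 3 * (((v:CC) - 1) * (v - β) * (v - 1 - β)) := by
      rw [hq z hz, hzv, show e3 = -e1 - e2 by linear_combination hs]
      have h3 : 3 * e1 = A + β * A := by rw [hB]; nth_rewrite 1 [hA]; linear_combination hs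
      rw [show e2 = e1 - A by rw [hA]; ring, show A * (v:CC) - 2 * e1 - e1 = A * v - (A + β * A) by rw [← h3]; ring,
        show A * (v:CC) - 2 * e1 - (e1 - A) = A * v - (A + β * A) + A by rw [← h3]; ring]
      ring
    have hd0 : ℘'[L] z ≠ 0 := fun h0 => by
      rw [h0] at hq1
      exact mul_ne_zero (mul_ne_zero (by norm_num : (4:CC) ≠ 0) (pow_ne_zero 3 hA0)) (hU1 v hv) (by rw [← hq1]; ring)
    have hst : HasStrictDerivAt ℘[L] (℘'[L] z) z := by
      have := (L.P_an hz).hasStrictDerivAt; rwa [L.deriv_weierstrassP] at this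
    set g := hst.localInverse _ _ _ hd0 with hgd
    have hgi : HasStrictDerivAt g (℘'[L] z)⁻¹ (℘[L] z) := hst.to_localInverse hd0
    have hge : ∀ᶠ x in 𝓝 (℘[L] z), ℘[L] (g x) = x := (hst.hasStrictFDerivAt_equiv hd0).eventually_right_inverse
    have hgz : g (℘[L] z) = z := (hst.hasStrictFDerivAt_equiv hd0).localInverse_apply_image
    set γ : RR → CC := fun t => g (A * t - 2 * e1) with hγd
    have hγv : γ v = z := by simp only [hγd]; rw [← hzv, hgz]
    have hl : HasDerivAt (fun t : RR => A * (t:CC) - 2 * e1) A v := by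
      simpa using ((Complex.ofRealCLM.hasDerivAt (x := v)).const_mul A).sub_const (2 * e1)
    have hγ : HasDerivAt γ ((℘'[L] z)⁻¹ * A) v := by
      have := hgi.hasDerivAt
      rw [hzv] at this
      exact HasDerivAt.comp v this hl
    obtain ⟨hf0, hf⟩ := L.fr_an ha hz (by rw [hzv]; exact hne v (hUJ hv))
    set κ := ℘'[L] a / (℘[L] z - ℘[L] a) * ((℘'[L] z)⁻¹ * A) with hκ
    have hF : HasDerivAt (fun t => L.fr a (γ t)) (κ * L.fr a z) v := by
      have hf' := hf; rw [← hγv] at hf'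
      have := HasDerivAt.comp v hf' hγ
      rw [hγv] at this
      exact this.congr_deriv (by rw [hκ]; ring)
    have hloc : IsLocalMax (fun t => ‖L.fr a (γ t)‖ ^ 2) v := by
      have c1 : ∀ᶠ t in 𝓝 v, ℘[L] (γ t) = A * t - 2 * e1 := by
        rw [hzv] at hge
        exact hl.continuousAt.eventually hge
      filter_upwards [c1, hU.mem_nhds hv] with t h1 h2
      rw [hγv]
      exact pow_le_pow_left₀ (norm_nonneg _) (hmax _ (Or.inr ⟨t, hUJ h2, h1⟩)) 2
    have hre : κ.re = 0 := by
      have hn := hloc.hasDerivAt_eq_zero hF.norm_sq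
      rw [hγv, Complex.inner] at hn
      have e : κ * L.fr a z * conj (L.fr a z) = κ * ((‖L.fr a z‖ ^ 2 : RR) : CC) := by
        rw [mul_assoc, Complex.mul_conj, Complex.normSq_eq_norm_sq]
      rw [e, Complex.re_mul_ofReal] at hn
      have := norm_pos_iff.2 hf0
      have h4 : ‖L.fr a z‖ ^ 2 ≠ 0 := by positivity
      simpa [h4] using hn
    have hκ2 : κ ^ 2 = -((κ.im ^ 2 : RR) : CC) := by
      have : κ = κ.im * Complex.I := by apply Complex.ext <;> simp [hre]
      rw [this]; simp [mul_pow]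
    have hx : ℘[L] z - ℘[L] a = A * v := by rw [hc, hzv]; ring
    have hv0 : (v:CC) ≠ 0 := by exact_mod_cast hJ0 v (hUJ hv)
    have hq2 : ℘'[L] a ^ 2 = -4 * A ^ 3 * (β * (1 + β)) := by
      rw [hq a ha, hc]
      have h3 : 3 * e1 = A + β * A := by rw [hB]; nth_rewrite 1 [hA]; linear_combination hs
      rw [show e3 = -e1 - e2 by linear_combination hs, show e2 = e1 - A by rw [hA]; ring, show -2 * e1 - e1 = -(A + β * A) by rw [← h3]; ring,
        show -2 * e1 - (e1 - A) = A - (A + β * A) by rw [← h3]; ring]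
      ring
    refine hU2 v hv (κ.im * v) ?_
    have e5 : κ ^ 2 * (v:CC) ^ 2 * ℘'[L] z ^ 2 = ℘'[L] a ^ 2 := by
      rw [hκ, hx]; field_simp
    rw [hκ2, hq1, hq2] at e5
    have e6 : (4 * A ^ 3) ≠ 0 := mul_ne_zero (by norm_num : (4:CC) ≠ 0) (pow_ne_zero 3 hA0)
    apply mul_left_cancel₀ e6
    push_cast at e5 ⊢
    linear_combination e5
  have hSp : ∀ w ∈ L.lattice, ∀ z ∈ S, z + w ∈ S := fun w hw z hz => by
    rcases hz with h | ⟨v, h1, h2⟩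
    · exact Or.inl (add_mem h hw)
    · exact Or.inr ⟨v, h1, by rw [L.P_add hw, h2]⟩
  have hSv : ∀ z ∈ S, z ∉ L.lattice → ∃ v ∈ J, ℘[L] z = A * v - 2 * e1 := fun z hz hz' => hz.resolve_left hz'
  have hSc : IsClosed S := by
    rw [← isOpen_compl_iff, isOpen_iff_mem_nhds]
    intro z hz
    simp only [hSd, mem_compl_iff, mem_setOf_eq, not_or] at hz
    have hcl : IsClosed ((fun v : RR => A * (v:CC) - 2 * e1) '' J) := by
      have : IsClosedEmbedding (fun v : RR => A * (v:CC) - 2 * e1) :=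
        ((Homeomorph.mulLeft₀ A hA0).trans (Homeomorph.subRight (2 * e1))).isClosedEmbedding.comp Complex.isometry_ofReal.isClosedEmbedding
      exact this.isClosedMap _ hJ
    have := (L.P_an hz.1).continuousAt.preimage_mem_nhds (hcl.isOpen_compl.mem_nhds (fun ⟨v, h1, h2⟩ => hz.2 ⟨v, h1, h2.symm⟩))
    filter_upwards [this, L.ev_compl hz.1] with y h1 h2 h3
    rcases h3 with h3 | ⟨v, h3, h4⟩
    · exact h2 h3
    · exact h1 ⟨v, h3, h4.symm⟩
  have hNc : ContinuousOn (fun z => ‖L.fr a z‖) S := fun z hz => by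
    refine ContinuousAt.continuousWithinAt ?_
    by_cases hzL : z ∈ L.lattice
    · have e : (fun y => ‖L.fr a y‖) = fun y => ‖L.fr a (y - z)‖ := by
        funext y; rw [← L.fr_per hg hzL (y - z), sub_add_cancel]
      rw [e]
      exact (ContinuousAt.comp_of_eq (L.fr_c0 hg) (f := fun y => y - z) (by fun_prop) (by simp)).norm
    · obtain ⟨v, h1, h2⟩ := hSv z hz hzL
      exact (L.fr_an ha hzL (by rw [h2]; exact hne v h1)).2.continuousAt.norm
  obtain ⟨z, hz, hm⟩ := L.fin_max hSc ⟨0, Or.inl L.zero_mem'⟩ hSp hNc (fun w hw z => L.fr_per hg hw z)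
  have hle : ‖L.fr a z‖ ≤ 1 := by
    by_cases hzL : z ∈ L.lattice
    · rw [L.fr_mem hzL, norm_one]
    obtain ⟨v, h1, h2⟩ := hSv z hz hzL
    by_cases hv : v ∈ U
    · obtain ⟨y, hy, hlt⟩ := key z hzL v hv h2
      exact absurd (hm y hy) (not_le.2 hlt)
    · refine (L.fr_half hg (by rw [h2]; exact hne v h1) (ht z hzL ?_)).le
      rcases hJU v h1 hv with e | e
      · right; rw [h2, e, hA]; push_cast; linear_combination -hs
      · left; rw [h2, e, mul_add, mul_one, mul_comm A, hB, hA]; linear_combination -hs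
  obtain ⟨v, hv⟩ := hUn
  obtain ⟨y, hy, hyv⟩ := L.P_surj (A * v - 2 * e1)
  have hyS : y ∈ S := Or.inr ⟨v, hUJ hv, hyv⟩
  have hyS' : -y ∈ S := Or.inr ⟨v, hUJ hv, by rw [weierstrassP_neg, hyv]⟩
  obtain ⟨t, ht', hlt⟩ := key y hy v hv hyv
  have l1 := hm _ hyS'
  have hya : ℘[L] y ≠ ℘[L] a := by rw [hyv]; exact hne v (hUJ hv)
  rw [L.fr_neg hya ha, norm_inv] at l1
  have l2 := norm_pos_iff.2 (L.fr_an ha hy hya).1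
  have l3 : 1 ≤ ‖L.fr a y‖ := by
    have := l1.trans hle
    rwa [inv_le_one₀ l2] at this
  linarith [hm t ht']

theorem excl (hg : L.Good a) : ℘[L] a ≠ -2 * ℘[L] (L.ω₁ / 2) := fun hc => by
  obtain ⟨e2, e3, n2, n3, n23, hs, hq, ht⟩ := L.cubic
  set e1 := ℘[L] (L.ω₁ / 2) with he₁
  have h10 : e1 ≠ 0 := fun h0 => hg.1 (ht a hg.nm (Or.inl (by rw [hc, h0]; ring)))
  have cplx : ∀ β : CC, β.im ≠ 0 → ∀ v : RR, 1 < v → ∀ s : RR, β * (1 + β) ≠ s ^ 2 * (((v:CC) - 1) * (v - β) * (v - 1 - β)) := fun β hβ v hv s H => by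
    have h1 := congrArg Complex.im H
    have h2 := congrArg Complex.re H
    simp [pow_two] at h1 h2
    set p := β.re
    set q := β.im
    set ρ := s * s * (v - 1) with hρ
    have hρ0 : 0 ≤ ρ := mul_nonneg (mul_self_nonneg s) (by linarith)
    have E1 : (2 * p + 1) * (1 - ρ) + 2 * v * ρ = 0 := mul_left_cancel₀ hβ (by rw [hρ]; linear_combination h1)
    have E2 : (p ^ 2 - q ^ 2 + p) * (1 - ρ) - ρ * (v ^ 2 - v * (2 * p + 1)) = 0 := by rw [hρ]; linear_combination h2
    have E3 : ρ * v ^ 2 + (1 / 4 + q ^ 2) * (1 - ρ) ^ 2 = 0 := by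
      linear_combination -(1 - ρ) * E2 + ((2 * p + 1) * (1 - ρ) + 2 * v * ρ) / 4 * E1
    have t1 : 0 ≤ ρ * v ^ 2 := by positivity
    have t2 : 0 ≤ (1 / 4 + q ^ 2) * (1 - ρ) ^ 2 := by positivity
    have t3 : (1 / 4 + q ^ 2) * (1 - ρ) ^ 2 = 0 := by linarith
    have t4 : ρ * v ^ 2 = 0 := by linarith
    have t5 := (mul_eq_zero.1 t3).resolve_left (by positivity)
    have t6 : ρ = 1 := by nlinarith
    rw [t6] at t4; nlinarith
  have main : ∀ e2 e3 β : CC, e2 ≠ e1 → e1 + e2 + e3 = 0 → (∀ z ∉ L.lattice, ℘'[L] z ^ 2 = 4 * (℘[L] z - e1) * (℘[L] z - e2) * (℘[L] z - e3)) →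
      (∀ z ∉ L.lattice, ℘[L] z = e1 ∨ ℘[L] z = e3 → 2 * z ∈ L.lattice) → β * (e1 - e2) = e1 - e3 →
      (β.im ≠ 0 ∨ ∃ b : RR, β = b ∧ (-1 < b ∧ b < 0 ∨ 0 < b ∧ b < 1)) → False := fun e2 e3 β n2 hs hq ht hB hβ => by
    have hA0 := sub_ne_zero.2 n2.symm
    by_cases hpos : ∃ b : RR, β = b ∧ 0 < b ∧ b < 1
    · obtain ⟨b, rfl, b0, b1⟩ := hpos
      refine L.excl0 hg hs hq ht hc rfl hB hA0 (J := Icc 1 (1 + b)) (U := Ioo 1 (1 + b)) isClosed_Icc isOpen_Ioo Ioo_subset_Icc_self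
        ⟨1 + b / 2, by constructor <;> linarith⟩ (fun v hv => by have := hv.1; linarith) (fun v hv hv' => ?_) (fun v hv => ?_) (fun v hv s H => ?_)
      · rcases eq_or_lt_of_le hv.1 with e | e
        · exact Or.inl e.symm
        · right
          have : v = 1 + b := le_antisymm hv.2 (not_lt.1 fun h => hv' ⟨e, h⟩)
          rw [this]; push_cast; ring
      · have h1 := hv.1
        have h2 := hv.2
        have : (v - 1) * (v - b) * (v - 1 - b) ≠ 0 := mul_ne_zero (mul_ne_zero (by linarith) (by linarith)) (by linarith)
        exact_mod_cast this
      · have h1 := hv.1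
        have h2 := hv.2
        have H' : b * (1 + b) = s ^ 2 * ((v - 1) * (v - b) * (v - 1 - b)) := by exact_mod_cast H
        have t1 : 0 < b * (1 + b) := by positivity
        have t2 : 0 ≤ s ^ 2 * ((v - 1) * (v - b)) := mul_nonneg (sq_nonneg s) (mul_nonneg (by linarith) (by linarith))
        nlinarith
    · refine L.excl0 hg hs hq ht hc rfl hB hA0 (J := Ici 1) (U := Ioi 1) isClosed_Ici isOpen_Ioi Ioi_subset_Ici_self
        ⟨2, by simp⟩ (fun v hv => by have : 1 ≤ v := hv; linarith) (fun v hv hv' => Or.inl (le_antisymm (not_lt.1 hv') hv)) (fun v hv => ?_) (fun v hv s => ?_)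
      · have hv : 1 < v := hv
        refine mul_ne_zero (mul_ne_zero ?_ ?_) ?_
        · exact_mod_cast (by linarith : v - 1 ≠ 0)
        all_goals
          intro h0
          have h1 := congrArg Complex.im h0
          have h2 := congrArg Complex.re h0
          rcases hβ with hβ | ⟨b, rfl, hb⟩
          · simp at h1; exact hβ h1
          · rcases hb with hb | hb
            · simp at h2; linarith [hb.1, hb.2]
            · exact hpos ⟨b, rfl, hb⟩
      · have hv : 1 < v := hv
        rcases hβ with hβ | ⟨b, rfl, hb⟩
        · exact cplx β hβ v hv s
        · rcases hb with hb | hb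
          · intro H
            have H' : b * (1 + b) = s ^ 2 * ((v - 1) * (v - b) * (v - 1 - b)) := by exact_mod_cast H
            have t2 : 0 ≤ s ^ 2 * ((v - 1) * (v - b) * (v - 1 - b)) := mul_nonneg (sq_nonneg s) (mul_nonneg (mul_nonneg (by linarith) (by linarith [hb.2])) (by linarith [hb.2]))
            nlinarith [hb.1, hb.2]
          · exact absurd ⟨b, rfl, hb⟩ hpos
  have hA0 := sub_ne_zero.2 n2.symm
  have hB0 := sub_ne_zero.2 n3.symm
  set β := (e1 - e3) / (e1 - e2) with hβ
  have hB : β * (e1 - e2) = e1 - e3 := div_mul_cancel₀ _ hA0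
  have hq' : ∀ z ∉ L.lattice, ℘'[L] z ^ 2 = 4 * (℘[L] z - e1) * (℘[L] z - e3) * (℘[L] z - e2) := fun z hz => by rw [hq z hz]; ring
  have hB' : β⁻¹ * (e1 - e3) = e1 - e2 := by rw [hβ, inv_div]; exact div_mul_cancel₀ _ hB0
  have m1 := main e2 e3 β n2 hs hq (fun z hz h => ht z hz (by tauto)) hB
  have m2 := main e3 e2 β⁻¹ n3 (by linear_combination hs) hq' (fun z hz h => ht z hz (by tauto)) hB'
  by_cases him : β.im = 0
  · have hβr : β = β.re := Complex.ext (by simp) (by simp [him])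
    set b := β.re with hb
    have b0 : b ≠ 0 := fun h0 => by
      rw [hβr, h0] at hB; apply hB0; rw [← hB]; simp
    have b1 : b ≠ 1 := fun h0 => by
      rw [hβr, h0] at hB; apply n23; simp at hB; exact hB
    have b2 : b ≠ -1 := fun h0 => by
      rw [hβr, h0] at hB; apply h10; push_cast at hB; linear_combination (-hB + hs) / 3
    have hbi : β⁻¹ = ((b⁻¹ : RR) : CC) := by rw [hβr]; push_cast; rfl
    rcases lt_trichotomy b 0 with h | h | h
    · rcases lt_or_gt_of_ne b2 with h' | h'
      · refine m2 (Or.inr ⟨_, hbi, Or.inl ⟨?_, inv_lt_zero.2 h⟩⟩)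
        have : b⁻¹ * b = 1 := inv_mul_cancel₀ b0
        nlinarith
      · exact m1 (Or.inr ⟨b, hβr, Or.inl ⟨h', h⟩⟩)
    · exact b0 h
    · rcases lt_or_gt_of_ne b1 with h' | h'
      · exact m1 (Or.inr ⟨b, hβr, Or.inr ⟨h, h'⟩⟩)
      · exact m2 (Or.inr ⟨_, hbi, Or.inr ⟨inv_pos.2 h, inv_lt_one_of_one_lt₀ h'⟩⟩)
  · exact m1 (Or.inl him)
end PeriodPair

def uu (W : CC) (y1 y2 : CC → CC) (z : CC) : RR := Real.log (8 * ‖W‖ ^ 2 / (‖y1 z‖ ^ 2 + ‖y2 z‖ ^ 2) ^ 2)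

lemma Sol.an {Ω : Set CC} {q y d : CC → CC} (h : Sol Ω q y d) (ho : IsOpen Ω) {z : CC} (hz : z ∈ Ω) : AnalyticAt CC y z :=
  Complex.analyticAt_iff_eventually_differentiableAt.2 (by
    filter_upwards [ho.mem_nhds hz] with w hw using (h w hw).1.differentiableAt)

lemma npos {W a b c d : CC} (h : a * d - c * b = W) (h0 : W ≠ 0) : 0 < ‖a‖ ^ 2 + ‖b‖ ^ 2 := by
  by_cases ha : a = 0
  · by_cases hb : b = 0
    · subst ha hb; simp at h; exact absurd h.symm h0
    · have := norm_pos_iff.2 hb; positivity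
  · have := norm_pos_iff.2 ha; positivity

lemma uu_liou {Ω : Set CC} {q y1 y2 d1 d2 : CC → CC} {W : CC} (ho : IsOpen Ω) (h1 : Sol Ω q y1 d1) (h2 : Sol Ω q y2 d2)
    (hW : ∀ z ∈ Ω, y1 z * d2 z - d1 z * y2 z = W) (h0 : W ≠ 0) {z : CC} (hz : z ∈ Ω) :
    (∀ n : ℕ, ContDiffAt RR n (uu W y1 y2) z) ∧ lapl (uu W y1 y2) z + Real.exp (uu W y1 y2 z) = 0 ∧ Qp (uu W y1 y2) z = q z := by
  have hWn : 0 < ‖W‖ := norm_pos_iff.2 h0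
  have hs : ∀ n : ℕ, ContDiffAt RR n (uu W y1 y2) z := fun n => by
    have a1 : ContDiffAt RR n y1 z := (h1.an ho hz).contDiffAt.restrict_scalars RR
    have a2 : ContDiffAt RR n y2 z := (h2.an ho hz).contDiffAt.restrict_scalars RR
    have p := npos (hW z hz) h0
    refine ContDiffAt.log (contDiffAt_const.div (((a1.norm_sq RR).add (a2.norm_sq RR)).pow 2) (by positivity)) (by positivity)
  set N : CC → CC := fun z => y1 z * conj (y1 z) + y2 z * conj (y2 z) with hN
  have hNr : ∀ z, N z = ((‖y1 z‖ ^ 2 + ‖y2 z‖ ^ 2 : RR) : CC) := fun z => by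
    simp only [hN, Complex.mul_conj, Complex.normSq_eq_norm_sq]; push_cast; ring
  have hN0 : ∀ z ∈ Ω, N z ≠ 0 := fun z hz => by
    rw [hNr]; exact_mod_cast (npos (hW z hz) h0).ne'
  have wN : ∀ z ∈ Ω, HasW N (d1 z * conj (y1 z) + d2 z * conj (y2 z)) (y1 z * conj (d1 z) + y2 z * conj (d2 z)) z := fun z hz =>
    (((h1 z hz).1.hasW.mul (h1 z hz).1.hasW.conj).add ((h2 z hz).1.hasW.mul (h2 z hz).1.hasW.conj)).cd (by simp) (by simp)
  have wN1 : ∀ z ∈ Ω, HasW (fun z => d1 z * conj (y1 z) + d2 z * conj (y2 z)) (q z * N z) (d1 z * conj (d1 z) + d2 z * conj (d2 z)) z := fun z hz =>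
    (((h1 z hz).2.hasW.mul (h1 z hz).1.hasW.conj).add ((h2 z hz).2.hasW.mul (h2 z hz).1.hasW.conj)).cd (by simp [hN]; ring) (by simp)
  have eU : ∀ z ∈ Ω, Uc (uu W y1 y2) z = (Real.log (8 * ‖W‖ ^ 2) : RR) - 2 * Complex.log (N z) := fun z hz => by
    have p := npos (hW z hz) h0
    rw [hNr, ← Complex.ofReal_log p.le, Uc, uu, Real.log_div (by positivity) (by positivity), Real.log_pow]; push_cast; ring
  have wU : ∀ z ∈ Ω, dz (Uc (uu W y1 y2)) z = -2 * (d1 z * conj (y1 z) + d2 z * conj (y2 z)) * (N z)⁻¹ := fun z hz => by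
    have p := npos (hW z hz) h0
    have hsl : N z ∈ Complex.slitPlane := by rw [hNr]; exact Complex.ofReal_mem_slitPlane.2 p
    have := (hasW_const (Real.log (8 * ‖W‖ ^ 2) : RR) z).sub ((hasW_const 2 z).mul (HasW.comp (Complex.hasDerivAt_log hsl) (wN z hz)))
    rw [(this.congr (eventually_of_mem (ho.mem_nhds hz) eU) rfl rfl).dz_eq]; ring
  have wU1 := (((hasW_const (-2) z).mul (wN1 z hz)).mul ((wN z hz).inv (hN0 z hz))).congr (eventually_of_mem (ho.mem_nhds hz) wU) rfl rfl
  have n0 := hN0 z hz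
  have p := npos (hW z hz) h0
  refine ⟨hs, ?_, ?_⟩
  · have e1 := (liou_lap hs).2
    rw [wU1.db_eq] at e1
    have e2 : Real.exp (uu W y1 y2 z) = 8 * ‖W‖ ^ 2 / (‖y1 z‖ ^ 2 + ‖y2 z‖ ^ 2) ^ 2 := by rw [uu, Real.exp_log (by positivity)]
    have e3 : ((Real.exp (uu W y1 y2 z) : RR) : CC) = 8 * (W * conj W) / N z ^ 2 := by
      rw [e2, hNr, Complex.mul_conj, Complex.normSq_eq_norm_sq]; push_cast; ring
    have : ((lapl (uu W y1 y2) z + Real.exp (uu W y1 y2 z) : RR) : CC) = 0 := by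
      rw [Complex.ofReal_add, e3, show ((lapl (uu W y1 y2) z : RR) : CC) = 4 * ((lapl (uu W y1 y2) z : RR) / 4) by ring, ← e1, ← hW z hz]
      field_simp
      simp only [hN, map_sub, map_mul]; ring
    exact_mod_cast this
  · rw [Qp, wU1.dz_eq, wU z hz]; field_simp; ring

def CS (Λ P : Set CC) (u : CC → RR) : Prop := (∀ w ∈ Λ, ∀ z, u (z + w) = u z) ∧
  (∀ z ∉ P, (∀ n : ℕ, ContDiffAt RR n u z) ∧ lapl u z + Real.exp (u z) = 0) ∧
  ∀ p ∈ P, ∃ C ε : RR, 0 < ε ∧ ∀ z ∈ ann p ε, |u z - 4 * Real.log (dist z p)| ≤ C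

structure CP (P : Set CC) (q y₁ y₂ d₁ d₂ : CC → CC) (W : CC) : Prop where
  cl : IsClosed P
  s1 : Sol Pᶜ q y₁ d₁
  s2 : Sol Pᶜ q y₂ d₂
  W0 : W ≠ 0
  wr : ∀ z ∉ P, y₁ z * d₂ z - d₁ z * y₂ z = W
  sg : ∀ p ∈ P, ∃ Y₁ Y₂ : CC → CC, AnalyticAt CC Y₁ p ∧ AnalyticAt CC Y₂ p ∧ (Y₁ p ≠ 0 ∨ Y₂ p ≠ 0) ∧
    ∀ᶠ z in 𝓝[≠] p, z ∉ P ∧ y₁ z = Y₁ z / (z - p) ∧ y₂ z = Y₂ z / (z - p)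

theorem constr {Λ P : Set CC} {q y1 y2 d1 d2 : CC → CC} {W : CC} (h : CP P q y1 y2 d1 d2 W)
    (hper : ∀ w ∈ Λ, ∀ z, ‖y1 (z + w)‖ = ‖y1 z‖ ∧ ‖y2 (z + w)‖ = ‖y2 z‖) : CS Λ P (uu W y1 y2) := by
  refine ⟨fun w hw z => by simp only [uu, (hper w hw z).1, (hper w hw z).2], fun z hz => ?_, fun p hp => ?_⟩
  · have := uu_liou h.cl.isOpen_compl h.s1 h.s2 h.wr h.W0 hz
    exact ⟨this.1, this.2.1⟩
  · obtain ⟨Y₁, Y2, a1, a2, hn, ev⟩ := h.sg p hp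
    have pos : 0 < ‖Y₁ p‖ ^ 2 + ‖Y2 p‖ ^ 2 := by
      rcases hn with h | h <;> have := norm_pos_iff.2 h <;> positivity
    have hW := norm_pos_iff.2 h.W0
    have ct : ContinuousAt (uu W Y₁ Y2) p := by
      refine ContinuousAt.log (continuousAt_const.div (((a1.continuousAt.norm.pow 2).add (a2.continuousAt.norm.pow 2)).pow 2) (by positivity)) (by positivity)
    have ev2 : ∀ᶠ z in 𝓝 p, |uu W Y₁ Y2 z| < |uu W Y₁ Y2 p| + 1 := ct.abs.eventually_lt continuousAt_const (by linarith)
    have ev4 : ∀ᶠ z in 𝓝 p, 0 < ‖Y₁ z‖ ^ 2 + ‖Y2 z‖ ^ 2 :=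
      continuousAt_const.eventually_lt ((a1.continuousAt.norm.pow 2).add (a2.continuousAt.norm.pow 2)) pos
    have ev3 := (ev2.and ev4).and (eventually_nhdsWithin_iff.1 ev)
    obtain ⟨ε, he, hb⟩ := Metric.eventually_nhds_iff.1 ev3
    refine ⟨|uu W Y₁ Y2 p| + 1, ε, he, fun z hz => ?_⟩
    obtain ⟨⟨b1, b3⟩, b2⟩ := hb hz.2
    obtain ⟨-, e1, e2⟩ := b2 hz.1
    have hd : 0 < ‖z - p‖ := norm_pos_iff.2 (sub_ne_zero.2 hz.1)
    have : uu W y1 y2 z - 4 * Real.log (dist z p) = uu W Y₁ Y2 z := by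
      rw [uu, uu, e1, e2, norm_div, norm_div, dist_eq_norm, show 8 * ‖W‖ ^ 2 / ((‖Y₁ z‖ / ‖z - p‖) ^ 2 + (‖Y2 z‖ / ‖z - p‖) ^ 2) ^ 2 =
        8 * ‖W‖ ^ 2 / (‖Y₁ z‖ ^ 2 + ‖Y2 z‖ ^ 2) ^ 2 * ‖z - p‖ ^ 4 by field_simp, Real.log_mul (by positivity) (by positivity), Real.log_pow]
      push_cast; ring
    rw [this]; exact b1.le

theorem dev {P : Set CC} {q y1 y2 d1 d2 g : CC → CC} {W : CC} (h : CP P q y1 y2 d1 d2 W)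
    (hm : ∀ z, MeromorphicAt g z) (hg : ∀ z, ∀ᶠ x in 𝓝[≠] z, g x * y2 x = y1 x) : IsDevelopingMapOf (uu W y1 y2) g := by
  refine ⟨hm, fun z ga g0 => ?_⟩
  by_cases hz : z ∈ P
  · exfalso
    obtain ⟨Y₁, Y2, a1, a2, hn, ev⟩ := h.sg z hz
    have e : ∀ᶠ x in 𝓝[≠] z, g x * Y2 x = Y₁ x := by
      filter_upwards [hg z, ev, self_mem_nhdsWithin] with x e1 ⟨_, e2, e3⟩ hx
      have : x - z ≠ 0 := sub_ne_zero.2 hx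
      rw [e2, e3] at e1; field_simp at e1; exact e1
    have e0 := eq_of_punct (ga.continuousAt.mul a2.continuousAt) a1.continuousAt e
    have hY : Y2 z ≠ 0 := fun h0 => by
      simp only [Pi.mul_apply, h0, mul_zero] at e0
      rcases hn with h | h
      exacts [h e0.symm, h h0]
    have eD : ∀ᶠ x in 𝓝[≠] z, deriv g x * Y2 x ^ 2 = -W * (x - z) ^ 2 := by
      have ga' : ∀ᶠ x in 𝓝[≠] z, AnalyticAt CC g x := ga.eventually_analyticAt.filter_mono nhdsWithin_le_nhds
      filter_upwards [ev_pp (hg z), ev, self_mem_nhdsWithin, ga'] with x e1 ⟨hx, e2, e3⟩ hxz gx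
      have nx : x - z ≠ 0 := sub_ne_zero.2 hxz
      have s1 := (h.s1 x hx).1
      have s2 := (h.s2 x hx).1
      have f1 : g x * y2 x = y1 x := e1.self_of_nhds
      have e1' : (g * y2) =ᶠ[𝓝 x] y1 := e1
      have f2 := (gx.differentiableAt.hasDerivAt.mul s2).unique (s1.congr_of_eventuallyEq e1')
      have f3 := h.wr x hx
      rw [show Y2 x = y2 x * (x - z) by rw [e3]; field_simp]
      linear_combination (x - z) ^ 2 * (y2 x * f2 - f3 - f1 * d2 x)
    have := eq_of_punct (ga.deriv.continuousAt.mul (a2.continuousAt.pow 2)) (by fun_prop) eD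
    simp [g0, hY] at this
  · have s1 := (h.s1 z hz).1
    have s2 := (h.s2 z hz).1
    have f1 : g z * y2 z = y1 z := eq_of_punct (ga.continuousAt.mul s2.continuousAt) s1.continuousAt (hg z)
    have f2 := (ga.differentiableAt.hasDerivAt.mul s2).unique (s1.congr_of_eventuallyEq (eq_nhds_of_punct (hg z) f1))
    have f3 := h.wr z hz
    have hY : y2 z ≠ 0 := fun h0 => h.W0 (by rw [← f3, ← f1, h0]; ring)
    have f4 : W = -deriv g z * y2 z ^ 2 := by linear_combination -f3 + y2 z * f2 - f1 * d2 z
    have := norm_pos_iff.2 hY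
    rw [uu, f4, ← f1]; congr 1
    rw [norm_mul, norm_mul, norm_neg, norm_pow]; field_simp; ring

lemma dz_per {g : CC → CC} {w : CC} (h : ∀ z, g (z + w) = g z) (z : CC) : dz g (z + w) = dz g z := by
  have : (fun z => g (z + w)) = g := funext h
  have e := fderiv_comp_add_right (𝕜 := RR) (f := g) (x := z) w
  rw [this] at e
  rw [dz, dz, e]
lemma Uc_per {u : CC → RR} {w : CC} (h : ∀ z, u (z + w) = u z) (z : CC) : Uc u (z + w) = Uc u z := by rw [Uc, Uc, h]
lemma hp_per {u : CC → RR} {w : CC} (h : ∀ z, u (z + w) = u z) (z : CC) : hp u (z + w) = hp u z := by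
  rw [hp, hp, dz_per (Uc_per h)]
lemma Qp_per {u : CC → RR} {w : CC} (h : ∀ z, u (z + w) = u z) (z : CC) : Qp u (z + w) = Qp u z := by
  rw [Qp, Qp, dz_per (dz_per (Uc_per h)), dz_per (Uc_per h)]

lemma CS.liou {Λ P : Set CC} {u : CC → RR} (h : CS Λ P u) {z : CC} (hz : z ∉ P) : Liou u z := Liou.of (h.2.1 z hz).1 (h.2.1 z hz).2
lemma CS.Q_an {Λ P : Set CC} {u : CC → RR} (h : CS Λ P u) (hP : IsClosed P) {z : CC} (hz : z ∉ P) : AnalyticAt CC (Qp u) z :=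
  Complex.analyticAt_iff_eventually_differentiableAt.2 (by
    filter_upwards [hP.isOpen_compl.mem_nhds hz] with w hw
    exact Liou.holo (by filter_upwards [hP.isOpen_compl.mem_nhds hw] with x hx using h.liou hx))
lemma CS.loc {Λ P : Set CC} {u : CC → RR} (h : CS Λ P u) (hP : Disc P) {p : CC} (hp : p ∈ P) :
    ∃ t e c ρ, AnalyticAt CC ρ p ∧ c = t * e - t ^ 3 / 4 ∧
    ∀ᶠ z in 𝓝[≠] p, Qp u z = 2 / (z - p) ^ 2 + t / (z - p) + e + c * (z - p) + (z - p) ^ 2 * ρ z := by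
  obtain ⟨C, ε, he, hb⟩ := h.2.2 p hp
  obtain ⟨δ, hd, hb2⟩ := Metric.eventually_nhds_iff.1 (eventually_nhdsWithin_iff.1 (hP p))
  exact localQ (lt_min he hd) (fun z hz => h.liou (hb2 (hz.2.trans_le (min_le_right _ _)) hz.1))
    (fun z hz => hb z ⟨hz.1, hz.2.trans_le (min_le_left _ _)⟩)

namespace PeriodPair
variable (L : PeriodPair) {a h : CC}

lemma lat_closed : IsClosed (L.lattice : Set CC) := ⟨L.open_compl⟩

lemma lameFin {u : CC → RR} (hu : ∀ z ∉ L.lattice, Liou u z) (hper : ∀ w ∈ L.lattice, ∀ z, u (z + 2 * w) = u z) {B : CC}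
    (hQ : ∀ z ∉ L.lattice, Qp u z = 2 * ℘[L] z + B) : ∃ a, L.Good a ∧ ℘[L] a = B := by
  obtain ⟨a, ha, rfl⟩ := L.P_surj B
  refine ⟨a, ?_, rfl⟩
  refine L.lameGood (S := L.lattice) (q := fun z => 2 * ℘[L] z + ℘[L] a) (α := fun _ => 1) (β := fun _ => 0) (γ := fun _ => 0) (δ := fun _ => 1)
    (H := Hp u) (H' := fun z => hp u z * Hp u z) L.ctb L.lat_closed (fun z hz => hz) (fun z hz w hw => by rwa [SetLike.mem_coe, L.add_mem_iff hw]) ha ?_ ?_ ?_ ?_ ?_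
  · intro T hT y d hs; simpa using hs
  · intros; simp
  · intros; simp
  · exact (Liou.hpair (Ω := (L.lattice : Set CC)ᶜ) (fun z hz => hu z hz)).congr hQ
  · intro w hw z hz
    have e : Hp u (z + 2 * w) = Hp u z := by rw [Hp, Hp, hper w hw]
    exact ⟨e, by rw [e, hp_per (hper w hw)]⟩

theorem partA {u : CC → RR} (hu : CS L.lattice L.lattice u) : ∃ a, L.Good a := by
  obtain ⟨t, e, c, ρ, hρ, -, ev⟩ := hu.loc L.disc L.zero_mem'
  obtain ⟨β, hβ, ev1⟩ := L.zt_l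
  obtain ⟨γ, hγ, ev2⟩ := L.P_l
  obtain ⟨α, c', hα, -, h3⟩ := L.liouQ L.disc (φ := fun z => Qp u z - 2 * ℘[L] z - t * L.zt z) (fun w => -t * L.et w) (fun w hw z hz => by
    rw [Qp_per (hu.1 w hw), L.P_add hw, L.zt_add hw hz]; ring) (fun p => by
    by_cases hp : p ∈ L.lattice
    · refine ⟨-p, neg_mem hp, fun z => e + c * z + z ^ 2 * ρ z - 2 * z ^ 2 * γ z - t * z ^ 2 * β z, ?_, ?_⟩
      · rw [add_neg_cancel]; fun_prop
      · rw [add_neg_cancel]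
        filter_upwards [ev, ev1, ev2] with z e1 e2 e3
        rw [e1, e2, e3]; simp only [sub_zero]; ring
    · exact ⟨0, L.zero_mem', by
        rw [add_zero]
        have := hu.Q_an L.lat_closed hp
        have := L.P_an hp
        have := L.zt_an hp
        exact AnalyticAt.ext (by fun_prop)⟩)
  have ht : t = 0 := by
    by_contra h0
    exact L.no_lin (-α / t) (fun w hw => by field_simp; linear_combination hα w hw)
  have hα0 : α = 0 := by
    have := hα L.ω₁ L.ω₁_mem_lattice
    simp only [ht, neg_zero, zero_mul, mul_eq_zero] at this
    rcases this with h | h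
    · exact h
    · exact absurd (by rw [h]; simp) L.h1_mem
  obtain ⟨a, ha, -⟩ := L.lameFin (fun z hz => hu.liou hz) (fun w hw => hu.1 _ (L.two_mem hw)) (B := c') (fun z hz => by
    have q1 := hu.Q_an L.lat_closed hz
    have q2 := L.P_an hz
    have q3 := L.zt_an hz
    have := h3 z _ (by fun_prop) EventuallyEq.rfl
    rw [ht, hα0] at this; linear_combination this)
  exact ⟨a, ha⟩

lemma Y_loc (ha : a ∉ L.lattice) {p : CC} (hp : p ∈ L.lattice) : ∃ R, AnalyticAt CC R p ∧ R p ≠ 0 ∧ ∀ᶠ z in 𝓝[≠] p, L.Y a z = R z / (z - p) := by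
  obtain ⟨R, r1, r2⟩ := L.Y_l ha
  refine ⟨fun z => L.mu a p * (1 + (z - p) ^ 2 * R (z - p)), ?_, ?_, ?_⟩
  · have : AnalyticAt CC (fun z => R (z - p)) p := AnalyticAt.comp' (by rwa [sub_self]) (by fun_prop)
    exact analyticAt_const.mul (analyticAt_const.add (AnalyticAt.mul (by fun_prop) this))
  · simp [L.mu_ne]
  · rw [show (0:CC) = p + -p by ring] at r2
    filter_upwards [punct_add r2, self_mem_nhdsWithin] with z e1 e2
    have : z - p ≠ 0 := sub_ne_zero.2 e2
    rw [show L.Y a z = L.mu a p * L.Y a (z + -p) by rw [← L.Y_add hp]; congr 1; ring, e1, ← sub_eq_add_neg]; field_simp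

lemma P_neg' (z : CC) : ℘[L] (-z) = ℘[L] z := L.weierstrassP_neg z

lemma CP_Y (ha : 2 * a ∉ L.lattice) : CP L.lattice (fun z => 2 * ℘[L] z + ℘[L] a) (L.Y a) (L.Y (-a)) (L.Y1 a) (L.Y1 (-a)) (-℘'[L] a) := by
  have h1 : a ∉ L.lattice := fun H => ha (L.two_mem H)
  have h2 : -a ∉ L.lattice := by rwa [L.neg_mem_iff']
  refine ⟨L.lat_closed, L.Y_sol h1, ?_, neg_ne_zero.2 (L.Pd_ne h1 ha), fun z hz => L.Y_W h1 hz, fun p hp => ?_⟩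
  · have := L.Y_sol h2
    rw [P_neg'] at this; exact this
  · obtain ⟨R, r1, r2, r3⟩ := L.Y_loc h1 hp
    obtain ⟨T, t1, t2, t3⟩ := L.Y_loc h2 hp
    refine ⟨R, T, r1, t1, Or.inl r2, ?_⟩
    filter_upwards [r3, t3, L.disc p] with z e1 e2 e3 using ⟨e3, e1, e2⟩

lemma Y_nper (hg : L.Good a) {w : CC} (hw : w ∈ L.lattice) (z : CC) : ‖L.Y a (z + w)‖ = ‖L.Y a z‖ ∧ ‖L.Y (-a) (z + w)‖ = ‖L.Y (-a) z‖ := by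
  rw [L.Y_add hw, L.Y_add hw, mu_neg, norm_mul, norm_mul, norm_inv, hg.2 w hw]; simp

theorem partD (hg : L.Good a) : CS L.lattice L.lattice (uu (-℘'[L] a) (L.Y a) (L.Y (-a))) :=
  constr (L.CP_Y hg.1) (fun _ hw z => L.Y_nper hg hw z)

lemma uu_even (W : CC) (z : CC) : uu W (L.Y a) (L.Y (-a)) (-z) = uu W (L.Y a) (L.Y (-a)) z := by
  have e1 := L.Y_neg a z
  have e2 := L.Y_neg a (-z)
  rw [neg_neg] at e2
  simp only [uu, e2, e1, norm_neg]; rw [add_comm]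

lemma Y_mer (ha : a ∉ L.lattice) (z : CC) : MeromorphicAt (L.Y a) z := by
  by_cases hz : z ∈ L.lattice
  · obtain ⟨R, r1, -, r3⟩ := L.Y_loc ha hz
    exact (r1.meromorphicAt.div (by fun_prop : MeromorphicAt (fun x => x - z) z)).congr (r3.mono fun _ h => h.symm)
  · exact (L.Y_an ha hz).meromorphicAt
end PeriodPair

namespace PeriodPair
variable (L : PeriodPair) {a h : CC}

def PS (h : CC) : Set CC := {z | z ∈ L.lattice ∨ z - h ∈ L.lattice}
lemma PS_ctb : (L.PS h).Countable := L.ctb.union (L.ctb.preimage sub_left_injective)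
lemma PS_closed : IsClosed (L.PS h) := L.lat_closed.union (L.lat_closed.preimage (by fun_prop : Continuous fun z : CC => z - h))
lemma PS_disc : Disc (L.PS h) := L.disc.union (L.disc_add h)
lemma PS_add {z w : CC} (hw : w ∈ L.lattice) : z + w ∈ L.PS h ↔ z ∈ L.PS h := by
  simp only [PS, mem_setOf_eq, L.add_mem_iff hw, show z + w - h = z - h + w by ring]

def dQ (h lam z : CC) : CC := 2 * ℘[L] z + 2 * ℘[L] (z - h) - 2 * lam * L.Gf h z + lam ^ 2 - ℘[L] h
def dγ (h lam z : CC) : CC := 2 * L.Y h z + lam * (lam - L.Gf h z) / L.Y h z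
def dδ (h lam z : CC) : CC := (lam - L.Gf h z) / L.Y h z

lemma Yh_d (hh : h ∉ L.lattice) {z : CC} (hz : z ∉ L.PS h) : L.Y h z ≠ 0 ∧ HasDerivAt (L.Y h) (L.Gf h z * L.Y h z) z := by
  simp only [PS, mem_setOf_eq, not_or] at hz
  exact ⟨fun H => hz.2 ((L.Y_zero_iff hh hz.1).1 H), L.Y_d0 hh hz.1 hz.2⟩

lemma darb (hh : h ∉ L.lattice) (h2 : 2 * h ∈ L.lattice) {B lam : CC} (hB : B = lam ^ 2 - 2 * ℘[L] h) {T : Set CC} (hT : L.PS h ⊆ T) {y d : CC → CC}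
    (hs : Sol Tᶜ (fun z => 2 * ℘[L] z + B) y d) :
    Sol Tᶜ (L.dQ h lam) (fun z => lam / L.Y h z * y z + 1 / L.Y h z * d z) (fun z => L.dγ h lam z * y z + L.dδ h lam z * d z) := fun z hz => by
  have hzP : z ∉ L.PS h := fun H => hz (hT H)
  obtain ⟨hw, wd⟩ := L.Yh_d hh hzP
  have hzP' : z ∉ L.lattice ∧ z - h ∉ L.lattice := by simpa only [PS, mem_setOf_eq, not_or] using hzP
  have gd := L.G_d hzP'.1 hzP'.2
  have gs := L.G_sq hh hzP'.1 hzP'.2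
  have ws := L.Y_sq hh h2 hzP'.1
  obtain ⟨y1, y2⟩ := hs z hz
  have p1 : ℘[L] z = L.Y h z ^ 2 + ℘[L] h := by rw [ws]; ring
  have p2 : ℘[L] (z - h) = L.Gf h z ^ 2 - ℘[L] z - ℘[L] h := by rw [gs]; ring
  constructor
  · refine ((((hasDerivAt_const z lam).div wd hw).mul y1).add (((hasDerivAt_const z (1:CC)).div wd hw).mul y2)).congr_deriv ?_
    simp only [dγ, dδ, Pi.div_apply, p1, hB]; field_simp; ring
  · refine ((((wd.const_mul 2).add ((((hasDerivAt_const z lam).sub gd).const_mul lam).div wd hw)).mul y1).add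
      ((((hasDerivAt_const z lam).sub gd).div wd hw).mul y2)).congr_deriv ?_
    simp only [dγ, dδ, dQ, Pi.div_apply, Pi.sub_apply, Pi.add_apply, p2, p1, hB]; field_simp; ring

lemma darbG (hh : h ∉ L.lattice) (h2 : 2 * h ∈ L.lattice) {lam : CC} (ha : a ∉ L.lattice) (hB : ℘[L] a = lam ^ 2 - 2 * ℘[L] h) {u : CC → RR}
    (hu : CS L.lattice (L.PS h) u) (hQ : ∀ z ∉ L.PS h, Qp u z = L.dQ h lam z) : L.Good a := by
  refine L.lameGood (S := L.PS h) (q := L.dQ h lam) (α := fun z => lam / L.Y h z) (β := fun z => 1 / L.Y h z) (γ := L.dγ h lam) (δ := L.dδ h lam)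
    (H := Hp u) (H' := fun z => hp u z * Hp u z) L.PS_ctb L.PS_closed (fun z hz => Or.inl hz) (fun z hz w hw => by rwa [L.PS_add hw]) ha
    (fun T hT y d hs => L.darb hh h2 hB hT hs) (fun z hz => ?_) (fun w hw z hz => ?_) ((Liou.hpair (fun z hz => hu.liou hz)).congr hQ) (fun w hw z hz => ?_)
  · obtain ⟨hw, -⟩ := L.Yh_d hh hz
    have : lam / L.Y h z * L.dδ h lam z - 1 / L.Y h z * L.dγ h lam z = -2 := by simp only [dδ, dγ]; field_simp; ring
    rw [this]; norm_num
  · rw [L.Y_add (L.two_mem hw), L.mu_two hw, L.mu_half hh h2 hw, one_mul]; exact ⟨rfl, rfl⟩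
  · have hper := hu.1 _ (L.two_mem hw)
    have e : Hp u (z + 2 * w) = Hp u z := by rw [Hp, Hp, hper]
    exact ⟨e, by rw [e, hp_per hper]⟩

lemma Cglob (hh : h ∉ L.lattice) (h2 : 2 * h ∈ L.lattice) {u : CC → RR} (hu : CS L.lattice (L.PS h) u) :
    (∃ E, ∀ z ∉ L.PS h, Qp u z = 2 * ℘[L] z + 2 * ℘[L] (z - h) + E) ∨ ∃ lam, ∀ z ∉ L.PS h, Qp u z = L.dQ h lam z := by
  have m0 : (0:CC) ∈ L.PS h := Or.inl L.zero_mem'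
  have mh : h ∈ L.PS h := Or.inr (by rw [sub_self]; exact L.zero_mem')
  obtain ⟨t, e, c, ρ, hρ, hc, ev⟩ := hu.loc L.PS_disc m0
  obtain ⟨t', e', c', ρ', hρ', -, ev'⟩ := hu.loc L.PS_disc mh
  obtain ⟨β, hβ, ev1⟩ := L.zt_l
  obtain ⟨γ, hγ, ev2⟩ := L.P_l
  have ev1' : ∀ᶠ z in 𝓝[≠] h, L.zt (z + -h) = 1 / (z + -h) + (z + -h) ^ 2 * β (z + -h) :=
    punct_add (P := fun z => L.zt z = 1 / z + z ^ 2 * β z) (by rw [add_neg_cancel]; exact ev1)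
  have ev2' : ∀ᶠ z in 𝓝[≠] h, ℘[L] (z + -h) = 1 / (z + -h) ^ 2 + (z + -h) ^ 2 * γ (z + -h) :=
    punct_add (P := fun z => ℘[L] z = 1 / z ^ 2 + z ^ 2 * γ z) (by rw [add_neg_cancel]; exact ev2)
  have hh' : (0:CC) - h ∉ L.lattice := by rwa [zero_sub, L.neg_mem_iff']
  have ext : ∀ p, ∃ w ∈ L.lattice, ExtAt (fun z => Qp u z - 2 * ℘[L] z - 2 * ℘[L] (z - h) - t * L.zt z - t' * L.zt (z - h)) (p + w) := fun p => by
    by_cases hp : p ∈ L.lattice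
    · refine ⟨-p, neg_mem hp, fun z => e + c * z + z ^ 2 * ρ z - 2 * z ^ 2 * γ z - t * z ^ 2 * β z - 2 * ℘[L] (z - h) - t' * L.zt (z - h), ?_, ?_⟩
      · rw [add_neg_cancel]
        have := L.ztc_an hh'
        have := L.Pc_an hh'
        fun_prop
      · rw [add_neg_cancel]
        filter_upwards [ev, ev1, ev2] with z e1 e2 e3
        rw [e1, e2, e3]; simp only [sub_zero]; ring
    by_cases hp' : p - h ∈ L.lattice
    · refine ⟨-(p - h), neg_mem hp', fun z => e' + c' * (z - h) + (z - h) ^ 2 * ρ' z - 2 * (z - h) ^ 2 * γ (z - h) - t' * (z - h) ^ 2 * β (z - h) - 2 * ℘[L] z - t * L.zt z, ?_, ?_⟩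
      · rw [show p + -(p - h) = h by ring]
        have := L.zt_an hh
        have := L.P_an hh
        have g1 : AnalyticAt CC (fun z => γ (z - h)) h := AnalyticAt.comp' (by rwa [sub_self]) (by fun_prop)
        have g2 : AnalyticAt CC (fun z => β (z - h)) h := AnalyticAt.comp' (by rwa [sub_self]) (by fun_prop)
        have k : AnalyticAt CC (fun z => z - h) h := by fun_prop
        exact ((((((analyticAt_const.add (analyticAt_const.mul k)).add ((k.pow 2).mul hρ')).sub ((analyticAt_const.mul (k.pow 2)).mul g1)).sub
          ((analyticAt_const.mul (k.pow 2)).mul g2))).sub (analyticAt_const.mul (L.P_an hh))).sub (analyticAt_const.mul (L.zt_an hh))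
      · rw [show p + -(p - h) = h by ring]
        filter_upwards [ev', ev1', ev2'] with z e1 e2 e3
        rw [← sub_eq_add_neg] at e2 e3
        rw [e1, e2, e3]; ring
    · refine ⟨0, L.zero_mem', ?_⟩
      rw [add_zero]
      have := hu.Q_an L.PS_closed (z := p) (not_or.2 ⟨hp, hp'⟩)
      have := L.P_an hp
      have := L.zt_an hp
      have := L.ztc_an hp'
      have := L.Pc_an hp'
      exact AnalyticAt.ext (by fun_prop)
  obtain ⟨α, K, hα, -, h3⟩ := L.liouQ L.PS_disc (φ := fun z => Qp u z - 2 * ℘[L] z - 2 * ℘[L] (z - h) - t * L.zt z - t' * L.zt (z - h)) (fun w => -(t + t') * L.et w) (fun w hw z hz => by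
    have hz' := not_or.1 hz
    rw [Qp_per (hu.1 w hw), L.P_add hw, L.zt_add hw hz'.1, show z + w - h = z - h + w by ring, L.P_add hw, L.zt_add hw hz'.2]; ring) ext
  have ht : t + t' = 0 := by
    by_contra h0
    exact L.no_lin (-α / (t + t')) (fun w hw => by field_simp; linear_combination hα w hw)
  have hα0 : α = 0 := by
    have := hα L.ω₁ L.ω₁_mem_lattice
    simp only [ht, neg_zero, zero_mul, mul_eq_zero] at this
    rcases this with h | h
    · exact h
    · exact absurd (by rw [h]; simp) L.h1_mem
  have key : ∀ z ∉ L.PS h, Qp u z = 2 * ℘[L] z + 2 * ℘[L] (z - h) - t * L.Gf h z + (K + t * L.zt h) := fun z hz => by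
    have hz' := not_or.1 hz
    have q1 := hu.Q_an L.PS_closed hz
    have q2 := L.P_an hz'.1
    have q3 := L.zt_an hz'.1
    have q4 := L.ztc_an hz'.2
    have q5 := L.Pc_an hz'.2
    have := h3 z _ (by fun_prop) EventuallyEq.rfl
    rw [hα0] at this
    simp only [Gf]
    linear_combination this + ht * L.zt (z - h)
  by_cases t0 : t = 0
  · left; exact ⟨K + t * L.zt h, fun z hz => by rw [key z hz, t0]; ring⟩
  right
  refine ⟨t / 2, fun z hz => ?_⟩
  obtain ⟨A, hA, hA0, evA⟩ := L.G_l hh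
  have q5 := L.Pc_an hh'
  have e1 : (fun z => e + c * z + z ^ 2 * ρ z) =ᶠ[𝓝[≠] 0] fun z => 2 * z ^ 2 * γ z + 2 * ℘[L] (z - h) - t * (z * A z) + (K + t * L.zt h) := by
    filter_upwards [ev, ev2, evA, L.PS_disc 0] with z a1 a2 a3 a4
    rw [key z a4, a2, a3] at a1; rw [sub_zero] at a1; linear_combination -a1
  have q6 := q5.continuousAt
  have e2 := eq_of_punct (by fun_prop) (by fun_prop) e1
  have e3 := eq_nhds_of_punct e1 e2
  have e4 := e3.deriv_eq
  have D1 : HasDerivAt (fun z => e + c * z + z ^ 2 * ρ z) c 0 := by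
    refine ((((hasDerivAt_id (0:CC)).const_mul c).const_add e).add (((hasDerivAt_id (0:CC)).pow 2).mul hρ.differentiableAt.hasDerivAt)).congr_deriv ?_
    simp
  have D2 : HasDerivAt (fun z => 2 * z ^ 2 * γ z + 2 * ℘[L] (z - h) - t * (z * A z) + (K + t * L.zt h)) (t * ℘[L] h) 0 := by
    refine (((((((hasDerivAt_id (0:CC)).pow 2).const_mul 2).mul hγ.differentiableAt.hasDerivAt).add (((L.P_d hh').comp_sub_const 0 h).const_mul 2)).sub
      (((hasDerivAt_id (0:CC)).mul hA.differentiableAt.hasDerivAt).const_mul t)).add_const _).congr_deriv ?_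
    have := L.Pd_half hh h2
    simp [hA0, this]
  rw [D1.deriv, D2.deriv] at e4
  simp only [zero_sub, P_neg'] at e2
  have e5 : e = 2 * ℘[L] h + (K + t * L.zt h) := by simpa using e2
  have e6 : K + t * L.zt h = t ^ 2 / 4 - ℘[L] h := mul_left_cancel₀ t0 (by rw [e4, e5] at hc; linear_combination -hc)
  rw [key z hz, e6, dQ]; ring
end PeriodPair

lemma mero_id {F : CC → CC} (hm : ∀ z, MeromorphicAt F z) {z0 : CC} (h0 : ∀ᶠ x in 𝓝[≠] z0, F x = 0) (z : CC) : ∀ᶠ x in 𝓝[≠] z, F x = 0 := by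
  by_contra hz
  have hz' : meromorphicOrderAt F z ≠ ⊤ := fun H => hz (meromorphicOrderAt_eq_top_iff.1 H)
  have := MeromorphicOn.meromorphicOrderAt_ne_top_of_isPreconnected (U := univ) (fun z _ => hm z) isPreconnected_univ (mem_univ z) (mem_univ z0) hz'
  exact this (meromorphicOrderAt_eq_top_iff.2 h0)

lemma dz_congr {g g' : CC → CC} {z : CC} (h : g =ᶠ[𝓝 z] g') : dz g z = dz g' z := by rw [dz, dz, h.fderiv_eq]
lemma Qp_congr {u u' : CC → RR} {z : CC} (h : u =ᶠ[𝓝 z] u') : Qp u z = Qp u' z := by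
  have h1 : Uc u =ᶠ[𝓝 z] Uc u' := h.mono fun x e => by simp only [Uc, e]
  have h2 : dz (Uc u) =ᶠ[𝓝 z] dz (Uc u') := h1.eventually_nhds.mono fun x e => dz_congr e
  rw [Qp, Qp, dz_congr h2, dz_congr h1]

theorem mob {P : Set CC} {q y1 y2 d1 d2 : CC → CC} {W : CC} (h : CP P q y1 y2 d1 d2 W) (hP : Disc P) {u : CC → RR} {f : CC → CC}
    (hQ : ∀ z ∉ P, Qp u z = q z) (hf : IsDevelopingMapOf u f) (hy : ∀ z, MeromorphicAt y1 z ∧ MeromorphicAt y2 z) {z1 : CC}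
    (ha : AnalyticAt CC f z1) (hd : deriv f z1 ≠ 0) :
    ∃ α β γ δ, α * δ - β * γ ≠ 0 ∧ ∀ z, ∀ᶠ x in 𝓝[≠] z, f x * (γ * y1 x + δ * y2 x) = α * y1 x + β * y2 x := by
  have ev : ∀ᶠ z in 𝓝 z1, AnalyticAt CC f z ∧ deriv f z ≠ 0 := ha.eventually_analyticAt.and (ha.deriv.continuousAt.eventually_ne hd)
  obtain ⟨z0, ⟨a0, c0⟩, hz₀⟩ := ((ev.filter_mono nhdsWithin_le_nhds).and (hP z1)).exists
  have hsl : ∀ᶠ z in 𝓝 z0, deriv f z / deriv f z0 ∈ Complex.slitPlane := by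
    have : ContinuousAt (fun z => deriv f z / deriv f z0) z0 := a0.deriv.continuousAt.div_const _
    exact this.eventually_mem (Complex.isOpen_slitPlane.mem_nhds (by rw [div_self c0]; exact Complex.one_mem_slitPlane))
  obtain ⟨r, hr, hB⟩ := Metric.eventually_nhds_iff_ball.1 ((a0.eventually_analyticAt.and (a0.deriv.continuousAt.eventually_ne c0)).and
    (hsl.and (h.cl.isOpen_compl.mem_nhds hz₀)))
  set c := deriv f z0 with hc
  set s : CC → CC := fun z => Complex.exp (-(1 / 2) * Complex.log (deriv f z / c)) with hs
  set D : CC → CC := fun z => deriv (deriv f) z / deriv f z with hD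
  have sd : ∀ z ∈ ball z0 r, HasDerivAt s (-(1 / 2) * D z * s z) z := fun z hz => by
    obtain ⟨⟨fa, f0⟩, fs, -⟩ := hB z hz
    have := (((Complex.hasDerivAt_log fs).comp z (fa.deriv.differentiableAt.hasDerivAt.div_const c)).const_mul (-(1/2))).cexp
    refine this.congr_deriv ?_
    simp only [hs, hD, Function.comp_def]; field_simp
  have Da : ∀ z ∈ ball z0 r, HasDerivAt D (deriv D z) z := fun z hz => by
    obtain ⟨⟨fa, f0⟩, fs, -⟩ := hB z hz
    exact (fa.deriv.deriv.div fa.deriv f0).differentiableAt.hasDerivAt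
  have s2 : ∀ z ∈ ball z0 r, s z ^ 2 * deriv f z = c := fun z hz => by
    obtain ⟨⟨fa, f0⟩, fs, -⟩ := hB z hz
    have : s z ^ 2 = (deriv f z / c)⁻¹ := by
      simp only [hs]
      rw [← Complex.exp_nat_mul, show ((2:ℕ):CC) * (-(1 / 2) * Complex.log (deriv f z / c)) = -Complex.log (deriv f z / c) by push_cast; ring,
        Complex.exp_neg, Complex.exp_log (div_ne_zero f0 c0)]
    rw [this]; field_simp
  have S1 : Sol (ball z0 r) (fun z => -(1/2) * deriv D z + 1 / 4 * D z ^ 2) s (fun z => -(1 / 2) * D z * s z) := fun z hz =>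
    ⟨sd z hz, ((((Da z hz).const_mul (-(1/2))).mul (sd z hz))).congr_deriv (by ring)⟩
  have S2 : Sol (ball z0 r) (fun z => -(1/2) * deriv D z + 1 / 4 * D z ^ 2) (fun z => f z * s z) (fun z => deriv f z * s z + f z * (-(1 / 2) * D z * s z)) := fun z hz => by
    obtain ⟨⟨fa, f0⟩, -, -⟩ := hB z hz
    have fd := fa.differentiableAt.hasDerivAt
    refine ⟨fd.mul (sd z hz), ((fa.deriv.differentiableAt.hasDerivAt.mul (sd z hz)).add (fd.mul (S1 z hz).2)).congr_deriv ?_⟩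
    rw [show deriv (deriv f) z = D z * deriv f z by simp only [hD]; field_simp]; ring
  have SW : ∀ z ∈ ball z0 r, s z * (deriv f z * s z + f z * (-(1 / 2) * D z * s z)) - (-(1 / 2) * D z * s z) * (f z * s z) = c := fun z hz => by
    linear_combination s2 z hz
  have ue : ∀ z ∈ ball z0 r, u z = uu c s (fun z => f z * s z) z := fun z hz => by
    obtain ⟨⟨fa, f0⟩, -, -⟩ := hB z hz
    have s0 : 0 < ‖s z‖ := norm_pos_iff.2 (Complex.exp_ne_zero _)
    rw [hf.2 z fa f0, uu, ← s2 z hz]; congr 1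
    rw [norm_mul, norm_mul, norm_pow]; field_simp
  have qe : ∀ z ∈ ball z0 r, -(1/2) * deriv D z + 1 / 4 * D z ^ 2 = q z := fun z hz => by
    rw [← hQ z (hB z hz).2.2, Qp_congr (eventually_of_mem (isOpen_ball.mem_nhds hz) ue)]
    exact (uu_liou isOpen_ball S1 S2 SW c0 hz).2.2.symm
  have hsub : ball z0 r ⊆ Pᶜ := fun z hz => (hB z hz).2.2
  have T1 : Sol (ball z0 r) q s _ := fun z hz => by rw [← qe z hz]; exact S1 z hz
  have T2 : Sol (ball z0 r) q (fun z => f z * s z) _ := fun z hz => by rw [← qe z hz]; exact S2 z hz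
  have m0 := mem_ball_self hr (x := z0)
  have pc : IsPreconnected (ball z0 r) := (convex_ball z0 r).isPreconnected
  have h1 : Sol (ball z0 r) q y1 d1 := fun z hz => h.s1 z (hsub hz)
  have h2 : Sol (ball z0 r) q y2 d2 := fun z hz => h.s2 z (hsub hz)
  have hW : y1 z0 * d2 z0 - d1 z0 * y2 z0 ≠ 0 := by rw [h.wr z0 hz₀]; exact h.W0
  obtain ⟨γ, δ, e1⟩ := sol_lin pc isOpen_ball m0 h1 h2 T1 hW
  obtain ⟨α, β, e2⟩ := sol_lin pc isOpen_ball m0 h1 h2 T2 hW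
  refine ⟨α, β, γ, δ, fun H => c0 ?_, fun z => ?_⟩
  · have nb := isOpen_ball.mem_nhds m0
    have k1 := ((((h1 z0 m0).1.const_mul γ).add ((h2 z0 m0).1.const_mul δ)).congr_of_eventuallyEq (eventually_of_mem nb e1)).unique (T1 z0 m0).1
    have k2 := ((((h1 z0 m0).1.const_mul α).add ((h2 z0 m0).1.const_mul β)).congr_of_eventuallyEq (eventually_of_mem nb e2)).unique (T2 z0 m0).1
    have e2' : f z0 * s z0 = _ := e2 z0 m0
    rw [← SW z0 m0, ← k2, ← k1, e2', e1 z0 m0]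
    linear_combination (-(y1 z0 * d2 z0 - d1 z0 * y2 z0)) * H
  · have := mero_id (F := fun x => f x * (γ * y1 x + δ * y2 x) - (α * y1 x + β * y2 x)) (z0 := z0) (fun z => by
      have := (hy z).1
      have := (hy z).2
      have := hf.1 z
      fun_prop) (nhdsWithin_le_nhds (eventually_of_mem (isOpen_ball.mem_nhds m0) fun x hx => by
        have s0 : s x ≠ 0 := Complex.exp_ne_zero _
        rw [← e1 x hx, ← e2 x hx, sub_self])) z
    exact this.mono fun x hx => sub_eq_zero.1 hx

lemma CP.smul {P : Set CC} {q y1 y2 d1 d2 : CC → CC} {W κ : CC} (h : CP P q y1 y2 d1 d2 W) (hκ : κ ≠ 0) :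
    CP P q (fun z => κ * y1 z) y2 (fun z => κ * d1 z) d2 (κ * W) := by
  refine ⟨h.cl, fun z hz => ⟨(h.s1 z hz).1.const_mul κ, ((h.s1 z hz).2.const_mul κ).congr_deriv (by ring)⟩, h.s2, mul_ne_zero hκ h.W0,
    fun z hz => by rw [← h.wr z hz]; ring, fun p hp => ?_⟩
  obtain ⟨A, B, a, b, c, d⟩ := h.sg p hp
  refine ⟨fun z => κ * A z, B, analyticAt_const.mul a, b, c.imp_left (mul_ne_zero hκ), ?_⟩
  filter_upwards [d] with z ⟨e1, e2, e3⟩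
  exact ⟨e1, by rw [e2, mul_div_assoc], e3⟩

namespace PeriodPair
variable (L : PeriodPair) {a h : CC}

lemma noQ (ha : 2 * a ∉ L.lattice) (hq : ∀ w ∈ L.lattice, L.mu a (2 * w) ^ 2 = 1) : False := by
  have h1 : a ∉ L.lattice := fun H => ha (L.two_mem H)
  have h2 : -a ∉ L.lattice := by rwa [L.neg_mem_iff']
  obtain ⟨R, r1, r2⟩ := L.Y_l h1
  have r1' : AnalyticAt CC (fun z => R (-z)) 0 := AnalyticAt.comp' (by rwa [neg_zero]) (by fun_prop)
  have r2' := punct_neg (p := 0) (by rw [neg_zero]; exact r2)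
  have hs : AnalyticAt CC (fun z => (2 * R z - 2 * R (-z) + z ^ 2 * (R z ^ 2 - R (-z) ^ 2)) ^ 2) 0 := by
    have i : AnalyticAt CC (fun z : CC => z ^ 2) 0 := by fun_prop
    exact ((((analyticAt_const.mul r1).sub (analyticAt_const.mul r1')).add (i.mul ((r1.pow 2).sub (r1'.pow 2)))).pow 2)
  have he : (fun z => (L.Y a z ^ 2 - L.Y (-a) z ^ 2) ^ 2) =ᶠ[𝓝[≠] 0] fun z => (2 * R z - 2 * R (-z) + z ^ 2 * (R z ^ 2 - R (-z) ^ 2)) ^ 2 := by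
    filter_upwards [r2, r2', self_mem_nhdsWithin] with z e1 e2 e3
    have e3 : z ≠ 0 := e3
    rw [Y_neg, e1, e2]; field_simp; ring
  have han : ∀ z ∉ L.lattice, AnalyticAt CC (fun z => (L.Y a z ^ 2 - L.Y (-a) z ^ 2) ^ 2) z := fun z hz => by
    have := L.Y_an h1 hz
    have := L.Y_an h2 hz
    fun_prop
  obtain ⟨c, -, k⟩ := L.liouC L.disc (φ := fun z => (L.Y a z ^ 2 - L.Y (-a) z ^ 2) ^ 2) (fun w hw z hz => by
    have := hq w hw
    have m0 := L.mu_ne a w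
    rw [L.mu_two hw] at this
    rw [L.Y_add hw, L.Y_add hw, mu_neg]
    have e : (L.mu a w)⁻¹ = L.mu a w ^ 3 := by field_simp; linear_combination -this
    rw [e]
    linear_combination ((L.Y a z ^ 2 - L.Y (-a) z ^ 2) ^ 2 + 2 * L.mu a w ^ 4 * L.Y (-a) z ^ 2 * (L.Y (-a) z ^ 2 * (L.mu a w ^ 4 + 1) / 2 - L.Y a z ^ 2)) * this + (L.mu a w ^ 8 * (L.mu a w ^ 4 - 1)) * L.Y (-a) z ^ 4 - (L.mu a w ^ 8 * (L.mu a w ^ 4 - 1)) * L.Y (-a) z ^ 4) (fun p => by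
    by_cases hp : p ∈ L.lattice
    · exact ⟨-p, neg_mem hp, _, by rw [add_neg_cancel]; exact hs, by rw [add_neg_cancel]; exact he⟩
    · exact ⟨0, L.zero_mem', by rw [add_zero]; exact (han p hp).ext⟩)
  have k0 := k 0 _ hs.continuousAt he
  have k1 := k a _ (han a h1).continuousAt EventuallyEq.rfl
  have y0 : L.Y a a = 0 := (L.Y_zero_iff h1 h1).2 (by rw [sub_self]; exact L.zero_mem')
  have y1 : L.Y (-a) a ≠ 0 := fun H => ha (by have := (L.Y_zero_iff h2 h1).1 H; rwa [sub_neg_eq_add, ← two_mul] at this)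
  rw [← k0, y0] at k1
  simp [y1] at k1

lemma quad (ha : 2 * a ∉ L.lattice) {A B C : CC} (h : ∀ z, ∀ᶠ x in 𝓝[≠] z, A * L.Y a x ^ 2 + B * (L.Y a x * L.Y (-a) x) + C * L.Y (-a) x ^ 2 = 0) :
    A = 0 ∧ B = 0 ∧ C = 0 := by
  have h1 : a ∉ L.lattice := fun H => ha (L.two_mem H)
  have h2 : -a ∉ L.lattice := by rwa [L.neg_mem_iff']
  have k : ∀ z ∉ L.lattice, A * L.Y a z ^ 2 + B * (L.Y a z * L.Y (-a) z) + C * L.Y (-a) z ^ 2 = 0 := fun z hz => by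
    have := (L.Y_an h1 hz).continuousAt
    have := (L.Y_an h2 hz).continuousAt
    exact eq_of_punct (f := fun z => A * L.Y a z ^ 2 + B * (L.Y a z * L.Y (-a) z) + C * L.Y (-a) z ^ 2) (g := fun _ => 0) (by fun_prop) (by fun_prop) (h z)
  have y0 : L.Y a a = 0 := (L.Y_zero_iff h1 h1).2 (by rw [sub_self]; exact L.zero_mem')
  have y1 : L.Y (-a) a ≠ 0 := fun H => ha (by have := (L.Y_zero_iff h2 h1).1 H; rwa [sub_neg_eq_add, ← two_mul] at this)
  have y2 := L.Y_neg a a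
  have y3 := L.Y_neg a (-a)
  rw [neg_neg, y0, neg_zero] at y3
  have hC : C = 0 := by have := k a h1; simpa [y0, y1] using this
  have y4 : L.Y a (-a) ≠ 0 := fun H => y1 (by rw [y2, H, neg_zero])
  have hA : A = 0 := by have := k (-a) h2; simpa [y3, y4] using this
  obtain ⟨z, hz, hze⟩ := L.P_surj (℘[L] a + 1)
  refine ⟨hA, ?_, hC⟩
  have := k z hz
  rw [L.Y_mul h1 hz, hze, hA, hC] at this
  linear_combination this

lemma evenFam (hg : L.Good a) {f : CC → CC} (hm : ∀ z, MeromorphicAt f z) {α β γ δ : CC} (hdet : α * δ - β * γ ≠ 0)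
    (hr : ∀ z, ∀ᶠ x in 𝓝[≠] z, f x * (γ * L.Y a x + δ * L.Y (-a) x) = α * L.Y a x + β * L.Y (-a) x)
    (hII : ∀ w ∈ L.lattice, ∃ e : CC, ∀ z, f (z + 2 * w) = e * f z) :
    ∃ b : RR, IsDevelopingMapOf (uu (-℘'[L] a) (L.Y a) (L.Y (-a))) (fun z => (Real.exp b : CC) * f z) := by
  have ha := hg.1
  obtain ⟨w, hw, hw2⟩ : ∃ w ∈ L.lattice, L.mu a (2 * w) ^ 2 ≠ 1 := by
    by_contra! H; exact L.noQ ha H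
  obtain ⟨e, he⟩ := hII w hw
  set m := L.mu a (2 * w) with hm'
  have m0 : m ≠ 0 := L.mu_ne _ _
  obtain ⟨qA, qB, qC⟩ := L.quad ha (A := α * γ * m * (e - 1)) (B := e * (α * δ * m⁻¹ + β * γ * m) - (α * δ * m + β * γ * m⁻¹)) (C := β * δ * m⁻¹ * (e - 1)) (fun z => by
    filter_upwards [hr z, punct_add (hr (z + 2 * w))] with x e1 e2
    rw [he, L.Y_add (L.two_mem hw), L.Y_add (L.two_mem hw), mu_neg, ← hm'] at e2
    linear_combination (γ * L.Y a x + δ * L.Y (-a) x) * e2 - e * (γ * (m * L.Y a x) + δ * (m⁻¹ * L.Y (-a) x)) * e1)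
  have e1 : e - 1 ≠ 0 := fun H => by
    rw [sub_eq_zero.1 H] at qB
    have : (α * δ - β * γ) * (m⁻¹ - m) = 0 := by linear_combination qB
    rcases mul_eq_zero.1 this with h | h
    · exact hdet h
    · field_simp at h
      exact hw2 (by linear_combination -h)
  have bd : ∀ κ : CC, κ ≠ 0 → ‖((Real.exp (-Real.log ‖κ‖) : RR) : CC) * κ‖ = 1 := fun κ hκ => by
    have := norm_pos_iff.2 hκ
    rw [norm_mul, Complex.norm_real, Real.norm_eq_abs, abs_of_pos (Real.exp_pos _), Real.exp_neg, Real.exp_log this, inv_mul_cancel₀ this.ne']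
  have fm : ∀ b : RR, ∀ z, MeromorphicAt (fun z => (Real.exp b : CC) * f z) z := fun b z => by
    have := hm z; fun_prop
  by_cases hα : α = 0
  · have hβ : β ≠ 0 := fun H => hdet (by rw [hα, H]; ring)
    have hγ : γ ≠ 0 := fun H => hdet (by rw [hα, H]; ring)
    have hδ : δ = 0 := by simpa [hβ, m0, e1] using qC
    have hk := div_ne_zero hβ hγ
    set κ := ((Real.exp (-Real.log ‖β / γ‖) : RR) : CC) * (β / γ) with hκ
    have k1 : ‖κ‖ = 1 := bd _ hk
    have cp := (L.CP_Y (a := -a) (by rwa [mul_neg, L.neg_mem_iff'])).smul (κ := κ) (fun H => by rw [H] at k1; simp at k1)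
    refine ⟨-Real.log ‖β / γ‖, ?_⟩
    have := dev cp (fm (-Real.log ‖β / γ‖)) (fun z => by
      filter_upwards [hr z] with x hx
      rw [neg_neg, hκ]; rw [hα, hδ] at hx; field_simp; linear_combination hx)
    convert this using 1
    funext z
    simp only [uu, norm_mul, norm_neg, k1, derivWeierstrassP_neg, neg_neg, one_mul]
    rw [add_comm (‖L.Y a z‖ ^ 2)]
  · have hγ : γ = 0 := by simpa [hα, m0, e1] using qA
    have hδ : δ ≠ 0 := fun H => hdet (by rw [hγ, H]; ring)
    have hβ : β = 0 := by simpa [hδ, m0, e1] using qC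
    have hk := div_ne_zero hα hδ
    set κ := ((Real.exp (-Real.log ‖α / δ‖) : RR) : CC) * (α / δ) with hκ
    have k1 : ‖κ‖ = 1 := bd _ hk
    have cp := (L.CP_Y ha).smul (κ := κ) (fun H => by rw [H] at k1; simp at k1)
    refine ⟨-Real.log ‖α / δ‖, ?_⟩
    have := dev cp (fm (-Real.log ‖α / δ‖)) (fun z => by
      filter_upwards [hr z] with x hx
      rw [hκ]; rw [hγ, hβ] at hx; field_simp; linear_combination hx)
    convert this using 1
    funext z
    simp only [uu, norm_mul, k1, one_mul]

lemma devEven (hg : L.Good a) {u : CC → RR} {f : CC → CC} (hf : IsDevelopingMapOf u f) (hQ : ∀ z ∉ L.lattice, Qp u z = 2 * ℘[L] z + ℘[L] a)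
    (hII : ∀ w ∈ L.lattice, ∃ e : CC, ∀ z, f (z + 2 * w) = e * f z) :
    ∃ b : RR, IsDevelopingMapOf (uu (-℘'[L] a) (L.Y a) (L.Y (-a))) (fun z => (Real.exp b : CC) * f z) := by
  by_cases H : ∃ z, AnalyticAt CC f z ∧ deriv f z ≠ 0
  · obtain ⟨z, h1, h2⟩ := H
    obtain ⟨α, β, γ, δ, hd, hr⟩ := mob (L.CP_Y hg.1) L.disc hQ hf (fun z => ⟨L.Y_mer hg.nm z, L.Y_mer (by rw [L.neg_mem_iff']; exact hg.nm) z⟩) h1 h2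
    exact L.evenFam hg hf.1 hd hr hII
  · refine ⟨0, ?_⟩
    simp only [Real.exp_zero, Complex.ofReal_one, one_mul]
    exact ⟨hf.1, fun z h1 h2 => absurd ⟨z, h1, h2⟩ H⟩
end PeriodPair

namespace PeriodPair
variable (L : PeriodPair) {a h : CC}

def hf : PeriodPair where
  ω₁ := L.ω₁ / 2
  ω₂ := L.ω₂
  indep := by
    refine LinearIndependent.pair_iff.2 fun s t e => ?_
    have := LinearIndependent.pair_iff.mp L.indep (s / 2) t (by rw [← e]; simp; ring)
    exact ⟨by linarith [this.1], this.2⟩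

lemma hf_mem {z : CC} : z ∈ L.hf.lattice ↔ z ∈ L.PS (L.ω₁ / 2) := by
  simp only [PS, mem_setOf_eq, mem_lattice, hf]
  constructor
  · rintro ⟨m, n, rfl⟩
    rcases Int.even_or_odd' m with ⟨k, rfl | rfl⟩
    · left; exact ⟨k, n, by push_cast; ring⟩
    · right; exact ⟨k, n, by push_cast; ring⟩
  · rintro (⟨m, n, e⟩ | ⟨m, n, e⟩)
    · exact ⟨2 * m, n, by rw [← e]; push_cast; ring⟩
    · exact ⟨2 * m + 1, n, by push_cast; linear_combination e⟩
lemma hf_eq : (L.hf.lattice : Set CC) = L.PS (L.ω₁ / 2) := Set.ext fun _ => L.hf_mem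
lemma hf_two {w : CC} (hw : w ∈ L.hf.lattice) : 2 * w ∈ L.lattice := by
  obtain ⟨m, n, rfl⟩ := mem_lattice.1 hw
  exact mem_lattice.2 ⟨m, 2 * n, by simp only [hf]; push_cast; ring⟩
lemma hf_le {w : CC} (hw : w ∈ L.lattice) : w ∈ L.hf.lattice := L.hf_mem.2 (Or.inl hw)

lemma hfP : ∃ K, ∀ z ∉ L.PS (L.ω₁ / 2), ℘[L] z + ℘[L] (z - L.ω₁ / 2) = ℘[L.hf] z + K := by
  set h := L.ω₁ / 2 with hh0
  have hh : h ∉ L.lattice := L.h1_mem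
  have hm : h ∈ L.hf.lattice := L.hf.ω₁_mem_lattice
  obtain ⟨γ, hγ, ev⟩ := L.P_l
  obtain ⟨δ, hδ, ev'⟩ := L.hf.P_l
  have hh' : (0:CC) - h ∉ L.lattice := by rwa [zero_sub, L.neg_mem_iff']
  have evh : ∀ᶠ z in 𝓝[≠] h, ℘[L] (z + -h) = 1 / (z + -h) ^ 2 + (z + -h) ^ 2 * γ (z + -h) :=
    punct_add (P := fun z => ℘[L] z = 1 / z ^ 2 + z ^ 2 * γ z) (by rw [add_neg_cancel]; exact ev)
  have evh' : ∀ᶠ z in 𝓝[≠] h, ℘[L.hf] (z + -h) = 1 / (z + -h) ^ 2 + (z + -h) ^ 2 * δ (z + -h) :=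
    punct_add (P := fun z => ℘[L.hf] z = 1 / z ^ 2 + z ^ 2 * δ z) (by rw [add_neg_cancel]; exact ev')
  obtain ⟨K, -, hK⟩ := L.liouC L.PS_disc (S := L.PS h) (φ := fun z => ℘[L] z + ℘[L] (z - h) - ℘[L.hf] z) (fun w hw z _ => by
      rw [L.P_add hw, show z + w - h = z - h + w by ring, L.P_add hw, L.hf.P_add (L.hf_le hw)]) fun p => by
    by_cases hp : p ∈ L.lattice
    · refine ⟨-p, neg_mem hp, fun z => z ^ 2 * γ z - z ^ 2 * δ z + ℘[L] (z - h), ?_, ?_⟩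
      · rw [add_neg_cancel]
        have := L.Pc_an hh'
        fun_prop
      · rw [add_neg_cancel]
        filter_upwards [ev, ev'] with z e1 e2
        rw [e1, e2]; ring
    by_cases hp' : p - h ∈ L.lattice
    · refine ⟨-(p - h), neg_mem hp', fun z => (z - h) ^ 2 * γ (z - h) - (z - h) ^ 2 * δ (z - h) + ℘[L] z, ?_, ?_⟩
      · rw [show p + -(p - h) = h by ring]
        have := L.P_an hh
        have g1 : AnalyticAt CC (fun z => γ (z - h)) h := AnalyticAt.comp' (by rwa [sub_self]) (by fun_prop)
        have g2 : AnalyticAt CC (fun z => δ (z - h)) h := AnalyticAt.comp' (by rwa [sub_self]) (by fun_prop)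
        have k : AnalyticAt CC (fun z => z - h) h := by fun_prop
        exact (((k.pow 2).mul g1).sub ((k.pow 2).mul g2)).add this
      · rw [show p + -(p - h) = h by ring]
        filter_upwards [evh, evh'] with z e1 e2
        rw [L.hf.P_add (neg_mem hm)] at e2
        rw [← sub_eq_add_neg] at e1 e2
        rw [e1, e2]; ring
    · refine ⟨0, L.zero_mem', ?_⟩
      rw [add_zero]
      have := L.P_an hp
      have := L.Pc_an hp'
      have := L.hf.P_an (z := p) (by rw [hf_mem]; exact not_or.2 ⟨hp, hp'⟩)
      exact AnalyticAt.ext (by fun_prop)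
  refine ⟨K, fun z hz => ?_⟩
  have hz' := not_or.1 hz
  have q1 := L.P_an hz'.1
  have q2 := L.Pc_an hz'.2
  have q3 := L.hf.P_an (z := z) (by rwa [hf_mem])
  have := hK z _ (by fun_prop) EventuallyEq.rfl
  linear_combination this

theorem partC {u : CC → RR} {f : CC → CC} (hu : CS L.lattice (L.PS (L.ω₁ / 2)) u) (hd : IsDevelopingMapOf u f)
    (hII : ∀ w ∈ L.lattice, ∃ e : CC, ∀ z, f (z + w) = e * f z)
    (hne : ¬ ∃ (β : RR) (v : CC → RR), CS L.lattice (L.PS (L.ω₁ / 2)) v ∧ IsDevelopingMapOf v (fun z => (Real.exp β : CC) * f z) ∧ ∀ z, v (-z) = v z) :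
    ∃ a, L.Good a := by
  have hh : L.ω₁ / 2 ∉ L.lattice := L.h1_mem
  have h2 : 2 * (L.ω₁ / 2) ∈ L.lattice := by rw [mul_div_cancel₀ _ two_ne_zero]; exact L.ω₁_mem_lattice
  rcases L.Cglob hh h2 hu with ⟨E, hE⟩ | ⟨lam, hl⟩
  · exfalso
    obtain ⟨K, hK⟩ := L.hfP
    obtain ⟨a, ha, haB⟩ := L.hf.lameFin (u := u) (B := 2 * K + E) (fun z hz => hu.liou (by rwa [hf_mem] at hz)) (fun w hw z => hu.1 _ (L.hf_two hw) z)
      (fun z hz => by rw [hf_mem] at hz; rw [hE z hz]; linear_combination 2 * hK z hz)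
    obtain ⟨b, hb⟩ := L.hf.devEven ha hd (fun z hz => by rw [hf_mem] at hz; rw [haB, hE z hz]; linear_combination 2 * hK z hz)
      (fun w hw => hII _ (L.hf_two hw))
    refine hne ⟨b, _, ?_, hb, fun z => L.hf.uu_even _ z⟩
    have := L.hf.partD ha
    rw [hf_eq] at this
    exact ⟨fun w hw => this.1 w (Or.inl hw), this.2⟩
  · obtain ⟨a, ha, e⟩ := L.P_surj (lam ^ 2 - 2 * ℘[L] (L.ω₁ / 2))
    exact ⟨a, L.darbG hh h2 ha e hu hl⟩
end PeriodPair

lemma CP.mer {P : Set CC} {q y1 y2 d1 d2 : CC → CC} {W : CC} (h : CP P q y1 y2 d1 d2 W) (z : CC) : MeromorphicAt y1 z ∧ MeromorphicAt y2 z := by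
  by_cases hz : z ∈ P
  · obtain ⟨A, B, a, b, -, ev⟩ := h.sg z hz
    have k : MeromorphicAt (fun x => x - z) z := by fun_prop
    exact ⟨(a.meromorphicAt.div k).congr (ev.mono fun _ h => h.2.1.symm), (b.meromorphicAt.div k).congr (ev.mono fun _ h => h.2.2.symm)⟩
  · exact ⟨(h.s1.an h.cl.isOpen_compl hz).meromorphicAt, (h.s2.an h.cl.isOpen_compl hz).meromorphicAt⟩

lemma CP.out {P : Set CC} {q y1 y2 d1 d2 : CC → CC} {W : CC} (h : CP P q y1 y2 d1 d2 W) (z : CC) : ∀ᶠ x in 𝓝[≠] z, x ∉ P := by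
  by_cases hz : z ∈ P
  · obtain ⟨A, B, a, b, -, ev⟩ := h.sg z hz
    exact ev.mono fun _ h => h.1
  · exact nhdsWithin_le_nhds (h.cl.isOpen_compl.mem_nhds hz)

lemma CP.ne {P : Set CC} {q y1 y2 d1 d2 : CC → CC} {W : CC} (h : CP P q y1 y2 d1 d2 W) (z : CC) : ∀ᶠ x in 𝓝[≠] z, y2 x ≠ 0 := by
  rcases (h.mer z).2.eventually_eq_zero_or_eventually_ne_zero with H | H
  · obtain ⟨x, hx, hxP⟩ := ((ev_pp H).and (h.out z)).exists
    have d0 : d2 x = 0 := (h.s2 x hxP).1.unique ((hasDerivAt_const x (0:CC)).congr_of_eventuallyEq hx)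
    exact absurd (by rw [← h.wr x hxP, d0, hx.self_of_nhds]; ring) h.W0
  · exact H

lemma CP.devq {P : Set CC} {q y1 y2 d1 d2 : CC → CC} {W : CC} (h : CP P q y1 y2 d1 d2 W) : IsDevelopingMapOf (uu W y1 y2) (fun z => y1 z / y2 z) :=
  dev h (fun z => (h.mer z).1.div (h.mer z).2) fun z => (h.ne z).mono fun x hx => div_mul_cancel₀ _ hx

lemma CP.eqd {P : Set CC} {q y1 y2 d1 d2 : CC → CC} {W : CC} (h : CP P q y1 y2 d1 d2 W) {v : CC → RR} {g : CC → CC} (hg : g = fun z => y1 z / y2 z)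
    (hv : IsDevelopingMapOf v g) (p : CC) :
    ∀ᶠ z in 𝓝[≠] p, v z = uu W y1 y2 z := by
  subst hg
  filter_upwards [h.ne p, h.out p] with x hx hxP
  have a1 := h.s1.an h.cl.isOpen_compl hxP
  have a2 := h.s2.an h.cl.isOpen_compl hxP
  have d : HasDerivAt (fun z => y1 z / y2 z) (-W / y2 x ^ 2) x :=
    ((h.s1 x hxP).1.div (h.s2 x hxP).1 hx).congr_deriv (by rw [← h.wr x hxP]; ring)
  have n : deriv (fun z => y1 z / y2 z) x ≠ 0 := by rw [d.deriv]; exact div_ne_zero (neg_ne_zero.2 h.W0) (pow_ne_zero _ hx)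
  rw [hv.2 x (a1.div a2 hx) n, h.devq.2 x (a1.div a2 hx) n]

lemma noEven {A B : CC → CC} {lam : CC} {κ : RR} (hA : HasDerivAt A lam 0) (hB : HasDerivAt B lam 0) (A0 : A 0 = -1) (B0 : B 0 = -1)
    (he : ∀ᶠ z in 𝓝[≠] (0:CC), κ ^ 2 * ‖A (-z)‖ ^ 2 + ‖B (-z)‖ ^ 2 = κ ^ 2 * ‖A z‖ ^ 2 + ‖B z‖ ^ 2) : lam = 0 := by
  set c : CC := conj lam with hc
  have key : ∀ {A : CC → CC}, HasDerivAt A lam 0 → A 0 = -1 → HasDerivAt (fun t : RR => ‖A (t * c)‖ ^ 2) (-2 * ‖lam‖ ^ 2) 0 := fun {A} hA A0 => by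
    have h1 : HasDerivAt (fun t : RR => (t : CC) * c) c 0 := by
      simpa using (Complex.ofRealCLM.hasDerivAt (x := (0:RR))).mul_const c
    have h2 : HasDerivAt (fun t : RR => A (t * c)) (lam * c) 0 := by
      have : HasDerivAt A lam ((0:RR) * c) := by simpa using hA
      exact this.comp (0:RR) h1
    refine h2.norm_sq.congr_deriv ?_
    rw [show A (((0:RR):CC) * c) = -1 by simpa using A0, hc, Complex.mul_conj, Complex.inner, Complex.normSq_eq_norm_sq]
    simp [← Complex.ofReal_pow]
  have d := ((key hA A0).const_mul (κ ^ 2)).add (key hB B0)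
  set φ : RR → RR := fun t => κ ^ 2 * ‖A (t * c)‖ ^ 2 + ‖B (t * c)‖ ^ 2 with hφ
  have d' : HasDerivAt φ (κ ^ 2 * (-2 * ‖lam‖ ^ 2) + -2 * ‖lam‖ ^ 2) 0 := d
  have he' : ∀ᶠ z in 𝓝 (0:CC), κ ^ 2 * ‖A (-z)‖ ^ 2 + ‖B (-z)‖ ^ 2 = κ ^ 2 * ‖A z‖ ^ 2 + ‖B z‖ ^ 2 := by
    rw [eventually_nhdsWithin_iff] at he
    filter_upwards [he] with z hz
    by_cases h : z = 0
    · simp [h]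
    · exact hz h
  have ev : ∀ᶠ t : RR in 𝓝 0, φ (-t) = φ t := by
    have ct : Tendsto (fun t : RR => (t : CC) * c) (𝓝 0) (𝓝 0) := by
      have : Continuous (fun t : RR => (t : CC) * c) := by fun_prop
      simpa using this.tendsto 0
    filter_upwards [ct.eventually he'] with t ht
    simp only [hφ]; push_cast; rw [neg_mul]; exact ht
  have d'' : HasDerivAt (fun t => φ (-t)) (-(κ ^ 2 * (-2 * ‖lam‖ ^ 2) + -2 * ‖lam‖ ^ 2)) 0 := by
    have : HasDerivAt φ (κ ^ 2 * (-2 * ‖lam‖ ^ 2) + -2 * ‖lam‖ ^ 2) (-0) := by rwa [neg_zero]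
    exact (this.comp (0:RR) (hasDerivAt_neg (0:RR))).congr_deriv (by ring)
  have := d''.unique (d'.congr_of_eventuallyEq ev)
  have h3 : (κ ^ 2 + 1) * ‖lam‖ ^ 2 = 0 := by linarith
  have h4 : κ ^ 2 + 1 ≠ 0 := by positivity
  simpa [h4] using h3

namespace PeriodPair
variable (L : PeriodPair) {a h : CC}

def yt (h lam a z : CC) : CC := lam / L.Y h z * L.Y a z + 1 / L.Y h z * L.Y1 a z

lemma yt_loc {lam p : CC} {R S : CC → CC} (hR : AnalyticAt CC R p) (hS : AnalyticAt CC S p) (S0 : S p ≠ 0)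
    (e1 : ∀ᶠ z in 𝓝[≠] p, L.Y a z = R z / (z - p)) (e2 : ∀ᶠ z in 𝓝[≠] p, L.Y h z = S z / (z - p)) :
    ∃ A, AnalyticAt CC A p ∧ A p = -R p / S p ∧ HasDerivAt A ((lam * R p * S p + R p * deriv S p) / S p ^ 2) p ∧
      ∀ᶠ z in 𝓝[≠] p, L.yt h lam a z = A z / (z - p) := by
  have k : AnalyticAt CC (fun z => z - p) p := by fun_prop
  have hR' := hR.deriv
  refine ⟨fun z => ((lam * R z + deriv R z) * (z - p) - R z) / S z, ?_, by simp, ?_, ?_⟩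
  · exact ((((analyticAt_const.mul hR).add hR').mul k).sub hR).div hS S0
  · refine (((((hR.differentiableAt.hasDerivAt.const_mul lam).add hR'.differentiableAt.hasDerivAt).mul ((hasDerivAt_id p).sub_const p)).sub
      hR.differentiableAt.hasDerivAt).div hS.differentiableAt.hasDerivAt S0).congr_deriv ?_
    simp
  · have hRa : ∀ᶠ x in 𝓝[≠] p, AnalyticAt CC R x := hR.eventually_analyticAt.filter_mono nhdsWithin_le_nhds
    have hSn : ∀ᶠ x in 𝓝[≠] p, S x ≠ 0 := (hS.continuousAt.eventually_ne S0).filter_mono nhdsWithin_le_nhds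
    filter_upwards [ev_pp e1, e2, hRa, hSn, self_mem_nhdsWithin] with z a1 a2 a3 a4 a5
    have nz : z - p ≠ 0 := sub_ne_zero.2 a5
    have a1' : L.Y a =ᶠ[𝓝 z] fun z => R z / (z - p) := a1
    have y1 : L.Y1 a z = (deriv R z * (z - p) - R z) / (z - p) ^ 2 := by
      rw [Y1, a1'.deriv_eq]
      have := a3.differentiableAt.hasDerivAt.div ((hasDerivAt_id z).sub_const p) nz
      exact (this.congr_deriv (by simp)).deriv
    rw [yt, y1, a2, a1'.self_of_nhds]
    field_simp; ring

lemma CP_yt (hh : h ∉ L.lattice) (h2 : 2 * h ∈ L.lattice) {lam : CC} (ha : 2 * a ∉ L.lattice) (hB : ℘[L] a = lam ^ 2 - 2 * ℘[L] h) :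
    CP (L.PS h) (L.dQ h lam) (L.yt h lam a) (L.yt h lam (-a)) (fun z => L.dγ h lam z * L.Y a z + L.dδ h lam z * L.Y1 a z)
      (fun z => L.dγ h lam z * L.Y (-a) z + L.dδ h lam z * L.Y1 (-a) z) (2 * ℘'[L] a) := by
  have c := L.CP_Y ha
  have h1 : a ∉ L.lattice := fun H => ha (L.two_mem H)
  have h1' : -a ∉ L.lattice := by rwa [L.neg_mem_iff']
  have sub : (L.PS h)ᶜ ⊆ (L.lattice : Set CC)ᶜ := fun z hz H => hz (Or.inl H)
  refine ⟨L.PS_closed, L.darb hh h2 hB subset_rfl (fun z hz => c.s1 z (sub hz)), L.darb hh h2 hB subset_rfl (fun z hz => c.s2 z (sub hz)),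
    mul_ne_zero two_ne_zero (L.Pd_ne h1 ha), fun z hz => ?_, fun p hp => ?_⟩
  · obtain ⟨n, -⟩ := L.Yh_d hh hz
    have w := c.wr z (sub hz)
    simp only [yt, dγ, dδ]
    field_simp
    linear_combination -2 * L.Y h z ^ 2 * w
  rcases hp with hp | hp
  · obtain ⟨R, r1, r2, r3⟩ := L.Y_loc h1 hp
    obtain ⟨T, t1, t2, t3⟩ := L.Y_loc h1' hp
    obtain ⟨S, s1, s2, s3⟩ := L.Y_loc hh hp
    obtain ⟨A, a1, a2, -, a3⟩ := L.yt_loc (lam := lam) r1 s1 s2 r3 s3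
    obtain ⟨B, b1, b2, -, b3⟩ := L.yt_loc (lam := lam) t1 s1 s2 t3 s3
    refine ⟨A, B, a1, b1, Or.inl (by rw [a2]; exact div_ne_zero (neg_ne_zero.2 r2) s2), ?_⟩
    filter_upwards [a3, b3, L.PS_disc p] with z e1 e2 e3 using ⟨e3, e1, e2⟩
  · have hpn : p ∉ L.lattice := fun H => hh (by have := sub_mem H hp; rwa [sub_sub_cancel] at this)
    obtain ⟨d, d0, hd⟩ := L.Y_shift hh h2
    obtain ⟨R, r1, r2, r3⟩ := L.Y_loc hh hp
    have r1' : AnalyticAt CC (fun z => R (z - h)) p := AnalyticAt.comp' r1 (by fun_prop)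
    rw [sub_eq_add_neg] at r3
    have r3' := punct_add r3
    have y1 := L.Y_an h1 hpn
    have y2 := L.Y_an h1' hpn
    have y3 := L.Y1_an h1 hpn
    have y4 := L.Y1_an h1' hpn
    have w := c.wr p hpn
    refine ⟨fun z => (lam * L.Y a z + L.Y1 a z) * (R (z - h) / d), fun z => (lam * L.Y (-a) z + L.Y1 (-a) z) * (R (z - h) / d),
      ((analyticAt_const.mul y1).add y3).mul (r1'.div analyticAt_const d0), ((analyticAt_const.mul y2).add y4).mul (r1'.div analyticAt_const d0), ?_, ?_⟩
    · by_contra! H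
      have n : R (p - h) / d ≠ 0 := div_ne_zero r2 d0
      have H1 := (mul_eq_zero.1 H.1).resolve_right n
      have H2 := (mul_eq_zero.1 H.2).resolve_right n
      exact c.W0 (by rw [← w]; linear_combination L.Y a p * H2 - L.Y (-a) p * H1)
    · filter_upwards [r3', L.PS_disc p, self_mem_nhdsWithin] with z e1 e2 e3
      have nz : z - p ≠ 0 := sub_ne_zero.2 e3
      have e2' := not_or.1 e2
      obtain ⟨n, -⟩ := L.Yh_d hh e2
      have e4 := hd z e2'.1 e2'.2
      rw [← sub_eq_add_neg, show z - h - (p + -h) = z - p by ring] at e1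
      have e5 : 1 / L.Y h z = R (z - h) / d / (z - p) := by
        rw [e1] at e4; rw [← e4] at d0 ⊢
        have : R (z - h) ≠ 0 := fun H => d0 (by rw [H]; ring)
        field_simp
      have e6 : ∀ a, L.yt h lam a z = (lam * L.Y a z + L.Y1 a z) * (R (z - h) / d) / (z - p) := fun a => by
        rw [yt, div_eq_mul_one_div lam, e5]; ring
      exact ⟨e2, e6 a, e6 (-a)⟩

lemma yt_add {lam w : CC} (hw : w ∈ L.lattice) (z : CC) : L.yt h lam a (z + w) = L.mu a w / L.mu h w * L.yt h lam a z := by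
  simp only [yt, L.Y_add hw, L.Y1_add hw]
  have := L.mu_ne h w
  by_cases h0 : L.Y h z = 0
  · simp [h0]
  · field_simp

lemma yt_0 {lam : CC} (ha : a ∉ L.lattice) (hh : h ∉ L.lattice) :
    ∃ A, HasDerivAt A lam 0 ∧ A 0 = -1 ∧ ∀ᶠ z in 𝓝[≠] 0, L.yt h lam a z = A z / z := by
  obtain ⟨R, r1, r2⟩ := L.Y_l ha
  obtain ⟨S, s1, s2⟩ := L.Y_l hh
  have k : ∀ {R : CC → CC}, AnalyticAt CC R 0 → AnalyticAt CC (fun z => 1 + z ^ 2 * R z) 0 := fun hR => by fun_prop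
  have k2 : ∀ {R : CC → CC} {a : CC}, (∀ᶠ z in 𝓝[≠] 0, L.Y a z = 1 / z + z * R z) → ∀ᶠ z in 𝓝[≠] 0, L.Y a z = (1 + z ^ 2 * R z) / (z - 0) := fun h => by
    filter_upwards [h, self_mem_nhdsWithin] with z e1 e2
    have e2 : z ≠ 0 := e2
    rw [e1, sub_zero]; field_simp
  obtain ⟨A, -, a2, a3, a4⟩ := L.yt_loc (lam := lam) (k r1) (k s1) (by simp) (k2 r2) (k2 s2)
  have dS : deriv (fun z => 1 + z ^ 2 * S z) 0 = 0 := by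
    have := ((((hasDerivAt_id (0:CC)).pow 2).mul s1.differentiableAt.hasDerivAt).const_add 1).deriv
    simpa using this
  rw [dS] at a3
  exact ⟨A, by simpa using a3, by simpa using a2, by simpa using a4⟩

theorem partB (hg : L.Good a) : ∃ u f, CS L.lattice (L.PS (L.ω₁ / 2)) u ∧ IsDevelopingMapOf u f ∧
    (∀ w ∈ L.lattice, ∃ e : CC, ‖e‖ = 1 ∧ ∀ z, f (z + w) = e * f z) ∧
    ¬ ∃ (β : RR) (v : CC → RR), CS L.lattice (L.PS (L.ω₁ / 2)) v ∧ IsDevelopingMapOf v (fun z => (Real.exp β : CC) * f z) ∧ ∀ z, v (-z) = v z := by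
  have hh : L.ω₁ / 2 ∉ L.lattice := L.h1_mem
  have h2 : 2 * (L.ω₁ / 2) ∈ L.lattice := by rw [mul_div_cancel₀ _ two_ne_zero]; exact L.ω₁_mem_lattice
  have ex := L.excl hg
  set h := L.ω₁ / 2 with hh0
  obtain ⟨lam, hlam⟩ := IsAlgClosed.exists_pow_nat_eq (℘[L] a + 2 * ℘[L] h) (n := 2) (by norm_num)
  have l0 : lam ≠ 0 := by
    rintro rfl
    exact ex (by linear_combination -hlam)
  have hB : ℘[L] a = lam ^ 2 - 2 * ℘[L] h := by linear_combination -hlam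
  have cp := L.CP_yt hh h2 hg.1 hB
  have nh : ∀ w ∈ L.lattice, ‖L.mu h w‖ = 1 := fun w hw => by
    have := congrArg norm (L.mu_half hh h2 hw)
    rw [norm_pow, norm_one] at this
    nlinarith [norm_nonneg (L.mu h w)]
  refine ⟨_, _, constr cp fun w hw z => ?_, cp.devq, fun w hw => ⟨L.mu a w ^ 2, ?_, fun z => ?_⟩, ?_⟩
  · rw [L.yt_add hw, L.yt_add hw, mu_neg, norm_mul, norm_mul, norm_div, norm_div, norm_inv, hg.2 w hw, nh w hw]; simp
  · rw [norm_pow, hg.2 w hw, one_pow]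
  · simp only [L.yt_add hw, mu_neg]
    have := L.mu_ne a w
    have := L.mu_ne h w
    by_cases h0 : L.yt h lam (-a) z = 0
    · simp [h0]
    · field_simp
  · rintro ⟨β, v, -, hv, hev⟩
    have hk : (Real.exp β : CC) ≠ 0 := by exact_mod_cast (Real.exp_pos β).ne'
    have cp' := cp.smul hk
    have ev := cp'.eqd (by funext z; rw [mul_div_assoc]) hv 0
    obtain ⟨A, dA, A0, eA⟩ := L.yt_0 (lam := lam) hg.nm hh
    obtain ⟨B, dB, B0, eB⟩ := L.yt_0 (a := -a) (lam := lam) (by rw [L.neg_mem_iff']; exact hg.nm) hh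
    have eu : ∀ᶠ z in 𝓝[≠] (0:CC), ∃ n : RR, 0 < n ∧ n = ‖(Real.exp β : CC) * L.yt h lam a z‖ ^ 2 + ‖L.yt h lam (-a) z‖ ^ 2 ∧
        n * ‖z‖ ^ 2 = Real.exp β ^ 2 * ‖A z‖ ^ 2 + ‖B z‖ ^ 2 ∧ v z = Real.log (8 * ‖(Real.exp β : CC) * (2 * ℘'[L] a)‖ ^ 2 / n ^ 2) := by
      filter_upwards [ev, eA, eB, cp.ne 0, self_mem_nhdsWithin] with z e1 e2 e3 e4 e5
      have e5 : 0 < ‖z‖ := norm_pos_iff.2 e5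
      refine ⟨_, by have := norm_pos_iff.2 e4; positivity, rfl, ?_, e1⟩
      rw [e2, e3, norm_mul, norm_div, norm_div, Complex.norm_real, Real.norm_eq_abs, abs_of_pos (Real.exp_pos β)]; field_simp
    have eu' := punct_neg (p := 0) (by rw [neg_zero]; exact eu)
    refine l0 (noEven (κ := Real.exp β) dA dB A0 B0 ?_)
    filter_upwards [eu, eu', self_mem_nhdsWithin] with z ⟨n, n0, _, n1, n2⟩ ⟨m, m0, _, m1, m2⟩ e5
    rw [norm_neg] at m1
    rw [← m1, ← n1]
    congr 1
    rw [hev, n2] at m2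
    have K : 0 < ‖(Real.exp β : CC) * (2 * ℘'[L] a)‖ := norm_pos_iff.2 cp'.W0
    have := Real.log_injOn_pos (mem_Ioi.2 (by positivity)) (mem_Ioi.2 (by positivity)) m2
    have h3 : n ^ 2 = m ^ 2 := by
      rw [div_eq_div_iff (by positivity) (by positivity)] at this
      exact (mul_left_cancel₀ (by positivity) this).symm
    exact ((pow_left_inj₀ n0.le m0.le two_ne_zero).1 h3).symm
end PeriodPair

lemma lat_lin {τ : CC} (hτ : 0 < τ.im) {x y : RR} (h : (x : CC) + y * τ = 0) : x = 0 ∧ y = 0 := by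
  have h1 := congrArg Complex.im h
  have h2 := congrArg Complex.re h
  simp [hτ.ne'] at h1
  subst h1
  simp at h2
  exact ⟨h2, rfl⟩

lemma exL {τ : CC} (hτ : 0 < τ.im) {k : ℕ} (hk : k = 1 ∨ k = 2 ∨ k = 3) :
    ∃ L : PeriodPair, L.ω₁ = per τ k ∧ ∀ z, z ∈ L.lattice ↔ z ∈ lat τ := by
  rcases hk with rfl | rfl | rfl
  · refine ⟨⟨1, τ, LinearIndependent.pair_iff.2 fun s t e => lat_lin hτ (by simpa using e)⟩, rfl, fun z => ?_⟩
    rw [PeriodPair.mem_lattice]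
    exact ⟨fun ⟨m, n, e⟩ => ⟨m, n, by rw [← e]; ring⟩, fun ⟨m, n, e⟩ => ⟨m, n, by rw [e]; ring⟩⟩
  · refine ⟨⟨τ, 1, LinearIndependent.pair_iff.2 fun s t e => (lat_lin hτ (x := t) (y := s) (by rw [← e]; simp; ring)).symm⟩, rfl, fun z => ?_⟩
    rw [PeriodPair.mem_lattice]
    exact ⟨fun ⟨m, n, e⟩ => ⟨n, m, by rw [← e]; ring⟩, fun ⟨m, n, e⟩ => ⟨n, m, by rw [e]; ring⟩⟩
  · refine ⟨⟨1 + τ, τ, LinearIndependent.pair_iff.2 fun s t e => ?_⟩, rfl, fun z => ?_⟩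
    · have := lat_lin hτ (x := s) (y := s + t) (by rw [← e]; simp; ring)
      exact ⟨this.1, by linarith [this.1, this.2]⟩
    rw [PeriodPair.mem_lattice]
    exact ⟨fun ⟨m, n, e⟩ => ⟨m, m + n, by rw [← e]; push_cast; ring⟩, fun ⟨m, n, e⟩ => ⟨m, n - m, by rw [e]; push_cast; ring⟩⟩

lemma mult {f : CC → CC} {c e : CC} (he : e ≠ 0) (h : ∀ z, f (z + c) = e * f z) (n : ℤ) : ∀ z, f (z + n * c) = e ^ n * f z := by
  induction n using Int.induction_on with
  | zero => simp
  | succ i ih => intro z; rw [show z + ((i + 1 : ℤ) : CC) * c = z + (i : ℤ) * c + c by push_cast; ring, h, ih, zpow_add_one₀ he]; ring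
  | pred i ih =>
    intro z
    have := h (z + ((-i - 1 : ℤ) : CC) * c)
    rw [show z + ((-i - 1 : ℤ) : CC) * c + c = z + (-i : ℤ) * c by push_cast; ring, ih] at this
    rw [zpow_sub_one₀ he]
    field_simp
    rw [this]; ring

lemma per_of {τ : CC} {u : CC → RR} (h1 : ∀ z, u (z + 1) = u z) (h2 : ∀ z, u (z + τ) = u z) : ∀ w ∈ lat τ, ∀ z, u (z + w) = u z := by
  rintro w ⟨m, n, rfl⟩ z
  have p1 : Function.Periodic u 1 := h1
  have p2 : Function.Periodic u τ := h2
  rw [← add_assoc, p2.int_mul n, ← mul_one (m : CC), p1.int_mul m]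

lemma one_lat (τ : CC) : (1:CC) ∈ lat τ := ⟨1, 0, by simp⟩
lemma tau_lat (τ : CC) : τ ∈ lat τ := ⟨0, 1, by simp⟩

lemma link {τ : CC} {m : Fin 4 → ℕ} {Λ P : Set CC} (hΛ : ∀ z, z ∈ Λ ↔ z ∈ lat τ) (hP : singSet τ m = P) (hm : ∀ j, 1 ≤ m j → m j = 1) (u : CC → RR) :
    IsCurvatureSolution τ m u ↔ CS Λ P u := by
  subst hP
  constructor
  · rintro ⟨h1, h2, h3, h4⟩
    refine ⟨fun w hw => per_of h1 h2 w ((hΛ w).1 hw), h3, ?_⟩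
    rintro p ⟨j, hj, l, hl, rfl⟩
    obtain ⟨C, ε, e0, h⟩ := h4 j hj l hl
    refine ⟨C, ε, e0, fun z hz => ?_⟩
    have := h z hz.1 hz.2
    rwa [hm j hj, Nat.cast_one, mul_one] at this
  · rintro ⟨h1, h2, h3⟩
    refine ⟨h1 1 ((hΛ _).2 (one_lat τ)), h1 τ ((hΛ _).2 (tau_lat τ)), h2, fun j hj l hl => ?_⟩
    obtain ⟨C, ε, e0, h⟩ := h3 _ ⟨j, hj, l, hl, rfl⟩
    refine ⟨C, ε, e0, fun z hz hz' => ?_⟩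
    rw [hm j hj, Nat.cast_one, mul_one]
    exact h z ⟨hz, hz'⟩

lemma starM_one {k : ℕ} (j : Fin 4) (h : 1 ≤ starM k j) : starM k j = 1 := by
  unfold starM at *; split_ifs at * <;> omega
lemma starM_iff {k : ℕ} (j : Fin 4) : 1 ≤ starM k j ↔ (j : ℕ) = 0 ∨ (j : ℕ) = k := by
  unfold starM; split_ifs with h <;> simp only [h, iff_true, iff_false] <;> omega

lemma sing0 {τ : CC} {L : PeriodPair} (hL : ∀ z, z ∈ L.lattice ↔ z ∈ lat τ) : singSet τ (starM 0) = L.lattice := by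
  ext z
  simp only [singSet, starM_iff, mem_setOf_eq, SetLike.mem_coe, hL, or_self]
  constructor
  · rintro ⟨j, hj, l, hl, rfl⟩
    rw [hj]; simpa [per] using hl
  · intro h
    exact ⟨0, rfl, z, h, by simp [per]⟩

lemma singk {τ : CC} {L : PeriodPair} {k : ℕ} (hk : k < 4) (hω : L.ω₁ = per τ k) (hL : ∀ z, z ∈ L.lattice ↔ z ∈ lat τ) : singSet τ (starM k) = L.PS (L.ω₁ / 2) := by
  ext z
  simp only [singSet, starM_iff, mem_setOf_eq, PeriodPair.PS, hL, hω]
  constructor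
  · rintro ⟨j, hj | hj, l, hl, rfl⟩
    · left; rw [hj]; simpa [per] using hl
    · right; rw [hj]; simpa using hl
  · rintro (h | h)
    · exact ⟨0, Or.inl rfl, z, h, by simp [per]⟩
    · exact ⟨⟨k, hk⟩, Or.inr rfl, _, h, by simp⟩

lemma wz {τ : CC} (hτ : 0 < τ.im) {L : PeriodPair} (hL : ∀ z, z ∈ L.lattice ↔ z ∈ lat τ) (z : CC) : wzeta τ z = L.zt z := by
  rw [L.zt_split, wzeta]
  congr 1
  let g : ℤ × ℤ → L.lattice := fun p => ⟨latPt τ p, (hL _).2 ⟨p.1, p.2, rfl⟩⟩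
  have hb : Function.Bijective g := by
    constructor
    · intro p q e
      have e : latPt τ p = latPt τ q := congrArg Subtype.val e
      have := lat_lin hτ (x := p.1 - q.1) (y := p.2 - q.2) (by simp only [latPt] at e; push_cast; linear_combination e)
      have h1 : (p.1 : RR) = q.1 := by linarith [this.1]
      have h2 : (p.2 : RR) = q.2 := by linarith [this.2]
      exact Prod.ext (by exact_mod_cast h1) (by exact_mod_cast h2)
    · rintro ⟨l, hl⟩
      obtain ⟨m, n, e⟩ := (hL l).1 hl
      exact ⟨(m, n), Subtype.ext e.symm⟩
  have g0 : g 0 = 0 := Subtype.ext (by simp [g, latPt])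
  rw [← (Equiv.ofBijective g hb).tsum_eq]
  refine (tsum_subtype {p : ℤ × ℤ | p ≠ 0} (fun p => 1 / (z - latPt τ p) + 1 / latPt τ p + z / latPt τ p ^ 2)).trans ?_
  refine tsum_congr fun p => ?_
  by_cases hp : p = 0
  · subst hp
    simp [g0]
  · have : g p ≠ 0 := fun H => hp (hb.1 (H.trans g0.symm))
    have e : ((Equiv.ofBijective g hb) p) = g p := rfl
    rw [indicator_of_mem (by exact hp), e, if_neg this]

lemma hecke {τ : CC} (hτ : 0 < τ.im) {L : PeriodPair} (hL : ∀ z, z ∈ L.lattice ↔ z ∈ lat τ) :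
    (∃ a, L.Good a) ↔ ∃ r s : RR, ¬ IsHalfIntPair r s ∧ heckeZ r s τ = 0 := by
  have m1 : (1:CC) ∈ L.lattice := (hL _).2 (one_lat τ)
  have mt : τ ∈ L.lattice := (hL _).2 (tau_lat τ)
  have n1 : (1:CC) / 2 ∉ L.lattice := fun H => by
    obtain ⟨m, n, e⟩ := (hL _).1 H
    have := (lat_lin hτ (x := m - 1 / 2) (y := n) (by push_cast; linear_combination -e)).1
    have : (2 * m : RR) = 1 := by linarith
    have : (2 * m : ℤ) = 1 := by exact_mod_cast this
    omega
  have nt : τ / 2 ∉ L.lattice := fun H => by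
    obtain ⟨m, n, e⟩ := (hL _).1 H
    have := (lat_lin hτ (x := m) (y := n - 1 / 2) (by push_cast; linear_combination -e)).2
    have : (2 * n : RR) = 1 := by linarith
    have : (2 * n : ℤ) = 1 := by exact_mod_cast this
    omega
  have E1 : eta1 τ = L.et 1 := by rw [L.et_half m1 n1, eta1, wz hτ hL]
  have E2 : eta2 τ = L.et τ := by rw [L.et_half mt nt, eta2, wz hτ hL]
  have hz : ∀ r s : RR, heckeZ r s τ = L.zt (r + s * τ) - r * L.et 1 - s * L.et τ := fun r s => by rw [heckeZ, wz hτ hL, E1, E2]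
  have hi : ∀ r s : RR, 2 * ((r : CC) + s * τ) ∈ L.lattice ↔ IsHalfIntPair r s := fun r s => by
    rw [hL]
    constructor
    · rintro ⟨m, n, e⟩
      have := lat_lin hτ (x := 2 * r - m) (y := 2 * s - n) (by push_cast; linear_combination e)
      refine ⟨m, n, ?_, ?_⟩
      · have h : r = m / 2 := by linarith [this.1]
        rw [h]; push_cast; rfl
      · have h : s = n / 2 := by linarith [this.2]
        rw [h]; push_cast; rfl
    · rintro ⟨m, n, e1, e2⟩
      exact ⟨m, n, by rw [e1, e2]; ring⟩
  constructor
  · rintro ⟨a, h1, h2⟩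
    set s : RR := a.im / τ.im with hs
    set r : RR := a.re - s * τ.re with hr
    have ha : a = r + s * τ := by
      apply Complex.ext
      · simp [hr]
      · simp [hs, hτ.ne']
    refine ⟨r, s, fun H => h1 (by rw [ha]; exact (hi r s).2 H), ?_⟩
    rw [hz, ← ha]
    obtain ⟨n, hn⟩ := L.legendre m1 mt
    have k1 := h2 1 m1
    have k2 := h2 τ mt
    rw [PeriodPair.mu, Complex.norm_exp, Real.exp_eq_one_iff] at k1 k2
    set Z := L.zt a - r * L.et 1 - s * L.et τ with hZ
    have e1 : L.zt a * 1 - a * L.et 1 = Z - s * (n * (2 * Real.pi * Complex.I)) := by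
      rw [← hn, hZ]; nth_rewrite 2 [ha]; ring
    have e2 : L.zt a * τ - a * L.et τ = Z * τ + r * (n * (2 * Real.pi * Complex.I)) := by
      rw [← hn, hZ]; nth_rewrite 2 [ha]; ring
    rw [e1] at k1
    rw [e2] at k2
    have k1' : Z.re = 0 := by simpa using k1
    have k2' : Z.im = 0 := by simpa [k1', hτ.ne'] using k2
    exact Complex.ext k1' k2'
  · rintro ⟨r, s, h1, h2⟩
    rw [hz] at h2
    refine ⟨r + s * τ, fun H => h1 ((hi r s).1 H), fun w hw => ?_⟩
    obtain ⟨n, hn⟩ := L.legendre m1 hw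
    obtain ⟨p, hp⟩ := L.legendre mt hw
    rw [PeriodPair.mu, show L.zt (r + s * τ) * w - (r + s * τ) * L.et w = r * (n * (2 * Real.pi * Complex.I)) + s * (p * (2 * Real.pi * Complex.I)) by
      rw [← hn, ← hp]; linear_combination w * h2, Complex.norm_exp, Real.exp_eq_one_iff]
    simp

lemma unimod {e : CC} (h : ‖e‖ = 1) : ∃ θ : RR, e = Complex.exp (2 * Complex.I * θ) := by
  refine ⟨e.arg / 2, ?_⟩
  have := Complex.norm_mul_exp_arg_mul_I e
  rw [h, Complex.ofReal_one, one_mul] at this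
  rw [← this]; push_cast; congr 1
  rw [this]; ring

lemma nonEven {τ : CC} {L : PeriodPair} {k : ℕ} (hk : k < 4) (hω : L.ω₁ = per τ k) (hL : ∀ z, z ∈ L.lattice ↔ z ∈ lat τ) :
    HasNonEvenFamily τ (starM k) ↔ ∃ a, L.Good a := by
  have lk := link (Λ := L.lattice) hL (singk hk hω hL) starM_one
  constructor
  · rintro ⟨u, f, h1, h2, ⟨θ1, θ2, t1, t2⟩, h4⟩
    refine L.partC ((lk u).1 h1) h2 (fun w hw => ?_) (fun ⟨β, v, q1, q2⟩ => h4 ⟨β, v, (lk v).2 q1, q2⟩)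
    obtain ⟨m, n, rfl⟩ := (hL w).1 hw
    refine ⟨Complex.exp (2 * Complex.I * θ2) ^ n * Complex.exp (2 * Complex.I * θ1) ^ m, fun z => ?_⟩
    rw [← add_assoc, mult (Complex.exp_ne_zero _) t2 n, show z + (m : CC) = z + m * 1 by ring, mult (Complex.exp_ne_zero _) t1 m, ← mul_assoc]
  · rintro ⟨a, ha⟩
    obtain ⟨u, f, h1, h2, h3, h4⟩ := L.partB ha
    obtain ⟨e1, n1, t1⟩ := h3 1 ((hL _).2 (one_lat τ))
    obtain ⟨e2, n2, t2⟩ := h3 τ ((hL _).2 (tau_lat τ))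
    obtain ⟨θ1, rfl⟩ := unimod n1
    obtain ⟨θ2, rfl⟩ := unimod n2
    exact ⟨u, f, (lk u).2 h1, h2, ⟨θ1, θ2, t1, t2⟩, fun ⟨β, v, q1, q2⟩ => h4 ⟨β, v, (lk v).1 q1, q2⟩⟩

theorem fin0 (τ₀ : CC) (hτ₀ : 0 < τ₀.im) (k : ℕ) (hk : k = 1 ∨ k = 2 ∨ k = 3) :
    (HasNonEvenFamily τ₀ (starM k) ↔ ∃ r s : RR, ¬ IsHalfIntPair r s ∧ heckeZ r s τ₀ = 0) ∧
    (HasNonEvenFamily τ₀ (starM k) ↔ ∃ u : CC → RR, IsCurvatureSolution τ₀ (starM 0) u) := by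
  obtain ⟨L, hω, hL⟩ := exL hτ₀ hk
  rw [nonEven (by omega) hω hL]
  refine ⟨hecke hτ₀ hL, ?_⟩
  have lk := link (Λ := L.lattice) hL (sing0 hL) starM_one
  exact ⟨fun ⟨a, ha⟩ => ⟨_, (lk _).2 (L.partD ha)⟩, fun ⟨u, hu⟩ => L.partA ((lk u).1 hu)⟩
end

theorem statement0 (τ₀ : ℂ) (hτ₀ : 0 < τ₀.im) (k : ℕ) (hk : k = 1 ∨ k = 2 ∨ k = 3) :
    (HasNonEvenFamily τ₀ (starM k) ↔
      ∃ r s : ℝ, ¬ IsHalfIntPair (r : ℂ) (s : ℂ) ∧ heckeZ (r : ℂ) (s : ℂ) τ₀ = 0) ∧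
    (HasNonEvenFamily τ₀ (starM k) ↔
      ∃ u : ℂ → ℝ, IsCurvatureSolution τ₀ (starM 0) u) := by
  exact fin0 τ₀ hτ₀ k hk
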